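/- arXiv:1905.04751 — 4 statements merged into one kernel-verified Lean document; each statement's English description precedes it below -/
import Mathlib

section
/- Every extreme ray of the cone 𝒞 is generated by a rank 1 matrix of the form v v^⊤ with v = v(x,y,z) for some real x, y, z. Precisely: if A is a nonzero element of 𝒞 such that whenever A = B + C with B, C ∈ 𝒞, both B and C are nonnegative scalar multiples of A, then there exist real numbers x, y, z with A = v(x,y,z) v(x,y,z)^⊤. -/
open Matrix

/-- The vector `v(x,y,z) = (x², xy, xz, y², yz, z²)ᵀ ∈ ℝ⁶`. -/
def v (x y z : ℝ) : Fin 6 → ℝ := ![x ^ 2, x * y, x * z, y ^ 2, y * z, z ^ 2]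

/-- Membership in the cone 𝒞 of 6×6 real positive semidefinite matrices
satisfying `a₁₄ = a₂₂`, `a₁₅ = a₂₃`, `a₁₆ = a₃₃`, `a₂₅ = a₃₄`, `a₂₆ = a₃₅`,
`a₄₆ = a₅₅` (1-based indexing). -/
def memC (A : Matrix (Fin 6) (Fin 6) ℝ) : Prop :=
  A.PosSemidef ∧ A 0 3 = A 1 1 ∧ A 0 4 = A 1 2 ∧ A 0 5 = A 2 2 ∧
    A 1 4 = A 2 3 ∧ A 1 5 = A 2 4 ∧ A 3 5 = A 4 4

/-- The moment matrix of a ternary quartic functional. -/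
def Mom (m : Fin 15 → ℝ) : Matrix (Fin 6) (Fin 6) ℝ :=
  !![m 0, m 1, m 2, m 3, m 4, m 5;
     m 1, m 3, m 4, m 6, m 7, m 8;
     m 2, m 4, m 5, m 7, m 8, m 9;
     m 3, m 6, m 7, m 10, m 11, m 12;
     m 4, m 7, m 8, m 11, m 12, m 13;
     m 5, m 8, m 9, m 12, m 13, m 14]

/-- Coefficient vector of a product of two linear forms. -/
def sp (l m : Fin 3 → ℝ) : Fin 6 → ℝ :=
  ![l 0 * m 0, l 0 * m 1 + l 1 * m 0, l 0 * m 2 + l 2 * m 0, l 1 * m 1,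
    l 1 * m 2 + l 2 * m 1, l 2 * m 2]

/-- Action of a linear change of coordinates on quadratic forms. -/
def S2 (g : Matrix (Fin 3) (Fin 3) ℝ) : Matrix (Fin 6) (Fin 6) ℝ :=
  Matrix.of ![sp (g 0) (g 0), sp (g 0) (g 1), sp (g 0) (g 2), sp (g 1) (g 1),
    sp (g 1) (g 2), sp (g 2) (g 2)]

lemma sp_comm (l m : Fin 3 → ℝ) : sp l m = sp m l := by
  funext i
  fin_cases i <;> simp [sp] <;> ring

lemma isMom_iff (A : Matrix (Fin 6) (Fin 6) ℝ) :
    (∃ m, A = Mom m) ↔ (A.IsSymm ∧ A 0 3 = A 1 1 ∧ A 0 4 = A 1 2 ∧ A 0 5 = A 2 2 ∧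
    A 1 4 = A 2 3 ∧ A 1 5 = A 2 4 ∧ A 3 5 = A 4 4) := by
  constructor
  · rintro ⟨m, rfl⟩
    refine ⟨?_, ?_⟩
    · ext i j
      fin_cases i <;> fin_cases j <;> rfl
    · simp [Mom]
  · rintro ⟨hs, h1, h2, h3, h4, h5, h6⟩
    refine ⟨![A 0 0, A 0 1, A 0 2, A 0 3, A 0 4, A 0 5, A 1 3, A 1 4, A 1 5, A 2 5,
      A 3 3, A 3 4, A 3 5, A 4 5, A 5 5], ?_⟩
    have h := fun i j => hs.apply i j
    ext i j
    have := h i j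
    fin_cases i <;> fin_cases j <;> simp [Mom] <;> simp at this <;> linarith

lemma T_symm (m : Fin 15 → ℝ) (a b c d : Fin 3 → ℝ) :
    sp a b ⬝ᵥ (Mom m *ᵥ sp c d) = sp a c ⬝ᵥ (Mom m *ᵥ sp b d) := by
  simp only [dotProduct, mulVec, Fin.sum_univ_six, Mom, sp, Matrix.of_apply, Matrix.cons_val]
  ring

lemma S2_mul (g h : Matrix (Fin 3) (Fin 3) ℝ) : S2 (g * h) = S2 g * S2 h := by
  ext i j
  fin_cases i <;> fin_cases j <;>
    simp [S2, sp, Matrix.mul_apply, Fin.sum_univ_succ] <;> ring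

lemma S2_one : S2 1 = 1 := by
  ext i j
  fin_cases i <;> fin_cases j <;> simp [S2, sp]

lemma S2_sp (g : Matrix (Fin 3) (Fin 3) ℝ) (l m : Fin 3 → ℝ) :
    (S2 g)ᵀ *ᵥ sp l m = sp (gᵀ *ᵥ l) (gᵀ *ᵥ m) := by
  funext i
  fin_cases i <;>
    simp [S2, sp, mulVec, dotProduct, Fin.sum_univ_succ] <;> ring

lemma S2_v (g : Matrix (Fin 3) (Fin 3) ℝ) (x y z : ℝ) :
    S2 g *ᵥ v x y z = v ((g *ᵥ ![x, y, z]) 0) ((g *ᵥ ![x, y, z]) 1) ((g *ᵥ ![x, y, z]) 2) := by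
  funext i
  fin_cases i <;>
    simp [S2, sp, v, mulVec, dotProduct, Fin.sum_univ_succ] <;> ring

lemma S2_entry (g : Matrix (Fin 3) (Fin 3) ℝ) (A : Matrix (Fin 6) (Fin 6) ℝ) (i j : Fin 6) :
    (S2 g * A * (S2 g)ᵀ) i j = S2 g i ⬝ᵥ (A *ᵥ S2 g j) := by
  rw [Matrix.mul_assoc, Matrix.mul_apply]
  rfl

lemma conj_mom (g : Matrix (Fin 3) (Fin 3) ℝ) (m : Fin 15 → ℝ) :
    ∃ m', S2 g * Mom m * (S2 g)ᵀ = Mom m' := by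
  rw [isMom_iff]
  refine ⟨?_, ?_⟩
  · have := ((isMom_iff (Mom m)).1 ⟨m, rfl⟩).1
    unfold Matrix.IsSymm at *
    rw [Matrix.transpose_mul, Matrix.transpose_mul, Matrix.transpose_transpose, this,
      Matrix.mul_assoc]
  · simp only [S2_entry]
    refine ⟨T_symm m (g 0) (g 0) (g 1) (g 1), T_symm m (g 0) (g 0) (g 1) (g 2),
      T_symm m (g 0) (g 0) (g 2) (g 2), ?_, T_symm m (g 0) (g 1) (g 2) (g 2),
      T_symm m (g 1) (g 1) (g 2) (g 2)⟩
    have := T_symm m (g 0) (g 1) (g 2) (g 1)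
    rw [sp_comm (g 2)] at this
    exact this

structure ExtM (A : Matrix (Fin 6) (Fin 6) ℝ) : Prop where
  mom : ∃ m, A = Mom m
  psd : A.PosSemidef
  ext : ∀ m, (∀ u, A *ᵥ u = 0 → Mom m *ᵥ u = 0) → ∃ c : ℝ, Mom m = c • A

def Goal (A : Matrix (Fin 6) (Fin 6) ℝ) : Prop :=
  ∃ x y z : ℝ, A = vecMulVec (v x y z) (v x y z)

lemma S2_inv {g : Matrix (Fin 3) (Fin 3) ℝ} (hg : IsUnit g.det) :
    S2 g * S2 g⁻¹ = 1 ∧ S2 g⁻¹ * S2 g = 1 := by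
  rw [← S2_mul, ← S2_mul, Matrix.mul_nonsing_inv _ hg, Matrix.nonsing_inv_mul _ hg, S2_one]
  simp

lemma S2_invT {g : Matrix (Fin 3) (Fin 3) ℝ} (hg : IsUnit g.det) :
    (S2 g)ᵀ * (S2 g⁻¹)ᵀ = 1 ∧ (S2 g⁻¹)ᵀ * (S2 g)ᵀ = 1 := by
  rw [← Matrix.transpose_mul, ← Matrix.transpose_mul, (S2_inv hg).1, (S2_inv hg).2]
  simp

lemma conj_back {g : Matrix (Fin 3) (Fin 3) ℝ} (hg : IsUnit g.det)
    (A : Matrix (Fin 6) (Fin 6) ℝ) :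
    S2 g * (S2 g⁻¹ * A * (S2 g⁻¹)ᵀ) * (S2 g)ᵀ = A := by
  calc S2 g * (S2 g⁻¹ * A * (S2 g⁻¹)ᵀ) * (S2 g)ᵀ
      = (S2 g * S2 g⁻¹) * A * ((S2 g⁻¹)ᵀ * (S2 g)ᵀ) := by simp only [Matrix.mul_assoc]
    _ = A := by rw [(S2_inv hg).1, (S2_invT hg).2]; simp

lemma conj_back' {g : Matrix (Fin 3) (Fin 3) ℝ} (hg : IsUnit g.det)
    (A : Matrix (Fin 6) (Fin 6) ℝ) :
    S2 g⁻¹ * (S2 g * A * (S2 g)ᵀ) * (S2 g⁻¹)ᵀ = A := by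
  calc S2 g⁻¹ * (S2 g * A * (S2 g)ᵀ) * (S2 g⁻¹)ᵀ
      = (S2 g⁻¹ * S2 g) * A * ((S2 g)ᵀ * (S2 g⁻¹)ᵀ) := by simp only [Matrix.mul_assoc]
    _ = A := by rw [(S2_inv hg).2, (S2_invT hg).1]; simp

lemma Goal_of_conj {g : Matrix (Fin 3) (Fin 3) ℝ} (hg : IsUnit g.det)
    {A : Matrix (Fin 6) (Fin 6) ℝ} (h : Goal (S2 g * A * (S2 g)ᵀ)) : Goal A := by
  obtain ⟨x, y, z, h⟩ := h
  have h2 := conj_back' hg A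
  rw [h, Matrix.mul_vecMulVec, Matrix.vecMulVec_mul, Matrix.vecMul_transpose, S2_v] at h2
  exact ⟨_, _, _, h2.symm⟩

lemma conj_mulVec {g : Matrix (Fin 3) (Fin 3) ℝ} (hg : IsUnit g.det)
    (A : Matrix (Fin 6) (Fin 6) ℝ) (u : Fin 6 → ℝ) :
    (S2 g * A * (S2 g)ᵀ) *ᵥ u = 0 ↔ A *ᵥ ((S2 g)ᵀ *ᵥ u) = 0 := by
  rw [Matrix.mulVec_mulVec]
  constructor
  · intro h
    have : S2 g⁻¹ *ᵥ ((S2 g * A * (S2 g)ᵀ) *ᵥ u) = 0 := by rw [h]; simp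
    rw [Matrix.mulVec_mulVec, Matrix.mul_assoc, ← Matrix.mul_assoc (S2 g⁻¹),
      (S2_inv hg).2, Matrix.one_mul] at this
    exact this
  · intro h
    rw [Matrix.mul_assoc, ← Matrix.mulVec_mulVec, h]; simp

lemma ExtM.conj {A : Matrix (Fin 6) (Fin 6) ℝ} (h : ExtM A) {g : Matrix (Fin 3) (Fin 3) ℝ}
    (hg : IsUnit g.det) : ExtM (S2 g * A * (S2 g)ᵀ) := by
  refine ⟨?_, ?_, ?_⟩
  · obtain ⟨m, rfl⟩ := h.mom
    exact conj_mom g m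
  · have := h.psd.mul_mul_conjTranspose_same (S2 g)
    rwa [Matrix.conjTranspose_eq_transpose_of_trivial] at this
  · intro m hm
    obtain ⟨m', hm'⟩ := conj_mom g⁻¹ m
    obtain ⟨c, hc⟩ := h.ext m' (by
      intro u hu
      rw [← hm', ← Matrix.mulVec_mulVec, ← Matrix.mulVec_mulVec, hm]
      · simp
      · rw [conj_mulVec hg, Matrix.mulVec_mulVec _ (S2 g)ᵀ, (S2_invT hg).1, Matrix.one_mulVec, hu])
    refine ⟨c, ?_⟩
    rw [← conj_back hg (Mom m), hm', hc]
    simp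

lemma psd_ker {A : Matrix (Fin 6) (Fin 6) ℝ} (h : A.PosSemidef) (u : Fin 6 → ℝ)
    (hu : u ⬝ᵥ (A *ᵥ u) = 0) : A *ᵥ u = 0 := by
  exact (h.dotProduct_mulVec_zero_iff u).1 (by simpa using hu)

lemma psd_nonneg {A : Matrix (Fin 6) (Fin 6) ℝ} (h : A.PosSemidef) (u : Fin 6 → ℝ) :
    0 ≤ u ⬝ᵥ (A *ᵥ u) := by
  simpa using h.dotProduct_mulVec_nonneg u

/-- `l` annihilates the functional. -/
def Nl (A : Matrix (Fin 6) (Fin 6) ℝ) (l : Fin 3 → ℝ) : Prop := ∀ m, A *ᵥ sp l m = 0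

lemma Nl_conj {A : Matrix (Fin 6) (Fin 6) ℝ} {g : Matrix (Fin 3) (Fin 3) ℝ}
    (hg : IsUnit g.det) (l : Fin 3 → ℝ) :
    Nl (S2 g * A * (S2 g)ᵀ) l ↔ Nl A (gᵀ *ᵥ l) := by
  constructor
  · intro h m
    have := (conj_mulVec hg _ _).1 (h ((g⁻¹)ᵀ *ᵥ m))
    rw [S2_sp, Matrix.mulVec_mulVec _ gᵀ, ← Matrix.transpose_mul, Matrix.nonsing_inv_mul _ hg] at this
    simpa using this
  · intro h m
    rw [conj_mulVec hg, S2_sp]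
    exact h _

lemma Nl_of_sq {A : Matrix (Fin 6) (Fin 6) ℝ} (h : ExtM A) (l : Fin 3 → ℝ)
    (hl : A *ᵥ sp l l = 0) : Nl A l := by
  intro k
  apply psd_ker h.psd
  obtain ⟨m, rfl⟩ := h.mom
  rw [sp_comm l k, T_symm m k l k l, hl, dotProduct_zero]

lemma quad_bound (T : Matrix (Fin 6) (Fin 6) ℝ) :
    ∃ K : ℝ, 0 < K ∧ ∀ y : Fin 6 → ℝ, |y ⬝ᵥ (T *ᵥ y)| ≤ K * (y ⬝ᵥ y) := by
  refine ⟨1 + ∑ i, ∑ j, |T i j|, by positivity, fun y => ?_⟩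
  have hle : ∀ i j, |y i * y j| ≤ y ⬝ᵥ y := by
    intro i j
    have hi : ∀ k, y k * y k ≤ y ⬝ᵥ y := fun k =>
      Finset.single_le_sum (f := fun k => y k * y k) (fun k _ => mul_self_nonneg _)
        (Finset.mem_univ k)
    have h1 := hi i
    have h2 := hi j
    rw [abs_le]
    constructor <;> nlinarith [sq_nonneg (y i + y j), sq_nonneg (y i - y j)]
  have h0 : 0 ≤ y ⬝ᵥ y := Finset.sum_nonneg fun k _ => mul_self_nonneg _
  calc |y ⬝ᵥ (T *ᵥ y)| = |∑ i, ∑ j, T i j * (y i * y j)| := by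
        congr 1
        simp only [dotProduct, mulVec, Finset.mul_sum]
        refine Finset.sum_congr rfl fun i _ => Finset.sum_congr rfl fun j _ => by ring
    _ ≤ ∑ i, ∑ j, |T i j| * (y ⬝ᵥ y) := by
        refine (Finset.abs_sum_le_sum_abs _ _).trans (Finset.sum_le_sum fun i _ => ?_)
        refine (Finset.abs_sum_le_sum_abs _ _).trans (Finset.sum_le_sum fun j _ => ?_)
        rw [abs_mul]
        exact mul_le_mul_of_nonneg_left (hle i j) (abs_nonneg _)
    _ = (∑ i, ∑ j, |T i j|) * (y ⬝ᵥ y) := by simp only [Finset.sum_mul]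
    _ ≤ _ := by nlinarith

lemma psd_factor {A : Matrix (Fin 6) (Fin 6) ℝ} (hA : A.PosSemidef) :
    ∃ M : Matrix (Fin 6) (Fin 6) ℝ, A = Mᵀ * M := by
  classical
  open scoped MatrixOrder in
  have h := CStarAlgebra.nonneg_iff_eq_star_mul_self.1 hA.nonneg
  obtain ⟨M, hM⟩ := h
  exact ⟨M, by rw [hM, Matrix.star_eq_conjTranspose, Matrix.conjTranspose_eq_transpose_of_trivial]⟩

lemma exists_pinv (M : Matrix (Fin 6) (Fin 6) ℝ) :
    ∃ P : Matrix (Fin 6) (Fin 6) ℝ, ∀ x, M *ᵥ (P *ᵥ (M *ᵥ x)) = M *ᵥ x := by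
  let f := Matrix.toLin' M
  obtain ⟨r, hr⟩ := f.rangeRestrict.exists_rightInverse_of_surjective (by simp)
  obtain ⟨P, hP⟩ := LinearMap.exists_extend r
  refine ⟨LinearMap.toMatrix' P, fun x => ?_⟩
  rw [LinearMap.toMatrix'_mulVec]
  have h1 : P (M *ᵥ x) = r (f.rangeRestrict x) := by
    rw [← hP]; rfl
  have h2 := LinearMap.congr_fun hr (f.rangeRestrict x)
  rw [h1]
  have h3 := congrArg Subtype.val h2
  exact h3

lemma perturb {A B : Matrix (Fin 6) (Fin 6) ℝ} (hA : A.PosSemidef) (hB : B.IsSymm)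
    (hk : ∀ u, A *ᵥ u = 0 → B *ᵥ u = 0) :
    ∃ K : ℝ, 0 < K ∧ ∀ x, |x ⬝ᵥ (B *ᵥ x)| ≤ K * (x ⬝ᵥ (A *ᵥ x)) := by
  obtain ⟨M, rfl⟩ := psd_factor hA
  obtain ⟨P, hP⟩ := exists_pinv M
  obtain ⟨K, hK, hb⟩ := quad_bound (Pᵀ * B * P)
  refine ⟨K, hK, fun x => ?_⟩
  have h1 : B *ᵥ x = B *ᵥ (P *ᵥ (M *ᵥ x)) := by
    have := hk (x - P *ᵥ (M *ᵥ x)) (by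
      rw [← Matrix.mulVec_mulVec, Matrix.mulVec_sub, hP, sub_self, Matrix.mulVec_zero])
    rw [Matrix.mulVec_sub] at this
    exact sub_eq_zero.1 this
  have hsym : ∀ a b : Fin 6 → ℝ, a ⬝ᵥ (B *ᵥ b) = b ⬝ᵥ (B *ᵥ a) := by
    intro a b
    rw [Matrix.dotProduct_mulVec, dotProduct_comm, ← Matrix.mulVec_transpose, hB]
  have hq := hb (M *ᵥ x)
  have e1 : x ⬝ᵥ (B *ᵥ x) = (M *ᵥ x) ⬝ᵥ ((Pᵀ * B * P) *ᵥ (M *ᵥ x)) := by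
    rw [h1, hsym, h1, ← Matrix.mulVec_mulVec, ← Matrix.mulVec_mulVec,
      Matrix.dotProduct_mulVec (M *ᵥ x), Matrix.vecMul_transpose]
  have e2 : x ⬝ᵥ ((Mᵀ * M) *ᵥ x) = (M *ᵥ x) ⬝ᵥ (M *ᵥ x) := by
    rw [← Matrix.mulVec_mulVec, Matrix.dotProduct_mulVec, Matrix.vecMul_transpose]
  rw [e1, e2]
  exact hq

lemma memC_iff (A : Matrix (Fin 6) (Fin 6) ℝ) : memC A ↔ A.PosSemidef ∧ ∃ m, A = Mom m := by
  rw [isMom_iff]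
  unfold memC
  constructor
  · rintro ⟨h, h'⟩
    refine ⟨h, ?_, h'⟩
    have := h.isHermitian
    rwa [Matrix.IsHermitian, Matrix.conjTranspose_eq_transpose_of_trivial] at this
  · rintro ⟨h, -, h'⟩
    exact ⟨h, h'⟩

lemma Mom_lin (a b : ℝ) (m n : Fin 15 → ℝ) : a • Mom m + b • Mom n = Mom (a • m + b • n) := by
  ext i j
  fin_cases i <;> fin_cases j <;> simp [Mom]

lemma Mom_symm (m : Fin 15 → ℝ) : (Mom m).IsSymm := ((isMom_iff _).1 ⟨m, rfl⟩).1

lemma memC_lin {m n : Fin 15 → ℝ} {K e : ℝ} (hK : 0 < K) (he : e = 1 ∨ e = -1)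
    (h : ∀ x, |x ⬝ᵥ (Mom n *ᵥ x)| ≤ K * (x ⬝ᵥ (Mom m *ᵥ x))) :
    memC ((1 / 2 : ℝ) • Mom m + (e / (2 * K)) • Mom n) := by
  rw [memC_iff, Mom_lin]
  refine ⟨?_, _, rfl⟩
  apply Matrix.PosSemidef.of_dotProduct_mulVec_nonneg
  · rw [Matrix.IsHermitian, Matrix.conjTranspose_eq_transpose_of_trivial]
    exact Mom_symm _
  · intro x
    rw [← Mom_lin, Matrix.add_mulVec, Matrix.smul_mulVec, Matrix.smul_mulVec]
    simp only [star_trivial, dotProduct_add, dotProduct_smul, smul_eq_mul]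
    have := abs_le.1 (h x)
    have e1 : (1 / 2 : ℝ) * (x ⬝ᵥ (Mom m *ᵥ x)) + e / (2 * K) * (x ⬝ᵥ (Mom n *ᵥ x))
      = (K * (x ⬝ᵥ (Mom m *ᵥ x)) + e * (x ⬝ᵥ (Mom n *ᵥ x))) / (2 * K) := by
      field_simp
    rw [e1]
    apply div_nonneg _ (by positivity)
    rcases he with rfl | rfl <;> linarith

lemma extM_of_extreme (A : Matrix (Fin 6) (Fin 6) ℝ) (hA : memC A)
    (hext : ∀ B C : Matrix (Fin 6) (Fin 6) ℝ, memC B → memC C → A = B + C →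
      (∃ s : ℝ, 0 ≤ s ∧ B = s • A) ∧ (∃ t : ℝ, 0 ≤ t ∧ C = t • A)) : ExtM A := by
  obtain ⟨hp, m, rfl⟩ := (memC_iff A).1 hA
  refine ⟨⟨m, rfl⟩, hp, fun n hn => ?_⟩
  obtain ⟨K, hK, h⟩ := perturb hp (Mom_symm n) hn
  obtain ⟨⟨s, -, hs⟩, -⟩ := hext _ _ (memC_lin hK (Or.inl rfl) h) (memC_lin hK (Or.inr rfl) h) (by
    rw [Mom_lin, Mom_lin]
    have := Mom_lin 1 1 ((1 / 2 : ℝ) • m + (1 / (2 * K)) • n) ((1 / 2 : ℝ) • m + (-1 / (2 * K)) • n)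
    rw [one_smul, one_smul] at this
    rw [this]
    congr 1
    funext i
    simp
    ring)
  refine ⟨2 * K * (s - 1 / 2), ?_⟩
  ext i j
  have := congrFun (congrFun hs i) j
  simp only [Matrix.add_apply, Matrix.smul_apply, smul_eq_mul] at this ⊢
  field_simp at this
  linarith

lemma diag_ker {A : Matrix (Fin 6) (Fin 6) ℝ} (h : A.PosSemidef) (i : Fin 6)
    (hi : A i i = 0) (j : Fin 6) : A j i = 0 := by
  have := psd_ker h (Pi.single i 1) (by simp [hi])
  simpa using congrFun this j

lemma Nl_smul_sq {A : Matrix (Fin 6) (Fin 6) ℝ} (h : ExtM A) (l : Fin 3 → ℝ)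
    (hl : sp l l ⬝ᵥ (A *ᵥ sp l l) = 0) : Nl A l :=
  Nl_of_sq h l (psd_ker h.psd _ hl)

lemma prime0 {A : Matrix (Fin 6) (Fin 6) ℝ} (h : ExtM A)
    (hxy : A *ᵥ sp ![1, 0, 0] ![0, 1, 0] = 0) : Nl A ![1, 0, 0] ∨ Nl A ![0, 1, 0] := by
  obtain ⟨m, rfl⟩ := h.mom
  have hc : ∀ j, (Mom m *ᵥ sp ![1, 0, 0] ![0, 1, 0]) j = 0 := fun j => by rw [hxy]; rfl
  have c0 : m 1 = 0 := by simpa [Mom, sp, mulVec, dotProduct, Fin.sum_univ_succ] using hc 0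
  have c1 : m 3 = 0 := by simpa [Mom, sp, mulVec, dotProduct, Fin.sum_univ_succ] using hc 1
  have c2 : m 4 = 0 := by simpa [Mom, sp, mulVec, dotProduct, Fin.sum_univ_succ] using hc 2
  have c3 : m 6 = 0 := by simpa [Mom, sp, mulVec, dotProduct, Fin.sum_univ_succ] using hc 3
  have c4 : m 7 = 0 := by simpa [Mom, sp, mulVec, dotProduct, Fin.sum_univ_succ] using hc 4
  have c5 : m 8 = 0 := by simpa [Mom, sp, mulVec, dotProduct, Fin.sum_univ_succ] using hc 5
  have rows : ∀ u, Mom m *ᵥ u = 0 → m 0 * u 0 + m 2 * u 2 + m 5 * u 5 = 0 ∧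
      m 2 * u 0 + m 5 * u 2 + m 9 * u 5 = 0 := by
    intro u hu
    have r0 := congrFun hu 0
    have r2 := congrFun hu 2
    simp only [mulVec, dotProduct, Fin.sum_univ_six, Mom, Matrix.of_apply, Matrix.cons_val,
      c0, c1, c2, c3, c4, c5, Pi.zero_apply] at r0 r2
    constructor <;> linarith
  have key : ∀ u, Mom m *ᵥ u = 0 → u 5 = 0 → m 5 * u 0 + m 9 * u 2 = 0 := by
    intro u hu h5
    obtain ⟨r0, r2⟩ := rows u hu
    rw [h5] at r0 r2
    have := psd_ker h.psd ![u 0, 0, u 2, 0, 0, 0] (by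
      simp only [mulVec, dotProduct, Fin.sum_univ_six, Mom, Matrix.of_apply, Matrix.cons_val]
      linear_combination u 0 * r0 + u 2 * r2)
    have r5 := congrFun this 5
    simp only [mulVec, dotProduct, Fin.sum_univ_six, Mom, Matrix.of_apply, Matrix.cons_val,
      Pi.zero_apply] at r5
    linarith
  have hb : ∃ b : ℝ, ∀ u, Mom m *ᵥ u = 0 → m 5 * u 0 + m 9 * u 2 + b * u 5 = 0 := by
    by_cases hq : ∃ q, Mom m *ᵥ q = 0 ∧ q 5 ≠ 0
    · obtain ⟨q, hq, hq5⟩ := hq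
      refine ⟨-(m 5 * q 0 + m 9 * q 2) / q 5, fun u hu => ?_⟩
      have := key (u - (u 5 / q 5) • q) (by
        rw [Matrix.mulVec_sub, Matrix.mulVec_smul, hu, hq]; simp) (by simp [hq5])
      simp only [Pi.sub_apply, Pi.smul_apply, smul_eq_mul] at this
      field_simp at this ⊢
      linarith
    · push Not at hq
      exact ⟨0, fun u hu => by rw [zero_mul, add_zero]; exact key u hu (hq u hu)⟩
  obtain ⟨b, hb⟩ := hb
  obtain ⟨c, hc⟩ := h.ext ![m 0, 0, m 2, 0, 0, m 5, 0, 0, 0, m 9, 0, 0, 0, 0, b] (by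
    intro u hu
    obtain ⟨r0, r2⟩ := rows u hu
    have r5 := hb u hu
    funext i
    fin_cases i <;>
      simp [mulVec, dotProduct, Fin.sum_univ_six, Mom] <;> linarith)
  by_cases hc0 : c = 0
  · left
    apply Nl_smul_sq h
    have := congrFun (congrFun hc 0) 0
    simp [Mom, hc0] at this
    simp [Mom, sp, mulVec, dotProduct, Fin.sum_univ_succ, this]
  · right
    apply Nl_smul_sq h
    have := congrFun (congrFun hc 3) 3
    simp [Mom, hc0] at this
    simp [Mom, sp, mulVec, dotProduct, Fin.sum_univ_succ, this]

/-- Third vector of a frame. -/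
def cr (l m : Fin 3 → ℝ) : Fin 3 → ℝ :=
  ![l 1 * m 2 - l 2 * m 1, l 2 * m 0 - l 0 * m 2, l 0 * m 1 - l 1 * m 0]

def gm (l m : Fin 3 → ℝ) : Matrix (Fin 3) (Fin 3) ℝ := Matrix.of ![l, m, cr l m]

lemma gm_det {l m : Fin 3 → ℝ} (h : cr l m ≠ 0) : IsUnit (gm l m).det := by
  rw [isUnit_iff_ne_zero]
  intro hd
  apply h
  have e : (gm l m).det = cr l m 0 ^ 2 + cr l m 1 ^ 2 + cr l m 2 ^ 2 := by
    rw [Matrix.det_fin_three]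
    simp [gm, cr]
    ring
  rw [e] at hd
  funext i
  have h0 := sq_nonneg (cr l m 0)
  have h1 := sq_nonneg (cr l m 1)
  have h2 := sq_nonneg (cr l m 2)
  fin_cases i
  · exact pow_eq_zero_iff (two_ne_zero) |>.1 (by linarith : cr l m 0 ^ 2 = 0)
  · exact pow_eq_zero_iff (two_ne_zero) |>.1 (by linarith : cr l m 1 ^ 2 = 0)
  · exact pow_eq_zero_iff (two_ne_zero) |>.1 (by linarith : cr l m 2 ^ 2 = 0)

lemma gm_0 (l m : Fin 3 → ℝ) : (gm l m)ᵀ *ᵥ ![1, 0, 0] = l := by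
  funext i
  fin_cases i <;> simp [gm, mulVec, dotProduct, Fin.sum_univ_succ]

lemma gm_1 (l m : Fin 3 → ℝ) : (gm l m)ᵀ *ᵥ ![0, 1, 0] = m := by
  funext i
  fin_cases i <;> simp [gm, mulVec, dotProduct, Fin.sum_univ_succ]

lemma exists_cr {l : Fin 3 → ℝ} (hl : l ≠ 0) : ∃ m, cr l m ≠ 0 := by
  by_contra hcon
  push Not at hcon
  apply hl
  have h1 := hcon ![1, 0, 0]
  have h2 := hcon ![0, 1, 0]
  funext i
  fin_cases i
  · simpa [cr] using congrFun h2 2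
  · simpa [cr] using congrFun h1 2
  · simpa [cr] using congrFun h1 1

lemma prime {A : Matrix (Fin 6) (Fin 6) ℝ} (h : ExtM A) {l m : Fin 3 → ℝ}
    (hlm : A *ᵥ sp l m = 0) : Nl A l ∨ Nl A m := by
  by_cases hc : cr l m = 0
  · by_cases hl : l = 0
    · left
      intro k
      have : sp l k = 0 := by
        subst hl
        funext i
        fin_cases i <;> simp [sp]
      rw [this, Matrix.mulVec_zero]
    · right
      have hm : ∃ t : ℝ, m = t • l := by
        obtain ⟨i, hi⟩ := Function.ne_iff.1 hl
        simp only [Pi.zero_apply] at hi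
        have h0 : l 1 * m 2 - l 2 * m 1 = 0 := by simpa [cr] using congrFun hc 0
        have h1 : l 2 * m 0 - l 0 * m 2 = 0 := by simpa [cr] using congrFun hc 1
        have h2 : l 0 * m 1 - l 1 * m 0 = 0 := by simpa [cr] using congrFun hc 2
        refine ⟨m i / l i, ?_⟩
        funext j
        simp only [Pi.smul_apply, smul_eq_mul]
        fin_cases i <;> fin_cases j <;> simp at hi ⊢ <;> field_simp <;> linarith
      obtain ⟨t, rfl⟩ := hm
      apply Nl_of_sq h
      have : sp (t • l) (t • l) = t • sp l (t • l) := by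
        funext i
        fin_cases i <;> simp [sp] <;> ring
      rw [this, Matrix.mulVec_smul, hlm, smul_zero]
  · have hg := gm_det hc
    have := prime0 (h.conj hg) (by rw [conj_mulVec hg, S2_sp, gm_0, gm_1, hlm])
    rwa [Nl_conj hg, Nl_conj hg, gm_0, gm_1] at this

/-- A binary quadratic form in the kernel produces an annihilating linear form. -/
lemma binary {A : Matrix (Fin 6) (Fin 6) ℝ} (h : ExtM A) {a b c : ℝ}
    (hne : ¬ (a = 0 ∧ b = 0 ∧ c = 0)) (hq : A *ᵥ ![0, 0, 0, a, b, c] = 0) :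
    ∃ l : Fin 3 → ℝ, l 0 = 0 ∧ l ≠ 0 ∧ Nl A l := by
  by_cases ha : a = 0
  · have : sp ![0, 0, 1] ![0, b, c] = ![0, 0, 0, a, b, c] := by
      subst ha
      funext i
      fin_cases i <;> simp [sp]
    rw [← this] at hq
    rcases prime h hq with h1 | h1
    · refine ⟨_, ?_, ?_, h1⟩
      · simp
      · intro h; simpa using congrFun h 2
    · refine ⟨_, ?_, ?_, h1⟩
      · simp
      · intro h
        exact hne ⟨ha, by simpa using congrFun h 1, by simpa using congrFun h 2⟩
  · by_cases hd : 0 ≤ b ^ 2 - 4 * a * c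
    · set d := Real.sqrt (b ^ 2 - 4 * a * c) with hdd
      have hs : d ^ 2 = b ^ 2 - 4 * a * c := Real.sq_sqrt hd
      have : sp ![0, 2 * a, b + d] ![0, 2 * a, b - d] = (4 * a) • ![0, 0, 0, a, b, c] := by
        funext i
        fin_cases i <;> simp [sp] <;> linarith
      have h2 : A *ᵥ sp ![0, 2 * a, b + d] ![0, 2 * a, b - d] = 0 := by
        rw [this, Matrix.mulVec_smul, hq, smul_zero]
      rcases prime h h2 with h1 | h1
      · refine ⟨_, ?_, ?_, h1⟩
        · simp
        · intro h; exact ha (by simpa using congrFun h 1)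
      · refine ⟨_, ?_, ?_, h1⟩
        · simp
        · intro h; exact ha (by simpa using congrFun h 1)
    · push Not at hd
      refine ⟨![0, 0, 1], by simp, fun h => by simpa using congrFun h 2, ?_⟩
      set u : Fin 3 → ℝ := ![0, 2 * a, b] with hu
      set w : Fin 3 → ℝ := ![0, 0, 1] with hw
      set k := 4 * a * c - b ^ 2 with hk
      have hkp : 0 < k := by linarith
      have e : sp u u + k • sp w w = (4 * a) • ![0, 0, 0, a, b, c] := by
        funext i
        fin_cases i <;> simp [sp, hu, hw, hk] <;> ring
      apply Nl_smul_sq h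
      have h0 : (sp u u + k • sp w w) ⬝ᵥ (A *ᵥ (sp u u + k • sp w w)) = 0 := by
        rw [e, Matrix.mulVec_smul, hq]; simp
      have p1 := psd_nonneg h.psd (sp u u)
      have p2 := psd_nonneg h.psd (sp u w)
      have p3 := psd_nonneg h.psd (sp w w)
      obtain ⟨m, rfl⟩ := h.mom
      have t1 := T_symm m u u w w
      have t2 := T_symm m w w u u
      rw [sp_comm w u] at t2
      rw [Matrix.mulVec_add, Matrix.mulVec_smul, add_dotProduct, dotProduct_add, dotProduct_add,
        smul_dotProduct, smul_dotProduct, dotProduct_smul, dotProduct_smul, t1, t2] at h0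
      simp only [smul_eq_mul] at h0
      have : k * (k * (sp w w ⬝ᵥ (Mom m *ᵥ sp w w))) ≤ 0 := by nlinarith [mul_nonneg hkp.le p2]
      by_contra hne
      have : 0 < sp w w ⬝ᵥ (Mom m *ᵥ sp w w) := lt_of_le_of_ne p3 (Ne.symm hne)
      have : 0 < k * (k * (sp w w ⬝ᵥ (Mom m *ᵥ sp w w))) := by positivity
      linarith

lemma goal_e6 {A : Matrix (Fin 6) (Fin 6) ℝ} (h : A.PosSemidef) {c : ℝ}
    (hA : A = Mom ![0, 0, 0, 0, 0, 0, 0, 0, 0, 0, 0, 0, 0, 0, c]) : Goal A := by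
  have hc : 0 ≤ c := by
    have := h.diag_nonneg (i := 5)
    rw [hA] at this
    simpa [Mom] using this
  refine ⟨0, 0, Real.sqrt (Real.sqrt c), ?_⟩
  have h1 : Real.sqrt (Real.sqrt c) ^ 2 = Real.sqrt c := Real.sq_sqrt (Real.sqrt_nonneg _)
  have h2 : Real.sqrt c * Real.sqrt c = c := Real.mul_self_sqrt hc
  rw [hA]
  ext i j
  fin_cases i <;> fin_cases j <;> simp [Mom, v, vecMulVec_apply, h1, h2]

lemma goal_of_two {A : Matrix (Fin 6) (Fin 6) ℝ} (h : ExtM A) {l k : Fin 3 → ℝ}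
    (hc : cr l k ≠ 0) (hl : Nl A l) (hk : Nl A k) : Goal A := by
  have hg := gm_det hc
  apply Goal_of_conj hg
  have h' := h.conj hg
  rw [← gm_0 l k, ← Nl_conj hg] at hl
  rw [← gm_1 l k, ← Nl_conj hg] at hk
  obtain ⟨m, hm⟩ := h'.mom
  apply goal_e6 h'.psd (c := m 14)
  rw [hm] at hl hk ⊢
  have c0 := hl ![1, 0, 0]
  have c1 := hl ![0, 1, 0]
  have c2 := hl ![0, 0, 1]
  have c3 := hk ![0, 1, 0]
  have c4 := hk ![0, 0, 1]
  have f0 := fun i => congrFun c0 i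
  have f1 := fun i => congrFun c1 i
  have f2 := fun i => congrFun c2 i
  have f3 := fun i => congrFun c3 i
  have f4 := fun i => congrFun c4 i
  simp [Fin.forall_fin_succ, Mom, sp, mulVec, dotProduct, Fin.sum_univ_succ] at f0 f1 f2 f3 f4
  congr 1
  funext i
  fin_cases i <;> simp [*]

lemma goal_of_e0 {A : Matrix (Fin 6) (Fin 6) ℝ} (h : ExtM A) (hl : Nl A ![1, 0, 0]) :
    Goal A := by
  by_cases hq : ∃ a b c : ℝ, ¬ (a = 0 ∧ b = 0 ∧ c = 0) ∧ A *ᵥ ![0, 0, 0, a, b, c] = 0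
  · obtain ⟨a, b, c, hne, hq⟩ := hq
    obtain ⟨l, hl0, hln, hN⟩ := binary h hne hq
    refine goal_of_two h ?_ hl hN
    intro hc
    apply hln
    have h1 := congrFun hc 1
    have h2 := congrFun hc 2
    simp [cr] at h1 h2
    funext i
    fin_cases i <;> simp [*]
  · obtain ⟨c, hc⟩ := h.ext ![0, 0, 0, 0, 0, 0, 0, 0, 0, 0, 0, 0, 0, 0, 1] (by
      intro u hu
      have e : ![0, 0, 0, u 3, u 4, u 5] = u - sp ![1, 0, 0] ![u 0, u 1, u 2] := by
        funext i
        fin_cases i <;> simp [sp]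
      have h5 : u 5 = 0 := by
        by_contra h5
        exact hq ⟨u 3, u 4, u 5, fun hh => h5 hh.2.2, by
          rw [e, Matrix.mulVec_sub, hu, hl, sub_zero]⟩
      funext i
      fin_cases i <;> simp [Mom, mulVec, dotProduct, Fin.sum_univ_succ]
      exact h5)
    have hc0 : c ≠ 0 := by
      rintro rfl
      have := congrFun (congrFun hc 5) 5
      simp [Mom] at this
    apply goal_e6 h.psd (c := c⁻¹)
    have : A = c⁻¹ • Mom ![0, 0, 0, 0, 0, 0, 0, 0, 0, 0, 0, 0, 0, 0, 1] := by
      rw [hc, smul_smul, inv_mul_cancel₀ hc0, one_smul]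
    rw [this]
    ext i j
    fin_cases i <;> fin_cases j <;> simp [Mom]

lemma goal_of_Nl {A : Matrix (Fin 6) (Fin 6) ℝ} (h : ExtM A) {l : Fin 3 → ℝ} (hl : l ≠ 0)
    (hN : Nl A l) : Goal A := by
  obtain ⟨k, hk⟩ := exists_cr hl
  have hg := gm_det hk
  apply Goal_of_conj hg
  apply goal_of_e0 (h.conj hg)
  rwa [Nl_conj hg, gm_0]

/-- Gram matrix (doubled) of a ternary quadratic form. -/
def gramQ (q : Fin 6 → ℝ) : Matrix (Fin 3) (Fin 3) ℝ :=
  !![2 * q 0, q 1, q 2; q 1, 2 * q 3, q 4; q 2, q 4, 2 * q 5]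

lemma goal_of_degenerate {A : Matrix (Fin 6) (Fin 6) ℝ} (h : ExtM A) {q : Fin 6 → ℝ}
    (hq0 : q ≠ 0) (hq : A *ᵥ q = 0) (hd : (gramQ q).det = 0) : Goal A := by
  obtain ⟨p, hp, hGp⟩ := Matrix.exists_mulVec_eq_zero_iff.2 hd
  obtain ⟨k, hk⟩ := exists_cr hp
  have hg := gm_det hk
  set H := (gm p k)ᵀ with hH
  have hHu : IsUnit H.det := by rw [hH, Matrix.det_transpose]; exact hg
  have hHi : IsUnit (H⁻¹).det := by
    rw [Matrix.det_nonsing_inv]; exact hHu.ringInverse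
  have g0 := congrFun hGp 0
  have g1 := congrFun hGp 1
  have g2 := congrFun hGp 2
  simp [gramQ, mulVec, dotProduct, Fin.sum_univ_succ] at g0 g1 g2
  have hback : (S2 H⁻¹)ᵀ *ᵥ ((S2 H)ᵀ *ᵥ q) = q := by
    rw [Matrix.mulVec_mulVec, (S2_invT hHu).2, Matrix.one_mulVec]
  set r := (S2 H)ᵀ *ᵥ q with hr
  have r0 : r 0 = 0 := by
    simp [hr, hH, gm, S2, sp, mulVec, dotProduct, Fin.sum_univ_succ]
    linear_combination (p 0 * g0 + p 1 * g1 + p 2 * g2) / 2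
  have r1 : r 1 = 0 := by
    simp [hr, hH, gm, S2, sp, mulVec, dotProduct, Fin.sum_univ_succ]
    linear_combination (k 0 * g0 + k 1 * g1 + k 2 * g2)
  have r2 : r 2 = 0 := by
    simp [hr, hH, gm, S2, sp, mulVec, dotProduct, Fin.sum_univ_succ]
    linear_combination (cr p k 0 * g0 + cr p k 1 * g1 + cr p k 2 * g2)
  have hre : r = ![0, 0, 0, r 3, r 4, r 5] := by
    funext i
    fin_cases i <;> simp [r0, r1, r2]
  obtain ⟨l, -, hl, hN⟩ := binary (h.conj hHi) (a := r 3) (b := r 4) (c := r 5) (by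
      rintro ⟨h3, h4, h5⟩
      apply hq0
      rw [← hback, hre, h3, h4, h5]
      have : (![0, 0, 0, 0, 0, 0] : Fin 6 → ℝ) = 0 := by
        funext i
        fin_cases i <;> rfl
      rw [this, Matrix.mulVec_zero])
    (by rw [← hre, conj_mulVec hHi, hback, hq])
  rw [Nl_conj hHi] at hN
  refine goal_of_Nl h ?_ hN
  intro h0
  apply hl
  have : Hᵀ *ᵥ ((H⁻¹)ᵀ *ᵥ l) = 0 := by rw [h0, Matrix.mulVec_zero]
  rwa [Matrix.mulVec_mulVec, ← Matrix.transpose_mul, Matrix.nonsing_inv_mul _ hHu,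
    Matrix.transpose_one, Matrix.one_mulVec] at this

lemma cubic_root_pos {a b c d : ℝ} (ha : 0 < a) :
    ∃ s : ℝ, a * s ^ 3 + b * s ^ 2 + c * s + d = 0 := by
  set K := 1 + (|b| + |c| + |d|) / a with hK
  have hK1 : 1 ≤ K := by
    have : 0 ≤ (|b| + |c| + |d|) / a := by positivity
    linarith
  have haK : a * K = a + (|b| + |c| + |d|) := by rw [hK]; field_simp
  have hcont : Continuous fun s : ℝ => a * s ^ 3 + b * s ^ 2 + c * s + d := by fun_prop
  have hK2 : 1 ≤ K ^ 2 := by nlinarith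
  have hKK : K ≤ K ^ 2 := by nlinarith
  have e3 : a * K ^ 3 = (a + (|b| + |c| + |d|)) * K ^ 2 := by rw [← haK]; ring
  have hb := abs_le.1 (le_refl |b|)
  have hc := abs_le.1 (le_refl |c|)
  have hd := abs_le.1 (le_refl |d|)
  have b1 : -(|b| * K ^ 2) ≤ b * K ^ 2 ∧ b * K ^ 2 ≤ |b| * K ^ 2 :=
    ⟨by nlinarith, by nlinarith⟩
  have c1 : |c| * K ≤ |c| * K ^ 2 := mul_le_mul_of_nonneg_left hKK (abs_nonneg _)
  have c2 : -(|c| * K) ≤ c * K ∧ c * K ≤ |c| * K := ⟨by nlinarith, by nlinarith⟩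
  have d1 : |d| ≤ |d| * K ^ 2 := le_mul_of_one_le_right (abs_nonneg _) hK2
  have a1 : 0 ≤ a * K ^ 2 := by positivity
  have hlo : a * (-K) ^ 3 + b * (-K) ^ 2 + c * (-K) + d ≤ 0 := by
    have : a * (-K) ^ 3 + b * (-K) ^ 2 + c * (-K) + d
      = -(a * K ^ 3) + b * K ^ 2 - c * K + d := by ring
    rw [this, e3]
    linarith [b1.2, c2.1, hd.2]
  have hhi : 0 ≤ a * K ^ 3 + b * K ^ 2 + c * K + d := by
    rw [e3]
    linarith [b1.1, c2.1, hd.1]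
  obtain ⟨s, -, hs⟩ := intermediate_value_Icc (by linarith : -K ≤ K) hcont.continuousOn ⟨hlo, hhi⟩
  exact ⟨s, hs⟩

lemma cubic_root {a b c d : ℝ} (ha : a ≠ 0) :
    ∃ s : ℝ, a * s ^ 3 + b * s ^ 2 + c * s + d = 0 := by
  rcases lt_or_gt_of_ne ha with h | h
  · obtain ⟨s, hs⟩ := cubic_root_pos (a := -a) (b := -b) (c := -c) (d := -d) (by linarith)
    exact ⟨s, by linarith⟩
  · exact cubic_root_pos h

lemma gramQ_pencil (q r : Fin 6 → ℝ) : ∃ b c d : ℝ, ∀ s : ℝ,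
    (gramQ (s • q + r)).det = (gramQ q).det * s ^ 3 + b * s ^ 2 + c * s + d := by
  refine ⟨8 * (q 0 * q 3 * r 5 + q 0 * r 3 * q 5 + r 0 * q 3 * q 5)
      + 2 * (q 1 * q 2 * r 4 + q 1 * r 2 * q 4 + r 1 * q 2 * q 4)
      - 2 * (r 0 * q 4 ^ 2 + 2 * q 0 * q 4 * r 4)
      - 2 * (r 3 * q 2 ^ 2 + 2 * q 3 * q 2 * r 2)
      - 2 * (r 5 * q 1 ^ 2 + 2 * q 5 * q 1 * r 1),
    8 * (r 0 * r 3 * q 5 + r 0 * q 3 * r 5 + q 0 * r 3 * r 5)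
      + 2 * (r 1 * r 2 * q 4 + r 1 * q 2 * r 4 + q 1 * r 2 * r 4)
      - 2 * (q 0 * r 4 ^ 2 + 2 * r 0 * r 4 * q 4)
      - 2 * (q 3 * r 2 ^ 2 + 2 * r 3 * r 2 * q 2)
      - 2 * (q 5 * r 1 ^ 2 + 2 * r 5 * r 1 * q 1),
    (gramQ r).det, fun s => ?_⟩
  simp [Matrix.det_fin_three, gramQ]
  ring

lemma goal_of_extM {A : Matrix (Fin 6) (Fin 6) ℝ} (h : ExtM A) (hA0 : A ≠ 0) : Goal A := by
  by_cases hf : Module.finrank ℝ (LinearMap.ker (Matrix.mulVecLin A)) ≤ 1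
  · exfalso
    obtain ⟨⟨q, hq⟩, hspan⟩ := finrank_le_one_iff.1 hf
    have htr : A.trace ≠ 0 := fun ht => hA0 (h.psd.trace_eq_zero_iff.1 ht)
    let Φ : (Fin 15 → ℝ) →ₗ[ℝ] ((Fin 6 → ℝ) × ℝ) :=
      { toFun := fun m => (Mom m *ᵥ q, (Mom m).trace)
        map_add' := fun m n => by
          have := Mom_lin 1 1 m n
          simp only [one_smul] at this
          rw [← this, Matrix.add_mulVec, Matrix.trace_add]; rfl
        map_smul' := fun c m => by
          have := Mom_lin c 0 m 0
          simp only [zero_smul, add_zero] at this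
          rw [← this, Matrix.smul_mulVec, Matrix.trace_smul]; rfl }
    have hker : LinearMap.ker Φ ≠ ⊥ := LinearMap.ker_ne_bot_of_finrank_lt (by simp)
    obtain ⟨m, hm, hm0⟩ := (Submodule.ne_bot_iff _).1 hker
    have hm1 : Mom m *ᵥ q = 0 := congrArg Prod.fst hm
    have hm2 : (Mom m).trace = 0 := congrArg Prod.snd hm
    obtain ⟨c, hc⟩ := h.ext m (by
      intro u hu
      obtain ⟨t, ht⟩ := hspan ⟨u, hu⟩
      have : t • q = u := congrArg Subtype.val ht
      rw [← this, Matrix.mulVec_smul, hm1, smul_zero])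
    rw [hc, Matrix.trace_smul, smul_eq_mul] at hm2
    have hc0 : c = 0 := (mul_eq_zero.1 hm2).resolve_right htr
    rw [hc0, zero_smul] at hc
    apply hm0
    have e := fun i j => congrFun (congrFun hc i) j
    have e0 := e 0
    have e1 := e 1
    have e2 := e 2
    have e3 := e 3
    have e4 := e 4
    have e5 := e 5
    simp [Mom, Fin.forall_fin_succ] at e0 e1 e2 e3 e4 e5
    funext i
    fin_cases i <;> simp [*]
  · push Not at hf
    obtain ⟨⟨q, hq⟩, hq0⟩ : ∃ q : LinearMap.ker (Matrix.mulVecLin A), q ≠ 0 := by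
      by_contra hcon
      push Not at hcon
      have := (finrank_le_one_iff (K := ℝ) (V := LinearMap.ker (Matrix.mulVecLin A))).2 ⟨(0 : LinearMap.ker (Matrix.mulVecLin A)),
        fun w => ⟨0, by rw [hcon w]; simp⟩⟩
      omega
    obtain ⟨⟨r, hr⟩, hrs⟩ : ∃ r : LinearMap.ker (Matrix.mulVecLin A),
        ∀ c : ℝ, c • (⟨q, hq⟩ : LinearMap.ker (Matrix.mulVecLin A)) ≠ r := by
      by_contra hcon
      push Not at hcon
      have := (finrank_le_one_iff (K := ℝ) (V := LinearMap.ker (Matrix.mulVecLin A))).2 ⟨_, hcon⟩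
      omega
    have hqA : A *ᵥ q = 0 := hq
    have hrA : A *ᵥ r = 0 := hr
    by_cases hdet : (gramQ q).det = 0
    · exact goal_of_degenerate h (fun h0 => hq0 (Subtype.ext h0)) hqA hdet
    · obtain ⟨b, c, d, hp⟩ := gramQ_pencil q r
      obtain ⟨s, hs⟩ := cubic_root (b := b) (c := c) (d := d) hdet
      refine goal_of_degenerate h (q := s • q + r) ?_ ?_ ((hp s).trans hs)
      · intro h0
        apply hrs (-s)
        apply Subtype.ext
        change (-s) • q = r
        rw [neg_smul]
        exact neg_eq_of_add_eq_zero_right h0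
      · rw [Matrix.mulVec_add, Matrix.mulVec_smul, hqA, hrA]; simp

/-- Every extreme ray of the cone 𝒞 is generated by a rank one matrix
`v(x,y,z) v(x,y,z)ᵀ`. -/
theorem extreme_ray_of_C_is_rank_one
    (A : Matrix (Fin 6) (Fin 6) ℝ) (hA : memC A) (hA0 : A ≠ 0)
    (hext : ∀ B C : Matrix (Fin 6) (Fin 6) ℝ, memC B → memC C → A = B + C →
      (∃ s : ℝ, 0 ≤ s ∧ B = s • A) ∧ (∃ t : ℝ, 0 ≤ t ∧ C = t • A)) :
    ∃ x y z : ℝ, A = vecMulVec (v x y z) (v x y z) := by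
  exact goal_of_extM (extM_of_extreme A hA hext) hA0
end

section
/- Every element of the cone 𝒞 is a nonnegative linear combination of matrices of the form v(x,y,z) v(x,y,z)^⊤: if A ∈ 𝒞, then there exist finitely many nonnegative reals ρ_1, …, ρ_m and real triples (x_i, y_i, z_i) such that A = Σ_{i=1}^m ρ_i v(x_i,y_i,z_i) v(x_i,y_i,z_i)^⊤. -/
open Matrix

lemma compact_convexHull_aux {E : Type} [NormedAddCommGroup E] [NormedSpace ℝ E]
    [FiniteDimensional ℝ E] {S : Set E} (hS : IsCompact S) : IsCompact (convexHull ℝ S) := by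
  rcases S.eq_empty_or_nonempty with rfl | ⟨z0, hz0⟩
  · simp
  set N := Module.finrank ℝ E + 1 with hN
  have key : convexHull ℝ S = (fun q : (Fin N → ℝ) × (Fin N → E) => ∑ i, q.1 i • q.2 i) ''
      (stdSimplex ℝ (Fin N) ×ˢ (Set.pi Set.univ fun _ => S)) := by
    apply Set.Subset.antisymm
    · intro x hx
      obtain ⟨ι, _, z, w, hz, hai, hw, hw1, hx⟩ := eq_pos_convex_span_of_mem_convexHull hx
      have hc : Fintype.card ι ≤ Fintype.card (Fin N) := by
        have h1 := hai.card_le_finrank_succ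
        have h2 := Submodule.finrank_le (vectorSpan ℝ (Set.range z))
        simp only [Fintype.card_fin]
        omega
      obtain ⟨e⟩ := Function.Embedding.nonempty_of_card_le hc
      refine ⟨(Function.extend e w 0, Function.extend e z (fun _ => z0)), ⟨⟨?_, ?_⟩, ?_⟩, ?_⟩
      · intro i
        by_cases h : ∃ a, e a = i
        · obtain ⟨a, rfl⟩ := h
          simp only [e.injective.extend_apply]; exact (hw a).le
        · simp [Function.extend_apply' _ _ _ h]
      · rw [← hw1]
        symm
        apply Fintype.sum_of_injective e e.injective
        · intro i hi
          simp only [Function.extend_apply' _ _ _ (by simpa using hi)]; rfl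
        · intro i; simp [e.injective.extend_apply]
      · intro i _
        by_cases h : ∃ a, e a = i
        · obtain ⟨a, rfl⟩ := h
          simp only [e.injective.extend_apply]; exact hz ⟨a, rfl⟩
        · simp only [Function.extend_apply' _ _ _ h]; exact hz0
      · rw [← hx]
        symm
        apply Fintype.sum_of_injective e e.injective
        · intro i hi
          simp [Function.extend_apply' _ _ _ (show ¬ ∃ a, e a = i by simpa using hi)]
        · intro i; simp [e.injective.extend_apply]
    · rintro _ ⟨⟨w, z⟩, ⟨⟨hw, hw1⟩, hz⟩, rfl⟩
      exact mem_convexHull_of_exists_fintype w z hw hw1 (fun i => hz i trivial) rfl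
  rw [key]
  apply IsCompact.image
  · exact (isCompact_stdSimplex ℝ (Fin N)).prod (isCompact_univ_pi fun _ => hS)
  · fun_prop

open Polynomial in
lemma pos_poly_two_squares (d : ℕ) : ∀ F : ℝ[X], F.natDegree = d → (∀ x, 0 < F.eval x) →
    ∃ p q : ℝ[X], F = p ^ 2 + q ^ 2 ∧ 2 * p.natDegree ≤ d ∧ 2 * q.natDegree ≤ d := by
  induction d using Nat.strong_induction_on with
  | _ d ih =>
  intro F hd hF
  have hF0 : F ≠ 0 := by rintro rfl; simpa using hF 0
  rcases Nat.eq_zero_or_pos d with h0 | hpos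
  · rw [h0] at hd
    rw [natDegree_eq_zero] at hd
    obtain ⟨a, rfl⟩ := hd
    have ha : 0 < a := by simpa using hF 0
    refine ⟨C (Real.sqrt a), 0, ?_, by simp, by simp⟩
    rw [← C_pow, Real.sq_sqrt ha.le]; simp
  · have hu : ¬ IsUnit F := by
      intro h; have := natDegree_eq_zero_of_isUnit h; omega
    obtain ⟨g, hg, G, rfl⟩ := WfDvdMonoid.exists_irreducible_factor hu hF0
    have hg2 := hg.natDegree_le_two
    have hgpos : 0 < g.natDegree := hg.natDegree_pos
    have hgr : ∀ x, g.eval x ≠ 0 := by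
      intro x hx; have := hF x; simp [hx] at this
    have hgd : g.natDegree = 2 := by
      have : g.natDegree ≠ 1 := by
        intro h1
        obtain ⟨x, hx⟩ := Polynomial.exists_root_of_degree_eq_one (degree_eq_iff_natDegree_eq_of_pos (by norm_num) |>.2 h1)
        exact hgr x hx
      omega
    -- shape of g
    obtain ⟨a, b, c, ha, rfl⟩ : ∃ a b c : ℝ, a ≠ 0 ∧ g = C a * X ^ 2 + C b * X + C c := by
      refine ⟨g.coeff 2, g.coeff 1, g.coeff 0, ?_, ?_⟩
      · rw [← hgd]; simpa using hg.ne_zero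
      · exact eq_quadratic_of_degree_le_two (natDegree_le_iff_degree_le.1 hgd.le)
    have hdisc : 0 < 4 * a * c - b ^ 2 := by
      by_contra hcon
      push Not at hcon
      obtain ⟨r, hs⟩ : ∃ r : ℝ, r ^ 2 = b ^ 2 - 4 * a * c :=
        ⟨_, Real.sq_sqrt (show 0 ≤ b ^ 2 - 4 * a * c by linarith)⟩
      apply hgr ((-b + r) / (2 * a))
      simp only [eval_add, eval_mul, eval_C, eval_pow, eval_X]
      field_simp
      nlinarith
    have hG0 : G ≠ 0 := by rintro rfl; simp at hF0
    have hdG : G.natDegree + 2 = d := by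
      rw [natDegree_mul hg.ne_zero hG0] at hd; omega
    have hval : ∀ x : ℝ, 4 * a * (a * x ^ 2 + b * x + c) = (2 * a * x + b) ^ 2 + (4 * a * c - b ^ 2) := by
      intro x; ring
    have hGpos : ∀ x, 0 < (C a * G).eval x := by
      intro x
      have h1 := hF x
      have h2 := hval x
      simp only [eval_add, eval_mul, eval_C, eval_pow, eval_X] at h1 ⊢
      have h3 : 0 < a * (a * x ^ 2 + b * x + c) := by nlinarith [sq_nonneg (2 * a * x + b)]
      have h4 : 0 < (a * (a * x ^ 2 + b * x + c)) * (a * G.eval x) := by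
        have : (a * (a * x ^ 2 + b * x + c)) * (a * G.eval x) =
          a ^ 2 * ((a * x ^ 2 + b * x + c) * G.eval x) := by ring
        rw [this]; positivity
      exact (pos_iff_pos_of_mul_pos h4).1 h3
    obtain ⟨p, q, hpq, hp, hq⟩ := ih (d - 2) (by omega) (C a * G)
      (by rw [natDegree_C_mul ha]; omega) hGpos
    set D := Real.sqrt (4 * a * c - b ^ 2) with hD
    have hDD : D ^ 2 = 4 * a * c - b ^ 2 := Real.sq_sqrt hdisc.le
    refine ⟨C (1 / (2 * a)) * ((C (2 * a) * X + C b) * p + C D * q),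
      C (1 / (2 * a)) * (C D * p - (C (2 * a) * X + C b) * q), ?_, ?_, ?_⟩
    · have e1 : (C (1 / (2 * a)) * ((C (2 * a) * X + C b) * p + C D * q)) ^ 2 +
        (C (1 / (2 * a)) * (C D * p - (C (2 * a) * X + C b) * q)) ^ 2 =
        C ((1 / (2 * a)) ^ 2) * ((C (2 * a) * X + C b) ^ 2 + C (D ^ 2)) * (p ^ 2 + q ^ 2) := by
        simp only [C_pow]; ring
      have e2 : (C (2 * a) * X + C b) ^ 2 + C (D ^ 2) = C (4 * a) * (C a * X ^ 2 + C b * X + C c) := by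
        rw [hDD]; simp only [C_mul, C_sub, C_pow]
        simp only [show (C (2:ℝ)) = 2 from rfl, show (C (4:ℝ)) = 4 from rfl]; ring
      rw [e1, e2, ← hpq]
      have : C ((1 / (2 * a)) ^ 2) * C (4 * a) * C a = (1 : ℝ[X]) := by
        rw [← C_mul, ← C_mul, ← C_1]; congr 1; field_simp; norm_num
      linear_combination -(C a * X ^ 2 + C b * X + C c) * G * this
    · have : (C (1 / (2 * a)) * ((C (2 * a) * X + C b) * p + C D * q)).natDegree ≤
          0 + max (1 + p.natDegree) (0 + q.natDegree) := by
        refine natDegree_mul_le_of_le (natDegree_C _).le (natDegree_add_le_of_le (natDegree_mul_le_of_le ?_ le_rfl) (natDegree_mul_le_of_le (by simp) le_rfl))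
        compute_degree
      omega
    · have : (C (1 / (2 * a)) * (C D * p - (C (2 * a) * X + C b) * q)).natDegree ≤
          0 + max (0 + p.natDegree) (1 + q.natDegree) := by
        refine natDegree_mul_le_of_le (natDegree_C _).le (natDegree_sub_le_of_le (natDegree_mul_le_of_le (by simp) le_rfl) (natDegree_mul_le_of_le ?_ le_rfl))
        compute_degree
      omega

open Polynomial in
lemma binary_moment (n : ℕ) (m : ℕ → ℝ)
    (hm : ∀ c : ℕ → ℝ, 0 ≤ ∑ i ∈ Finset.range (n + 1), ∑ j ∈ Finset.range (n + 1),
      c i * c j * m (i + j)) :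
    ∃ (N : ℕ) (ρ s t : Fin N → ℝ), (∀ i, 0 ≤ ρ i) ∧
      ∀ k ≤ 2 * n, m k = ∑ i, ρ i * (s i ^ k * t i ^ (2 * n - k)) := by
  classical
  -- the functional
  let Λ : ℝ[X] →ₗ[ℝ] ℝ := Polynomial.lsum fun k => (LinearMap.mulRight ℝ (m k))
  have hΛ : ∀ k (a : ℝ), Λ (C a * X ^ k) = a * m k := by
    intro k a
    simp [Λ, Polynomial.lsum_apply, C_mul_X_pow_eq_monomial, sum_monomial_index]
  have hsq : ∀ p : ℝ[X], p.natDegree ≤ n → 0 ≤ Λ (p ^ 2) := by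
    intro p hp
    have e : p = ∑ i ∈ Finset.range (n + 1), C (p.coeff i) * X ^ i :=
      p.as_sum_range_C_mul_X_pow' (by omega)
    have : Λ (p ^ 2) = ∑ i ∈ Finset.range (n + 1), ∑ j ∈ Finset.range (n + 1),
        p.coeff i * p.coeff j * m (i + j) := by
      conv_lhs => rw [e, sq, Finset.sum_mul_sum]
      simp only [map_sum]
      refine Finset.sum_congr rfl fun i _ => Finset.sum_congr rfl fun j _ => ?_
      rw [← hΛ, C_mul, pow_add]; congr 1; ring
    rw [this]; exact hm _
  have heven : ∀ i ≤ n, 0 ≤ m (2 * i) := by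
    intro i hi
    have := hsq (X ^ i) (by simpa using hi)
    rw [← pow_mul, ← one_mul (X ^ (i * 2)), ← C_1, hΛ] at this
    rw [mul_comm 2 i]; simpa using this
  set τ := Λ ((1 + X ^ 2) ^ n) with hτ
  have hτsum : τ = ∑ i ∈ Finset.range (n + 1), (n.choose i : ℝ) * m (2 * i) := by
    rw [hτ, add_comm, add_pow, map_sum]
    refine Finset.sum_congr rfl fun i _ => ?_
    rw [← hΛ]; congr 1; simp [← pow_mul]; ring
  have hτ0 : 0 ≤ τ := by
    rw [hτsum]
    refine Finset.sum_nonneg fun i hi => mul_nonneg (by positivity) (heven i ?_)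
    simp at hi; omega
  rcases hτ0.eq_or_lt with h0 | hpos
  · -- everything vanishes
    have hz : ∀ i ≤ n, m (2 * i) = 0 := by
      intro i hi
      rw [hτsum] at h0
      have := (Finset.sum_eq_zero_iff_of_nonneg (fun i hi => mul_nonneg (by positivity)
        (heven i (by simp at hi; omega)))).1 h0.symm i (by simp; omega)
      have hc : (n.choose i : ℝ) ≠ 0 := by exact_mod_cast (Nat.choose_pos hi).ne'
      exact (mul_eq_zero.1 this).resolve_left hc
    refine ⟨0, 0, 0, 0, by simp, ?_⟩
    intro k hk
    simp only [Finset.univ_eq_empty, Finset.sum_empty]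
    rcases Nat.even_or_odd' k with ⟨i, rfl | rfl⟩
    · exact hz i (by omega)
    · have h1 : ∀ a : ℝ, 0 ≤ a * m (2 * i + 1) := by
        intro a
        have := hsq (X ^ i + C (a / 2) * X ^ (i + 1)) (by
          refine natDegree_add_le_of_degree_le ?_ ?_
          · simp; omega
          · exact (natDegree_C_mul_X_pow_le _ _).trans (by omega))
        have e : (X ^ i + C (a / 2) * X ^ (i + 1)) ^ 2 = C 1 * X ^ (2 * i) + C a * X ^ (2 * i + 1) +
            C ((a / 2) ^ 2) * X ^ (2 * (i + 1)) := by
          have : (C a : ℝ[X]) = 2 * C (a / 2) := by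
            rw [show (2 : ℝ[X]) = C 2 from rfl, ← C_mul]; congr 1; ring
          rw [this, C_pow, C_1]; ring
        rw [e, map_add, map_add, hΛ, hΛ, hΛ, hz i (by omega), hz (i + 1) (by omega)] at this
        simpa using this
      have h2 := h1 1
      have h3 := h1 (-1)
      linarith
  · -- separation
    let V : ℝ × ℝ → (Fin (2 * n + 1) → ℝ) := fun q k => q.1 ^ (k : ℕ) * q.2 ^ (2 * n - (k : ℕ))
    let T : Set (ℝ × ℝ) := {q | q.1 ^ 2 + q.2 ^ 2 = 1}
    have hT : IsCompact T := by
      apply Metric.isCompact_of_isClosed_isBounded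
      · exact isClosed_eq (by fun_prop) (by fun_prop)
      · refine (Metric.isBounded_Icc ((-1, -1) : ℝ × ℝ) (1, 1)).subset ?_
        rintro ⟨a, b⟩ h
        simp only [T, Set.mem_ofPred_eq] at h
        simp only [Set.mem_Icc, Prod.mk_le_mk]
        refine ⟨⟨?_, ?_⟩, ?_, ?_⟩ <;> nlinarith [sq_nonneg a, sq_nonneg b]
    have hV : Continuous V := by
      apply continuous_pi; intro k; fun_prop
    have hc := compact_convexHull_aux (hT.image hV)
    let μ : Fin (2 * n + 1) → ℝ := fun k => τ⁻¹ * m k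
    have hμ : μ ∈ convexHull ℝ (V '' T) := by
      by_contra hcon
      obtain ⟨f, u, hfu, huf⟩ := geometric_hahn_banach_closed_point (convex_convexHull ℝ _)
        hc.isClosed hcon
      let a : ℕ → ℝ := fun k => if h : k < 2 * n + 1 then f (Pi.single ⟨k, h⟩ 1) else 0
      have hf : ∀ y : ℕ → ℝ, f (fun k => y k) = ∑ k ∈ Finset.range (2 * n + 1), a k * y k := by
        intro y
        have := LinearMap.pi_apply_eq_sum_univ (f : (Fin (2 * n + 1) → ℝ) →ₗ[ℝ] ℝ) (fun k => y k)
        simp only [ContinuousLinearMap.coe_coe] at this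
        rw [this, Finset.sum_range]
        refine Finset.sum_congr rfl fun k _ => ?_
        simp only [a, k.2, dif_pos, smul_eq_mul]
        rw [mul_comm]; congr 2
        ext j; simp [Pi.single_apply, eq_comm]
      let F : ℝ[X] := C u * (1 + X ^ 2) ^ n - ∑ k ∈ Finset.range (2 * n + 1), C (a k) * X ^ k
      have hFd : F.natDegree ≤ 2 * n := by
        refine (natDegree_sub_le _ _).trans (max_le ?_ ?_)
        · refine (natDegree_C_mul_le _ _).trans (natDegree_pow_le.trans ?_)
          have : (1 + X ^ 2 : ℝ[X]).natDegree ≤ 2 := by compute_degree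
          nlinarith
        · refine natDegree_sum_le_of_forall_le _ _ fun k hk => ?_
          refine (natDegree_C_mul_X_pow_le _ _).trans ?_
          simp at hk; omega
      have hFpos : ∀ x, 0 < F.eval x := by
        intro x
        set r := Real.sqrt (1 + x ^ 2) with hr
        have hrpos : 0 < r := Real.sqrt_pos.2 (by positivity)
        have hr2 : r ^ 2 = 1 + x ^ 2 := Real.sq_sqrt (by positivity)
        have h1 := hfu (V (x / r, 1 / r)) (subset_convexHull ℝ _ ⟨_, by
          simp only [T, Set.mem_ofPred_eq]; field_simp; linarith, rfl⟩)
        have h2 : f (V (x / r, 1 / r)) = (∑ k ∈ Finset.range (2 * n + 1), a k * x ^ k) / r ^ (2 * n) := by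
          have := hf (fun k => (x / r) ^ k * (1 / r) ^ (2 * n - k))
          rw [show V (x / r, 1 / r) = fun k : Fin (2 * n + 1) => (x / r) ^ (k : ℕ) * (1 / r) ^ (2 * n - (k : ℕ)) from rfl, this, Finset.sum_div]
          refine Finset.sum_congr rfl fun k hk => ?_
          have hk' : k + (2 * n - k) = 2 * n := by simp at hk; omega
          rw [div_pow, div_pow, one_pow, mul_div_assoc, div_mul_div_comm, ← pow_add, hk', mul_one]
        rw [h2, div_lt_iff₀ (by positivity), pow_mul, hr2] at h1
        simp only [F, eval_sub, eval_mul, eval_C, eval_pow, eval_add, eval_one, eval_X, eval_finsetSum]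
        linarith
      obtain ⟨p, q, hpq, hp, hq⟩ := pos_poly_two_squares _ F rfl hFpos
      have hΛF : 0 ≤ Λ F := by
        rw [hpq, map_add]
        exact add_nonneg (hsq _ (by omega)) (hsq _ (by omega))
      have hΛF2 : Λ F = u * τ - ∑ k ∈ Finset.range (2 * n + 1), a k * m k := by
        simp only [F, map_sub, map_sum, hΛ]
        rw [← smul_eq_C_mul, map_smul, smul_eq_mul]
      have h3 := hf (fun k => τ⁻¹ * m k)
      have h4 : f μ = τ⁻¹ * ∑ k ∈ Finset.range (2 * n + 1), a k * m k := by
        rw [show μ = fun k : Fin (2 * n + 1) => τ⁻¹ * m k from rfl, h3, Finset.mul_sum]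
        refine Finset.sum_congr rfl fun k _ => by ring
      rw [h4, inv_mul_eq_div, lt_div_iff₀ hpos] at huf
      linarith
    obtain ⟨ι, _, w, z, hw, hw1, hz, hsum⟩ := mem_convexHull_iff_exists_fintype.1 hμ
    choose q hqT hq using hz
    let e := Fintype.equivFin ι
    refine ⟨Fintype.card ι, fun i => τ * w (e.symm i), fun i => (q (e.symm i)).1,
      fun i => (q (e.symm i)).2, fun i => mul_nonneg hτ0 (hw _), ?_⟩
    intro k hk
    have h1 := congrFun hsum ⟨k, by omega⟩
    rw [Equiv.sum_comp e.symm (fun i => τ * w i * ((q i).1 ^ k * (q i).2 ^ (2 * n - k)))]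
    simp only [Finset.sum_apply, Pi.smul_apply, smul_eq_mul, μ, ← hq, V] at h1
    have h2 : m k = τ * (τ⁻¹ * m k) := by field_simp
    rw [h2, ← h1, Finset.mul_sum]
    refine Finset.sum_congr rfl fun i _ => by ring

namespace TQ
open MvPolynomial

/-- Polynomials in three variables. -/
abbrev P := MvPolynomial (Fin 3) ℝ

/-- Monomials. -/
noncomputable def mon (i j k : ℕ) : P := X 0 ^ i * X 1 ^ j * X 2 ^ k

/-- Functional nonnegative on squares of quadratic forms. -/
def Good (L : P →ₗ[ℝ] ℝ) : Prop := ∀ p : P, p.IsHomogeneous 2 → 0 ≤ L (p ^ 2)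

/-- The quadratic form `q` is in the kernel. -/
def Ker (L : P →ₗ[ℝ] ℝ) (q : P) : Prop :=
  q.IsHomogeneous 2 ∧ ∀ p : P, p.IsHomogeneous 2 → L (q * p) = 0

/-- The functional is a nonnegative combination of point evaluations on quartics. -/
def Rep (L : P →ₗ[ℝ] ℝ) : Prop :=
  ∃ (ι : Type) (_ : Fintype ι) (ρ : ι → ℝ) (a : ι → Fin 3 → ℝ), (∀ i, 0 ≤ ρ i) ∧
    ∀ f : P, f.IsHomogeneous 4 → L f = ∑ i, ρ i * eval (a i) f

lemma L_C (L : P →ₗ[ℝ] ℝ) (a : ℝ) (p : P) : L (C a * p) = a * L p := by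
  rw [← smul_eq_C_mul, map_smul, smul_eq_mul]

lemma mon_hom {i j k n : ℕ} (h : i + j + k = n) : (mon i j k).IsHomogeneous n := by
  have := ((isHomogeneous_X_pow (R := ℝ) (0 : Fin 3) i).mul
    (isHomogeneous_X_pow (R := ℝ) (1 : Fin 3) j)).mul (isHomogeneous_X_pow (R := ℝ) (2 : Fin 3) k)
  rw [h] at this
  exact this

lemma mon_mul (i j k i' j' k' : ℕ) : mon i j k * mon i' j' k' = mon (i + i') (j + j') (k + k') := by
  simp only [mon]; ring

lemma monomial_mon (d : Fin 3 →₀ ℕ) (r : ℝ) : (monomial d r : P) = C r * mon (d 0) (d 1) (d 2) := by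
  rw [monomial_eq, Finsupp.prod_fintype _ _ (by simp), Fin.prod_univ_three]; rfl

lemma hom_sum {f : P} {n : ℕ} (hf : f.IsHomogeneous n) :
    f = ∑ d ∈ f.support, C (f.coeff d) * mon (d 0) (d 1) (d 2) ∧
    ∀ d ∈ f.support, d 0 + d 1 + d 2 = n := by
  constructor
  · conv_lhs => rw [f.as_sum]
    exact Finset.sum_congr rfl fun d _ => monomial_mon _ _
  · intro d hd
    have := hf.degree_eq_sum_deg_support hd
    rw [Finset.sum_subset (Finset.subset_univ d.support) (fun i _ hi => by simpa using hi),
      Fin.sum_univ_three] at this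
    exact this.symm

lemma ext_mon {n : ℕ} (L L' : P →ₗ[ℝ] ℝ)
    (h : ∀ i j k, i + j + k = n → L (mon i j k) = L' (mon i j k)) (f : P)
    (hf : f.IsHomogeneous n) : L f = L' f := by
  obtain ⟨h1, h2⟩ := hom_sum hf
  rw [h1, map_sum, map_sum]
  refine Finset.sum_congr rfl fun d hd => ?_
  rw [L_C, L_C, h _ _ _ (h2 d hd)]

lemma rep_of_mon (L : P →ₗ[ℝ] ℝ) (ι : Type) [Fintype ι] (ρ : ι → ℝ) (a : ι → Fin 3 → ℝ)
    (hρ : ∀ i, 0 ≤ ρ i)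
    (h : ∀ i j k, i + j + k = 4 → L (mon i j k) = ∑ l, ρ l * (a l 0 ^ i * a l 1 ^ j * a l 2 ^ k)) :
    Rep L := by
  refine ⟨ι, inferInstance, ρ, a, hρ, fun f hf => ?_⟩
  have := ext_mon L (∑ i, ρ i • (aeval (a i) : P →ₐ[ℝ] ℝ).toLinearMap) (n := 4) (by
    intro i j k hh
    rw [h i j k hh]
    simp [mon]) f hf
  rw [this]
  simp [aeval_eq_eval]

lemma ker_of_sq {L : P →ₗ[ℝ] ℝ} (hL : Good L) {q : P} (hq : q.IsHomogeneous 2)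
    (h0 : L (q ^ 2) = 0) : Ker L q := by
  refine ⟨hq, fun p hp => ?_⟩
  have key : ∀ t : ℝ, 0 ≤ 2 * t * L (q * p) + L (p ^ 2) := by
    intro t
    have h1 := hL (C t * q + p) ((hq.C_mul t).add hp)
    have e : (C t * q + p) ^ 2 = C (t ^ 2) * q ^ 2 + C (2 * t) * (q * p) + p ^ 2 := by
      rw [C_pow, C_mul, show (C 2 : P) = 2 from rfl]; ring
    rw [e, map_add, map_add, L_C, L_C, h0] at h1
    linarith
  by_contra hne
  have := key (-(L (p ^ 2) + 1) / (2 * L (q * p)))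
  have e : 2 * (-(L (p ^ 2) + 1) / (2 * L (q * p))) * L (q * p) = -(L (p ^ 2) + 1) := by
    field_simp
  linarith

/-- Linear substitution. -/
noncomputable def phi (M : Matrix (Fin 3) (Fin 3) ℝ) : P →ₐ[ℝ] P :=
  aeval fun i => ∑ j, C (M i j) * X j

lemma phi_X (M : Matrix (Fin 3) (Fin 3) ℝ) (i : Fin 3) : phi M (X i) = ∑ j, C (M i j) * X j := by
  simp [phi]

lemma phi_C (M : Matrix (Fin 3) (Fin 3) ℝ) (r : ℝ) : phi M (C r) = C r := by
  simp [phi]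

lemma phi_hom (M : Matrix (Fin 3) (Fin 3) ℝ) {p : P} {n : ℕ} (hp : p.IsHomogeneous n) :
    (phi M p).IsHomogeneous n := by
  have := hp.aeval (fun i => ∑ j, C (M i j) * X j : Fin 3 → P) (n := 1) (fun i =>
    IsHomogeneous.sum _ _ _ fun j _ => isHomogeneous_C_mul_X _ _)
  rwa [one_mul] at this

lemma phi_phi (M N : Matrix (Fin 3) (Fin 3) ℝ) (h : N * M = 1) (f : P) : phi M (phi N f) = f := by
  have : (phi M).comp (phi N) = AlgHom.id ℝ P := by
    apply MvPolynomial.algHom_ext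
    intro i
    simp only [AlgHom.comp_apply, phi_X, map_sum, map_mul, phi_C, AlgHom.id_apply]
    have h1 : ∀ k, ∑ j, N i j * M j k = (1 : Matrix (Fin 3) (Fin 3) ℝ) i k := by
      intro k; rw [← h, Matrix.mul_apply]
    simp only [Finset.mul_sum]
    rw [Finset.sum_comm]
    have h2 : ∀ k, ∑ j, C (N i j) * (C (M j k) * X k) =
        C ((1 : Matrix (Fin 3) (Fin 3) ℝ) i k) * (X k : P) := by
      intro k
      rw [← h1, map_sum, Finset.sum_mul]
      refine Finset.sum_congr rfl fun j _ => by rw [C_mul]; ring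
    simp only [h2, Matrix.one_apply]
    simp
  exact DFunLike.congr_fun this f

lemma eval_phi (M : Matrix (Fin 3) (Fin 3) ℝ) (a : Fin 3 → ℝ) (f : P) :
    eval a (phi M f) = eval (M *ᵥ a) f := by
  have : (aeval a : P →ₐ[ℝ] ℝ).comp (phi M) = aeval (M *ᵥ a) := by
    apply MvPolynomial.algHom_ext
    intro i
    simp [phi_X, Matrix.mulVec, dotProduct]
  have := DFunLike.congr_fun this f
  simpa [aeval_eq_eval] using this

/-- Change of coordinates for a kernel form. -/
lemma rep_change (q : P) (hq : q.IsHomogeneous 2)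
    (hstd : ∀ L, Good L → Ker L q → Rep L) (M : Matrix (Fin 3) (Fin 3) ℝ) (hM : M.det ≠ 0)
    (L : P →ₗ[ℝ] ℝ) (hL : Good L) (hK : Ker L (phi M q)) : Rep L := by
  obtain ⟨ι, _, ρ, a, hρ, h⟩ := hstd (L ∘ₗ (phi M).toLinearMap) (by
      intro p hp
      simpa using hL _ (phi_hom M hp)) ⟨hq, by
      intro p hp
      simpa using hK.2 _ (phi_hom M hp)⟩
  refine ⟨ι, inferInstance, ρ, fun i => M⁻¹ *ᵥ a i, hρ, fun f hf => ?_⟩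
  have h1 := h (phi M⁻¹ f) (phi_hom _ hf)
  have h2 : M⁻¹ * M = 1 := Matrix.nonsing_inv_mul M (isUnit_iff_ne_zero.2 hM)
  simp only [LinearMap.comp_apply, AlgHom.toLinearMap_apply, phi_phi _ _ h2, eval_phi] at h1
  exact h1

lemma case_conic (L : P →ₗ[ℝ] ℝ) (hL : Good L) (hK : Ker L (X 0 * X 2 - X 1 ^ 2)) : Rep L := by
  have hrel : ∀ i j k, i + j + k = 2 → L (mon i (j + 2) k) = L (mon (i + 1) j (k + 1)) := by
    intro i j k h
    have h1 := hK.2 (mon i j k) (mon_hom h)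
    have e : (X 0 * X 2 - X 1 ^ 2) * mon i j k = mon (i + 1) j (k + 1) - mon i (j + 2) k := by
      simp only [mon]; ring
    rw [e, map_sub] at h1
    linarith
  let m : ℕ → ℝ := fun k => L (mon (k / 2) (k % 2) (4 - k / 2 - k % 2))
  have hm : ∀ i j k, i + j + k = 4 → L (mon i j k) = m (2 * i + j) := by
    intro i j k h
    have hj : j ≤ 4 := by omega
    have hi : i ≤ 4 := by omega
    obtain rfl : k = 4 - i - j := by omega
    interval_cases j <;> interval_cases i <;> first | omega | skip
    all_goals simp only [m]
    all_goals norm_num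
    all_goals first | done | rw [hrel _ _ _ (by norm_num)]
    all_goals first | done | rw [hrel _ _ _ (by norm_num)]
  let b : ℕ → P := fun k => mon (k / 2) (k % 2) (2 - k / 2 - k % 2)
  have hb : ∀ i ∈ Finset.range 5, i / 2 + i % 2 + (2 - i / 2 - i % 2) = 2 := by decide
  obtain ⟨N, ρ, s, t, hρ, hrep⟩ := binary_moment 4 m (by
    intro c
    have h1 := hL (∑ i ∈ Finset.range 5, C (c i) * b i)
      (IsHomogeneous.sum _ _ _ fun i hi => (mon_hom (hb i hi)).C_mul _)
    rw [sq, Finset.sum_mul_sum] at h1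
    simp only [map_sum] at h1
    refine h1.trans (le_of_eq ?_)
    refine Finset.sum_congr rfl fun i hi => Finset.sum_congr rfl fun j hj => ?_
    have e : C (c i) * b i * (C (c j) * b j) = C (c i * c j) * (b i * b j) := by
      rw [C_mul]; ring
    rw [e, L_C]
    congr 1
    simp only [b, mon_mul]
    have hi' := hb i hi
    have hj' := hb j hj
    rw [hm _ _ _ (by omega)]
    congr 1; omega)
  refine rep_of_mon L (Fin N) ρ (fun l => ![s l ^ 2, s l * t l, t l ^ 2]) hρ ?_
  intro i j k h
  rw [hm i j k h, hrep _ (by omega)]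
  refine Finset.sum_congr rfl fun l _ => ?_
  have : 2 * 4 - (2 * i + j) = j + 2 * k := by omega
  rw [this]
  simp only [Matrix.cons_val_zero, Matrix.cons_val_one, Matrix.cons_val]
  ring

lemma case_xy (L : P →ₗ[ℝ] ℝ) (hL : Good L) (hK : Ker L (X 0 * X 1)) : Rep L := by
  have hz : ∀ i j k, i + j + k = 2 → L (mon (i + 1) (j + 1) k) = 0 := by
    intro i j k h
    rw [← hK.2 (mon i j k) (mon_hom h)]
    congr 1; simp only [mon]; ring
  let x : ℕ → ℝ := fun k => L (mon k 0 (4 - k))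
  let y : ℕ → ℝ := fun k => L (mon 0 k (4 - k))
  let w : ℝ := L (mon 0 0 4)
  have hfull : ∀ a b e c d : ℝ, 0 ≤ (a ^ 2 * x 4 + 2 * a * b * x 3 + b ^ 2 * x 2 + 2 * a * e * x 2 +
      2 * b * e * x 1) + (c ^ 2 * y 4 + 2 * c * d * y 3 + d ^ 2 * y 2 + 2 * c * e * y 2 +
      2 * d * e * y 1) + e ^ 2 * w := by
    intro a b e c d
    have u1 : (mon 2 0 0).IsHomogeneous 2 := mon_hom rfl
    have u2 : (mon 1 0 1).IsHomogeneous 2 := mon_hom rfl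
    have u3 : (mon 0 0 2).IsHomogeneous 2 := mon_hom rfl
    have u4 : (mon 0 2 0).IsHomogeneous 2 := mon_hom rfl
    have u5 : (mon 0 1 1).IsHomogeneous 2 := mon_hom rfl
    have h1 := hL (C a * mon 2 0 0 + C b * mon 1 0 1 + C e * mon 0 0 2 + C c * mon 0 2 0 +
      C d * mon 0 1 1) ((((u1.C_mul a).add (u2.C_mul b)).add
        (u3.C_mul e)).add (u4.C_mul c) |>.add (u5.C_mul d))
    have e1 : (C a * mon 2 0 0 + C b * mon 1 0 1 + C e * mon 0 0 2 + C c * mon 0 2 0 +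
      C d * mon 0 1 1) ^ 2 = C (a ^ 2) * mon 4 0 0 + C (2 * a * b) * mon 3 0 1 +
      C (b ^ 2) * mon 2 0 2 + C (2 * a * e) * mon 2 0 2 + C (2 * b * e) * mon 1 0 3 +
      (C (c ^ 2) * mon 0 4 0 + C (2 * c * d) * mon 0 3 1 +
      C (d ^ 2) * mon 0 2 2 + C (2 * c * e) * mon 0 2 2 + C (2 * d * e) * mon 0 1 3) +
      C (e ^ 2) * mon 0 0 4 + (C (2 * a * c) * mon 2 2 0 + C (2 * a * d) * mon 2 1 1 +
      C (2 * b * c) * mon 1 2 1 + C (2 * b * d) * mon 1 1 2) := by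
      simp only [C_mul, C_pow, show (C 2 : P) = 2 from rfl, mon]; ring
    rw [e1] at h1
    simp only [map_add, L_C] at h1
    rw [hz 1 1 0 rfl, hz 1 0 1 rfl, hz 0 1 1 rfl, hz 0 0 2 rfl] at h1
    simp only [x, y, w]
    norm_num
    linarith
  let Q1 : ℝ × ℝ → ℝ := fun q => q.1 ^ 2 * x 4 + 2 * q.1 * q.2 * x 3 + q.2 ^ 2 * x 2 +
    2 * q.1 * x 2 + 2 * q.2 * x 1
  let Q2 : ℝ × ℝ → ℝ := fun q => q.1 ^ 2 * y 4 + 2 * q.1 * q.2 * y 3 + q.2 ^ 2 * y 2 +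
    2 * q.1 * y 2 + 2 * q.2 * y 1
  have hQ : ∀ p q, 0 ≤ Q1 p + Q2 q + w := by
    intro p q
    have := hfull p.1 p.2 1 q.1 q.2
    simp only [Q1, Q2]; linarith
  obtain ⟨α, hα1, hα2⟩ : ∃ α : ℝ, (∀ p, 0 ≤ Q1 p + α) ∧ ∀ q, 0 ≤ Q2 q + (w - α) := by
    refine ⟨sSup (Set.range fun p => - Q1 p), fun p => ?_, fun q => ?_⟩
    · have : - Q1 p ≤ _ := le_csSup (s := Set.range fun p => - Q1 p)
        ⟨Q2 0 + w, by rintro _ ⟨p, rfl⟩; have := hQ p 0; dsimp only; linarith⟩ ⟨p, rfl⟩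
      linarith
    · have := csSup_le (s := Set.range fun p => - Q1 p) (Set.range_nonempty _) (a := Q2 q + w) (by
        rintro _ ⟨p, rfl⟩; have := hQ p q; dsimp only; linarith)
      linarith
  have hbin : ∀ (x : ℕ → ℝ) (α : ℝ), (∀ a b : ℝ, 0 ≤ a ^ 2 * x 4 + 2 * a * b * x 3 + b ^ 2 * x 2) →
      (∀ a b : ℝ, 0 ≤ a ^ 2 * x 4 + 2 * a * b * x 3 + b ^ 2 * x 2 +
        2 * a * x 2 + 2 * b * x 1 + α) →
      ∃ (N : ℕ) (ρ s t : Fin N → ℝ), (∀ i, 0 ≤ ρ i) ∧ α = ∑ i, ρ i * t i ^ 4 ∧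
      ∀ k, 1 ≤ k → k ≤ 4 → x k = ∑ i, ρ i * (s i ^ k * t i ^ (4 - k)) := by
    intro x α h0 h1
    obtain ⟨N, ρ, s, t, hρ, hrep⟩ := binary_moment 2 (fun k => if k = 0 then α else x k) (by
      intro c
      simp [Finset.sum_range_succ]
      rcases eq_or_ne (c 0) 0 with hc | hc
      · have := h0 (c 2) (c 1)
        rw [hc]; linarith
      · have := mul_nonneg (sq_nonneg (c 0)) (h1 (c 2 / c 0) (c 1 / c 0))
        refine this.trans (le_of_eq ?_)
        field_simp
        ring)
    refine ⟨N, ρ, s, t, hρ, ?_, ?_⟩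
    · simpa using hrep 0 (by norm_num)
    · intro k h1 h4
      have := hrep k (by omega)
      rw [if_neg (by omega)] at this
      exact this
  obtain ⟨N, ρ, s, t, hρ, hr0, hr⟩ := hbin x α (fun a b => by
    have := hfull a b 0 0 0; linarith) (fun a b => by
    have := hα1 (a, b); simpa only [Q1] using this)
  obtain ⟨N', ρ', s', t', hρ', hr0', hr'⟩ := hbin y (w - α) (fun a b => by
    have := hfull 0 0 0 a b; linarith) (fun a b => by
    have := hα2 (a, b); simpa only [Q2] using this)
  refine rep_of_mon L (Fin N ⊕ Fin N') (Sum.elim ρ ρ')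
    (Sum.elim (fun l => ![s l, 0, t l]) (fun l => ![0, s' l, t' l])) (by
      rintro (i | i)
      · exact hρ i
      · exact hρ' i) ?_
  intro i j k h
  simp only [Fintype.sum_sum_type, Sum.elim_inl, Sum.elim_inr]
  rcases i with _ | i
  · rcases j with _ | j
    · obtain rfl : k = 4 := by omega
      simp
      rw [← hr0, ← hr0']
      simp [w]
    · have := hr' (j + 1) (by omega) (by omega)
      obtain rfl : k = 4 - (j + 1) := by omega
      simpa [x, y] using this
  · rcases j with _ | j
    · have := hr (i + 1) (by omega) (by omega)
      obtain rfl : k = 4 - (i + 1) := by omega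
      simpa [x, y] using this
    · simp
      exact hz i j k (by omega)

/-- Diagonal form. -/
noncomputable def dg (d : Fin 3 → ℝ) : P := ∑ i, C (d i) * X i ^ 2

lemma dg_hom (d : Fin 3 → ℝ) : (dg d).IsHomogeneous 2 :=
  IsHomogeneous.sum _ _ _ fun i _ => isHomogeneous_C_mul_X_pow _ _ _

/-- Diagonal statement. -/
def DG (d : Fin 3 → ℝ) : Prop := ∀ L, Good L → Ker L (dg d) → Rep L

lemma ker_neg {L : P →ₗ[ℝ] ℝ} {q : P} (h : Ker L q) : Ker L (-q) :=
  ⟨h.1.neg, fun p hp => by rw [neg_mul, map_neg, h.2 p hp, neg_zero]⟩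

lemma DG_neg {d : Fin 3 → ℝ} (h : DG (-d)) : DG d := by
  intro L hL hK
  apply h L hL
  have : dg (-d) = - dg d := by simp [dg]
  rw [this]; exact ker_neg hK

lemma DG_perm (σ : Equiv.Perm (Fin 3)) {d : Fin 3 → ℝ} (h : DG (d ∘ σ)) : DG d := by
  intro L hL hK
  refine rep_change (dg (d ∘ σ)) (dg_hom _) h (σ.permMatrix ℝ) ?_ L hL ?_
  · rw [Matrix.det_permutation]; simp
  · have : phi (σ.permMatrix ℝ) (dg (d ∘ σ)) = dg d := by
      simp only [dg, map_sum, map_mul, phi_C, map_pow, phi_X]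
      rw [← Equiv.sum_comp σ (fun i => C (d i) * (X i : P) ^ 2)]
      refine Finset.sum_congr rfl fun i _ => ?_
      simp [Equiv.Perm.permMatrix, PEquiv.toMatrix_apply, Equiv.toPEquiv_apply]
    rw [this]; exact hK

lemma DG_nonneg {d : Fin 3 → ℝ} (h0 : 0 < d 0) (h1 : 0 ≤ d 1) (h2 : 0 ≤ d 2) : DG d := by
  intro L hL hK
  have hp := hK.2 (mon 0 2 0) (mon_hom rfl)
  have e : dg d * mon 0 2 0 = C (d 0) * mon 1 1 0 ^ 2 + C (d 1) * mon 0 2 0 ^ 2 +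
    C (d 2) * mon 0 1 1 ^ 2 := by
    simp only [dg, mon, Fin.sum_univ_three]; ring
  rw [e, map_add, map_add, L_C, L_C, L_C] at hp
  have g0 := hL (mon 1 1 0) (mon_hom rfl)
  have g1 := mul_nonneg h1 (hL (mon 0 2 0) (mon_hom rfl))
  have g2 := mul_nonneg h2 (hL (mon 0 1 1) (mon_hom rfl))
  have : L (mon 1 1 0 ^ 2) = 0 := by
    have := mul_nonneg h0.le g0
    have : d 0 * L (mon 1 1 0 ^ 2) = 0 := by linarith
    exact (mul_eq_zero.1 this).resolve_left h0.ne'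
  apply case_xy L hL
  have := ker_of_sq hL (mon_hom rfl) this
  simpa [mon] using this

lemma DG_indef {d : Fin 3 → ℝ} (h0 : 0 < d 0) (h1 : d 1 < 0) (h2 : 0 ≤ d 2) : DG d := by
  intro L hL hK
  obtain ⟨α, hα, eα⟩ : ∃ α : ℝ, 0 < α ∧ d 0 = α ^ 2 :=
    ⟨_, Real.sqrt_pos.2 h0, (Real.sq_sqrt h0.le).symm⟩
  obtain ⟨β, hβ, eβ⟩ : ∃ β : ℝ, 0 < β ∧ d 1 = - β ^ 2 :=
    ⟨_, Real.sqrt_pos.2 (neg_pos.2 h1), by rw [Real.sq_sqrt (by linarith)]; ring⟩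
  obtain ⟨γ, hγ, eγ⟩ : ∃ γ : ℝ, 0 ≤ γ ∧ d 2 = γ ^ 2 :=
    ⟨_, Real.sqrt_nonneg _, (Real.sq_sqrt h2).symm⟩
  have hdg : dg d = C α ^ 2 * X 0 ^ 2 - C β ^ 2 * X 1 ^ 2 + C γ ^ 2 * X 2 ^ 2 := by
    simp only [dg, Fin.sum_univ_three, eα, eβ, eγ, C_neg, C_pow]; ring
  rcases hγ.eq_or_lt with hγ0 | hγ
  · refine rep_change (X 0 * X 1) ((isHomogeneous_X _ _).mul (isHomogeneous_X _ _)) case_xy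
      !![α, -β, 0; α, β, 0; 0, 0, 1] ?_ L hL ?_
    · rw [Matrix.det_fin_three]; simp; nlinarith [mul_pos hα hβ]
    · convert hK using 1
      rw [hdg, ← hγ0]
      simp [phi_X, Fin.sum_univ_three]; ring
  · refine rep_change (X 0 * X 2 - X 1 ^ 2) (((isHomogeneous_X _ _).mul (isHomogeneous_X _ _)).sub
      (isHomogeneous_X_pow _ _)) case_conic
      !![α, -β, 0; 0, 0, γ; -α, -β, 0] ?_ L hL ?_
    · rw [Matrix.det_fin_three]; simp
      have := mul_pos (mul_pos hα hβ) hγ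
      nlinarith
    · convert ker_neg hK using 1
      rw [hdg]
      simp [phi_X, Fin.sum_univ_three]; ring

lemma DG_pos {d : Fin 3 → ℝ} (h0 : 0 < d 0) : DG d := by
  rcases le_or_gt 0 (d 1) with h1 | h1
  · rcases le_or_gt 0 (d 2) with h2 | h2
    · exact DG_nonneg h0 h1 h2
    · exact DG_perm (Equiv.swap 1 2) (DG_indef (by simpa [Equiv.swap_apply_def] using h0)
        (by simpa using h2) (by simpa using h1))
  · rcases le_or_gt 0 (d 2) with h2 | h2
    · exact DG_indef h0 h1 h2
    · exact DG_neg (DG_perm (Equiv.swap 0 1) (DG_indef (by simpa using h1)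
        (by simpa using h0) (by simpa [Equiv.swap_apply_def] using h2.le)))

lemma DG_all {d : Fin 3 → ℝ} (h : d ≠ 0) : DG d := by
  obtain ⟨i, hi⟩ := Function.ne_iff.1 h
  rcases lt_or_gt_of_ne hi with hi | hi
  · exact DG_neg (DG_perm (Equiv.swap 0 i) (DG_pos (by simpa using hi)))
  · exact DG_perm (Equiv.swap 0 i) (DG_pos (by simpa using hi))

/-- Any nonzero quadratic form in the kernel. -/
lemma rep_of_sym (Q : Matrix (Fin 3) (Fin 3) ℝ) (hQ : Q.IsHermitian) (hQ0 : Q ≠ 0)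
    (L : P →ₗ[ℝ] ℝ) (hL : Good L) (hK : Ker L (∑ a, ∑ b, C (Q a b) * (X a * X b))) : Rep L := by
  have hd : hQ.eigenvalues ≠ 0 := fun h => hQ0 (hQ.eigenvalues_eq_zero_iff.1 h)
  obtain ⟨U, hU⟩ : ∃ U : Matrix (Fin 3) (Fin 3) ℝ, U = ↑hQ.eigenvectorUnitary := ⟨_, rfl⟩
  have hUU : U * star U = 1 := by
    rw [hU]; exact Unitary.mul_star_self_of_mem hQ.eigenvectorUnitary.2
  have hsp : Q = U * diagonal hQ.eigenvalues * star U := by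
    conv_lhs => rw [hQ.spectral_theorem]
    rw [hU]; rfl
  refine rep_change _ (dg_hom _) (DG_all hd) (star U) ?_ L hL ?_
  · intro h
    have := congrArg Matrix.det hUU
    rw [Matrix.det_mul, h] at this
    simp at this
  · convert hK using 1
    have : ∀ a b, Q a b = ∑ i, U a i * hQ.eigenvalues i * U b i := by
      intro a b
      conv_lhs => rw [hsp]
      simp [Matrix.mul_apply, Matrix.diagonal_apply, Matrix.star_apply]
    simp only [this, dg, map_sum, map_mul, phi_C, map_pow, phi_X, Matrix.star_apply, star_trivial]
    simp only [Fin.sum_univ_three]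
    ring

end TQ

namespace TQ
open MvPolynomial

/-- Moments read off from the matrix. -/
def mom (A : Matrix (Fin 6) (Fin 6) ℝ) : ℕ → ℕ → ℕ → ℝ
  | 4, 0, 0 => A 0 0
  | 3, 1, 0 => A 0 1
  | 3, 0, 1 => A 0 2
  | 2, 2, 0 => A 0 3
  | 2, 1, 1 => A 0 4
  | 2, 0, 2 => A 0 5
  | 1, 3, 0 => A 1 3
  | 1, 2, 1 => A 1 4
  | 1, 1, 2 => A 1 5
  | 1, 0, 3 => A 2 5
  | 0, 4, 0 => A 3 3
  | 0, 3, 1 => A 3 4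
  | 0, 2, 2 => A 3 5
  | 0, 1, 3 => A 4 5
  | 0, 0, 4 => A 5 5
  | _, _, _ => 0

/-- The functional of a matrix. -/
noncomputable def Lf (A : Matrix (Fin 6) (Fin 6) ℝ) : P →ₗ[ℝ] ℝ :=
  (basisMonomials (Fin 3) ℝ).constr ℝ fun d => mom A (d 0) (d 1) (d 2)

lemma Lf_mon (A : Matrix (Fin 6) (Fin 6) ℝ) (i j k : ℕ) : Lf A (mon i j k) = mom A i j k := by
  have : mon i j k = basisMonomials (Fin 3) ℝ
      (Finsupp.single 0 i + Finsupp.single 1 j + Finsupp.single 2 k) := by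
    simp [mon, X_pow_eq_monomial, monomial_mul]
  rw [this, Lf, Module.Basis.constr_basis]
  simp

/-- The degree two monomials. -/
noncomputable def bas : Fin 6 → P :=
  ![mon 2 0 0, mon 1 1 0, mon 1 0 1, mon 0 2 0, mon 0 1 1, mon 0 0 2]

lemma bas_hom (i : Fin 6) : (bas i).IsHomogeneous 2 := by
  fin_cases i <;> exact mon_hom rfl

lemma Lf_bas {A : Matrix (Fin 6) (Fin 6) ℝ} (hA : memC A) (i j : Fin 6) :
    Lf A (bas i * bas j) = A i j := by
  obtain ⟨hp, h1, h2, h3, h4, h5, h6⟩ := hA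
  have hs : ∀ i j, A i j = A j i := fun i j => by simpa using hp.1.apply j i
  have key : ∀ i j : Fin 6, i ≤ j → Lf A (bas i * bas j) = A i j := by
    intro i j hij
    fin_cases i <;> fin_cases j <;> first
      | exact absurd hij (by decide)
      | (simp [bas, mon_mul, Lf_mon, mom]; done)
      | (simp [bas, mon_mul, Lf_mon, mom]; assumption)
  rcases le_total i j with h | h
  · exact key i j h
  · rw [mul_comm, key j i h, hs]

lemma quad_exists {p : P} (hp : p.IsHomogeneous 2) : ∃ c : Fin 6 → ℝ, p = ∑ i, C (c i) * bas i := by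
  have : p ∈ Submodule.span ℝ (Set.range bas) := by
    obtain ⟨h1, h2⟩ := hom_sum hp
    rw [h1]
    refine Submodule.sum_mem _ fun d hd => ?_
    rw [← smul_eq_C_mul]
    apply Submodule.smul_mem
    apply Submodule.subset_span
    have h := h2 d hd
    generalize d 0 = i at *
    generalize d 1 = j at *
    generalize d 2 = k at *
    have hi : i ≤ 2 := by omega
    have hj : j ≤ 2 := by omega
    obtain rfl : k = 2 - i - j := by omega
    interval_cases i <;> interval_cases j <;> first
      | omega
      | exact ⟨0, rfl⟩
      | exact ⟨1, rfl⟩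
      | exact ⟨2, rfl⟩
      | exact ⟨3, rfl⟩
      | exact ⟨4, rfl⟩
      | exact ⟨5, rfl⟩
  obtain ⟨c, hc⟩ := (Submodule.mem_span_range_iff_exists_fun ℝ).1 this
  exact ⟨c, by simp only [← hc, smul_eq_C_mul]⟩

lemma Lf_mul {A : Matrix (Fin 6) (Fin 6) ℝ} (hA : memC A) (c d : Fin 6 → ℝ) :
    Lf A ((∑ i, C (c i) * bas i) * (∑ i, C (d i) * bas i)) = c ⬝ᵥ (A *ᵥ d) := by
  rw [Finset.sum_mul_sum]
  simp only [map_sum, dotProduct, Matrix.mulVec, Finset.mul_sum]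
  refine Finset.sum_congr rfl fun i _ => Finset.sum_congr rfl fun j _ => ?_
  have e : C (c i) * bas i * (C (d j) * bas j) = C (c i * d j) * (bas i * bas j) := by
    rw [C_mul]; ring
  rw [e, L_C, Lf_bas hA]; ring

lemma Lf_good {A : Matrix (Fin 6) (Fin 6) ℝ} (hA : memC A) : Good (Lf A) := by
  intro p hp
  obtain ⟨c, rfl⟩ := quad_exists hp
  rw [sq, Lf_mul hA]
  simpa using hA.1.dotProduct_mulVec_nonneg c

/-- Matrix representation. -/
def MRep (A : Matrix (Fin 6) (Fin 6) ℝ) : Prop :=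
  ∃ (ι : Type) (_ : Fintype ι) (ρ : ι → ℝ) (a : ι → Fin 3 → ℝ), (∀ i, 0 ≤ ρ i) ∧
    A = ∑ i, ρ i • vecMulVec (v (a i 0) (a i 1) (a i 2)) (v (a i 0) (a i 1) (a i 2))

lemma eval_bas (a : Fin 3 → ℝ) (i : Fin 6) : eval a (bas i) = v (a 0) (a 1) (a 2) i := by
  fin_cases i <;> simp [bas, mon, v]

lemma mrep_singular {A : Matrix (Fin 6) (Fin 6) ℝ} (hA : memC A) (c : Fin 6 → ℝ) (hc : c ≠ 0)
    (hAc : A *ᵥ c = 0) : MRep A := by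
  have hK : Ker (Lf A) (∑ i, C (c i) * bas i) := by
    refine ⟨IsHomogeneous.sum _ _ _ fun i _ => (bas_hom i).C_mul _, fun p hp => ?_⟩
    obtain ⟨d, rfl⟩ := quad_exists hp
    rw [mul_comm, Lf_mul hA, hAc]; simp
  let Q : Matrix (Fin 3) (Fin 3) ℝ :=
    !![c 0, c 1 / 2, c 2 / 2; c 1 / 2, c 3, c 4 / 2; c 2 / 2, c 4 / 2, c 5]
  have hQ : Q.IsHermitian := by
    ext i j
    fin_cases i <;> fin_cases j <;> simp [Q]
  have hQ0 : Q ≠ 0 := by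
    intro h
    apply hc
    have h' : ∀ i j, Q i j = 0 := fun i j => by rw [h]; rfl
    have h0 := h' 0 0
    have h1 := h' 0 1
    have h2 := h' 0 2
    have h3 := h' 1 1
    have h4 := h' 1 2
    have h5 := h' 2 2
    simp [Q] at h0 h1 h2 h3 h4 h5
    ext i
    fin_cases i <;> simp [h0, h1, h2, h3, h4, h5]
  have hsum : ∑ i, C (c i) * bas i = ∑ a, ∑ b, C (Q a b) * (X a * X b) := by
    have hh : ∀ r : ℝ, (C r : P) = 2 * C (r / 2) := by
      intro r
      rw [show (2 : P) = C 2 from rfl, ← C_mul]; congr 1; ring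
    simp only [Fin.sum_univ_succ, Fin.sum_univ_zero]
    simp [Q, bas, mon]
    rw [hh (c 1), hh (c 2), hh (c 4)]
    ring
  rw [hsum] at hK
  obtain ⟨ι, _, ρ, a, hρ, h⟩ := rep_of_sym Q hQ hQ0 (Lf A) (Lf_good hA) hK
  refine ⟨ι, inferInstance, ρ, a, hρ, ?_⟩
  ext i j
  rw [← Lf_bas hA, h _ ((bas_hom i).mul (bas_hom j))]
  simp only [Matrix.sum_apply, Matrix.smul_apply, vecMulVec_apply, smul_eq_mul, map_mul, eval_bas]

lemma mrep_all {A : Matrix (Fin 6) (Fin 6) ℝ} (hA : memC A) : MRep A := by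
  by_cases hdet : A.det = 0
  · obtain ⟨c, hc, hAc⟩ := Matrix.exists_mulVec_eq_zero_iff.2 hdet
    exact mrep_singular hA c hc hAc
  · set e : Fin 6 → ℝ := v 1 0 0 with he
    have hev : e = Pi.single 0 1 := by
      ext i; fin_cases i <;> simp [he, v]
    set q := A⁻¹ *ᵥ e with hq
    have hAq : A *ᵥ q = e := by
      rw [hq, Matrix.mulVec_mulVec, Matrix.mul_nonsing_inv _ (isUnit_iff_ne_zero.2 hdet),
        Matrix.one_mulVec]
    have hdot : ∀ u : Fin 6 → ℝ, u ⬝ᵥ e = u 0 := by intro u; rw [hev]; simp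
    have hq0 : q ≠ 0 := by
      intro h
      rw [h, Matrix.mulVec_zero] at hAq
      have := congrFun hAq 0
      rw [hev] at this; simp at this
    have hs : 0 < q 0 := by
      have h1 : 0 ≤ q ⬝ᵥ (A *ᵥ q) := by simpa using hA.1.dotProduct_mulVec_nonneg q
      rw [hAq, hdot] at h1
      refine lt_of_le_of_ne h1 fun h => ?_
      have := (hA.1.dotProduct_mulVec_zero_iff q).1 (by simp [hAq, hdot, ← h])
      rw [hAq] at this
      have := congrFun this 0
      rw [hev] at this; simp at this
    have hsym : ∀ i j, A i j = A j i := fun i j => by simpa using hA.1.1.apply j i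
    have hT : Aᵀ = A := by ext i j; exact hsym j i
    have hqu : ∀ u, q ⬝ᵥ (A *ᵥ u) = u 0 := by
      intro u
      rw [Matrix.dotProduct_mulVec, ← Matrix.mulVec_transpose, hT, hAq, dotProduct_comm, hdot]
    set A' := A - (q 0)⁻¹ • vecMulVec e e with hA'
    have hmv : ∀ u, A' *ᵥ u = A *ᵥ u - ((q 0)⁻¹ * u 0) • e := by
      intro u
      rw [hA', Matrix.sub_mulVec, Matrix.smul_mulVec, Matrix.vecMulVec_mulVec, dotProduct_comm, hdot]
      simp [smul_smul]
    have hC : memC A' := by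
      refine ⟨?_, ?_⟩
      · refine Matrix.PosSemidef.of_dotProduct_mulVec_nonneg ?_ ?_
        · ext i j
          simp [hA', vecMulVec_apply, hsym i j, mul_comm]
        · intro u
          have h1 : 0 ≤ (u - (u 0 / q 0) • q) ⬝ᵥ (A *ᵥ (u - (u 0 / q 0) • q)) := by
            simpa using hA.1.dotProduct_mulVec_nonneg (u - (u 0 / q 0) • q)
          rw [Matrix.mulVec_sub, Matrix.mulVec_smul, hAq] at h1
          simp only [sub_dotProduct, dotProduct_sub, smul_dotProduct, dotProduct_smul, hqu, hdot,
            smul_eq_mul, Pi.sub_apply, Pi.smul_apply] at h1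
          rw [hmv]
          simp only [star_trivial, dotProduct_sub, dotProduct_smul, hdot, smul_eq_mul]
          refine h1.trans (le_of_eq ?_)
          field_simp
          ring
      · obtain ⟨_, h1, h2, h3, h4, h5, h6⟩ := hA
        simp [hA', vecMulVec_apply, hev, h1, h2, h3, h4, h5, h6]
    obtain ⟨ι, _, ρ, a, hρ, h⟩ := mrep_singular hC q hq0 (by
      rw [hmv, hAq]
      rw [inv_mul_cancel₀ hs.ne']; simp)
    refine ⟨Option ι, inferInstance, fun o => o.elim (q 0)⁻¹ ρ, fun o => o.elim ![1, 0, 0] a, ?_, ?_⟩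
    · rintro (_ | i)
      · exact (inv_pos.2 hs).le
      · exact hρ i
    · rw [Fintype.sum_option]
      simp only [Option.elim_none, Option.elim_some]
      rw [← h, hA']
      simp [he]

end TQ

/-- Every element of the cone 𝒞 is a nonnegative linear combination of
matrices of the form `v(x,y,z) v(x,y,z)ᵀ`. -/
theorem memC_is_nonneg_combination_of_rank_ones
    (A : Matrix (Fin 6) (Fin 6) ℝ) (hA : memC A) :
    ∃ (m : ℕ) (ρ : Fin m → ℝ) (x y z : Fin m → ℝ),
      (∀ i, 0 ≤ ρ i) ∧
      A = ∑ i, ρ i • vecMulVec (v (x i) (y i) (z i)) (v (x i) (y i) (z i)) := by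
  obtain ⟨ι, _, ρ, a, hρ, h⟩ := TQ.mrep_all hA
  let e := (Fintype.equivFin ι).symm
  refine ⟨Fintype.card ι, fun i => ρ (e i), fun i => a (e i) 0, fun i => a (e i) 1,
    fun i => a (e i) 2, fun i => hρ _, ?_⟩
  rw [Equiv.sum_comp e (fun i => ρ i • vecMulVec (v (a i 0) (a i 1) (a i 2))
    (v (a i 0) (a i 1) (a i 2)))]
  exact h
end

section
/- No rank 3 element of the cone 𝒞 generates an extreme ray: if A ∈ 𝒞 has rank 3, then there exist B, C ∈ 𝒞 with A = B + C such that B is not a nonnegative scalar multiple of A. -/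
open Matrix

lemma nonflat (T : (Fin 3 → ℝ) →ₗ[ℝ] (Fin 3 → ℝ) →ₗ[ℝ] (Fin 3 → ℝ))
    (hs : ∀ a b, T a b = T b a)
    (hn : ∀ w : Fin 3 → ℝ, (∀ a b, w ⬝ᵥ T a b = 0) → w = 0)
    (hk : ∀ a, ∃ m, m ≠ 0 ∧ T a m = 0) :
    ∃ w : Fin 3 → ℝ, w ≠ 0 ∧ ∃ (c : ℝ) (p : Fin 3 → ℝ),
      ∀ a b, w ⬝ᵥ T a b = c * (p ⬝ᵥ a) * (p ⬝ᵥ b) := by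
  have hD : ∀ a x y z, (T a x) ⬝ᵥ ((T a y) ⨯₃ (T a z)) = 0 := by
    intro a x y z
    obtain ⟨m, hm, hTm⟩ := hk a
    have h0 : (LinearMap.toMatrix' (T a)).det = 0 := by
      rw [← Matrix.exists_mulVec_eq_zero_iff]
      exact ⟨m, hm, by rw [LinearMap.toMatrix'_mulVec, hTm]⟩
    have h1 : (LinearMap.toMatrix' (T a) * (Matrix.of ![x, y, z])ᵀ)ᵀ
        = ![T a x, T a y, T a z] := by
      have e : ∀ u, T a u = LinearMap.toMatrix' (T a) *ᵥ u := fun u => by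
        rw [LinearMap.toMatrix'_mulVec]
      rw [e x, e y, e z]
      generalize LinearMap.toMatrix' (T a) = N
      ext i j
      fin_cases i <;> simp [Matrix.mul_apply, Matrix.mulVec, dotProduct]
    rw [triple_product_eq_det, ← h1, det_transpose, det_mul, h0, zero_mul]
  -- independent pair
  have hpair : ∃ l b, (T l l) ⨯₃ (T l b) ≠ 0 := by
    by_contra! hc
    have hex : ∃ a, T a a ≠ 0 := by
      by_contra! h0
      have hT : ∀ a b, T a b = 0 := by
        intro a b
        have h1 := h0 (a + b)
        simp only [map_add, LinearMap.add_apply, h0, hs b a, zero_add, add_zero] at h1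
        have : (2 : ℝ) • T a b = 0 := by rw [two_smul]; exact h1
        simpa using this
      have := hn ![1, 0, 0] (fun a b => by simp [hT])
      simpa using congrFun this 0
    obtain ⟨a, ha⟩ := hex
    have h1 : ∀ n b, (T a a) ⨯₃ (T n b) = 0 := by
      intro n b
      have p1 := hc (a + n) b
      have p2 := hc (a - n) b
      have p3 := hc n b
      have q1 := hc a n
      have q2 := hc a b
      -- T a n × T a b = 0
      have q3 : (T a n) ⨯₃ (T a b) = 0 := by
        have ha' : ∃ i, T a a i ≠ 0 := by
          by_contra! h; exact ha (funext h)
        simp only [cross_apply] at q1 q2 ⊢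
        generalize T a a = A at *
        generalize T a n = B at *
        generalize T a b = C at *
        have a0 := congrFun q1 0
        have a1 := congrFun q1 1
        have a2 := congrFun q1 2
        have b0 := congrFun q2 0
        have b1 := congrFun q2 1
        have b2 := congrFun q2 2
        simp at a0 a1 a2 b0 b1 b2
        obtain ⟨i, hi⟩ := ha'
        ext j
        apply mul_left_cancel₀ hi
        fin_cases i <;> fin_cases j <;> simp <;> grind
      simp only [map_add, map_sub, LinearMap.add_apply, LinearMap.sub_apply, hs n a] at p1 p2
      simp only [p3, q2, q3] at p1 p2
      generalize (T a a) ⨯₃ (T n b) = A1 at *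
      generalize (T a n) ⨯₃ (T n b) = A2 at *
      generalize (T n n) ⨯₃ (T a b) = A3 at *
      ext i
      have := congrFun p1 i
      have := congrFun p2 i
      simp at *
      linarith
    -- contradiction
    have ha' : ∃ u : Fin 3 → ℝ, u ≠ 0 ∧ u ⬝ᵥ T a a = 0 := by
      by_cases h : T a a 0 = 0 ∧ T a a 1 = 0
      · exact ⟨![1,0,0], fun h => by simpa using congrFun h 0, by simp [dotProduct, Fin.sum_univ_three, h]⟩
      · refine ⟨![T a a 1, -T a a 0, 0], fun h' => h ?_, by simp [dotProduct, Fin.sum_univ_three]; ring⟩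
        exact ⟨by simpa using congrFun h' 1, by simpa using congrFun h' 0⟩
    obtain ⟨u, hu, hua⟩ := ha'
    apply hu
    apply hn
    intro n b
    have q1 := h1 n b
    have ha' : ∃ i, T a a i ≠ 0 := by
      by_contra! h; exact ha (funext h)
    obtain ⟨i, hi⟩ := ha'
    simp only [cross_apply] at q1
    have a0 := congrFun q1 0
    have a1 := congrFun q1 1
    have a2 := congrFun q1 2
    simp at a0 a1 a2
    simp only [dotProduct, Fin.sum_univ_three] at hua ⊢
    apply mul_left_cancel₀ hi
    fin_cases i <;> simp <;> grind
  obtain ⟨l, b, hw⟩ := hpair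
  obtain ⟨m, hm, hlm⟩ := hk l
  set w := (T l l) ⨯₃ (T l b) with hwdef
  have hwl : ∀ x, w ⬝ᵥ T l x = 0 := by
    intro x
    rw [dotProduct_comm]; exact hD l x l b
  have hwm : ∀ n, w ⬝ᵥ T n m = 0 := by
    intro n
    have p1 := hD (l + n) m l b
    have p2 := hD (l - n) m l b
    have p3 := hD n m l b
    simp only [map_add, map_sub, LinearMap.add_apply, LinearMap.sub_apply, hlm, zero_add, zero_sub,
      dotProduct_add, dotProduct_sub, neg_dotProduct, p3] at p1 p2
    rw [dotProduct_comm, hwdef]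
    linarith
  refine ⟨w, hw, ?_⟩
  set k := l ⨯₃ m with hk'
  have hkk : k ≠ 0 := by
    intro h0
    have hl : T l l ≠ 0 := by
      intro h; apply hw; simp [hwdef, h]
    -- m parallel to l
    obtain ⟨j, hj⟩ : ∃ j, m j ≠ 0 := by
      by_contra! h; exact hm (funext h)
    have e : m j • l = l j • m := by
      rw [hk'] at h0
      simp only [cross_apply] at h0
      have a0 := congrFun h0 0
      have a1 := congrFun h0 1
      have a2 := congrFun h0 2
      simp at a0 a1 a2
      ext i
      fin_cases i <;> fin_cases j <;> simp <;> grind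
    have h2 := congrArg (T l) e
    rw [map_smul, map_smul, hlm, smul_zero] at h2
    exact hl ((smul_eq_zero.mp h2).resolve_left hj)
  have hk2 : k ⬝ᵥ k ≠ 0 := by simpa using hkk
  have hdec : ∀ a : Fin 3 → ℝ, ∃ s t : ℝ, (k ⬝ᵥ k) • a = s • l + t • m + (k ⬝ᵥ a) • k := by
    intro a
    refine ⟨a ⬝ᵥ (m ⨯₃ k), a ⬝ᵥ (k ⨯₃ l), ?_⟩
    ext i
    fin_cases i <;> simp [hk', cross_apply, dotProduct, Fin.sum_univ_three] <;> ring
  refine ⟨w ⬝ᵥ T k k / (k ⬝ᵥ k)^2, k, fun x y => ?_⟩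
  obtain ⟨s, t, hx⟩ := hdec x
  obtain ⟨s', t', hy⟩ := hdec y
  have h3 : w ⬝ᵥ T ((k ⬝ᵥ k) • x) ((k ⬝ᵥ k) • y) = (k ⬝ᵥ x) * (k ⬝ᵥ y) * (w ⬝ᵥ T k k) := by
    have hwl' : ∀ x, w ⬝ᵥ T x l = 0 := fun x => by rw [hs]; exact hwl x
    have hwm' : ∀ x, w ⬝ᵥ T m x = 0 := fun x => by rw [hs]; exact hwm x
    rw [hx, hy]
    simp only [map_add, map_smul, LinearMap.add_apply, LinearMap.smul_apply, dotProduct_add,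
      dotProduct_smul, hwl, hwm, hwl', hwm', smul_eq_mul]
    ring
  simp only [map_smul, LinearMap.smul_apply, dotProduct_smul, smul_eq_mul] at h3
  field_simp
  linarith

lemma flat {E V : Type*} [AddCommGroup E] [Module ℝ E] [NormedAddCommGroup V]
    [InnerProductSpace ℝ V] [FiniteDimensional ℝ V] [Nontrivial V]
    (T : E →ₗ[ℝ] E →ₗ[ℝ] V) (hs : ∀ a b, T a b = T b a)
    (hF : ∀ a b c d, inner ℝ (T a b) (T c d) = inner ℝ (T a c) (T b d))
    (l : E) (e : E ≃ₗ[ℝ] V) (he : ∀ b, e b = T l b) :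
    ∃ w : V, w ≠ 0 ∧ ∃ (c : ℝ) (p : E → ℝ),
      ∀ a b, inner ℝ w (T a b) = c * p a * p b := by
  let X : E → (V →ₗ[ℝ] V) := fun a => (T a).comp e.symm.toLinearMap
  have hX : ∀ a b, X a (T l b) = T a b := by
    intro a b; simp [X, ← he]
  have hsur : ∀ u, ∃ x, T l x = u := fun u => ⟨e.symm u, by simp [← he]⟩
  have hsym : ∀ a, (X a).IsSymmetric := by
    intro a u v
    obtain ⟨x, rfl⟩ := hsur u
    obtain ⟨y, rfl⟩ := hsur v
    rw [hX, hX, hs a x, hF, hs x l]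
  have hcomm : Pairwise fun a b => Commute (X a) (X b) := by
    intro a b _
    ext u
    refine ext_inner_right ℝ fun v => ?_
    obtain ⟨x, rfl⟩ := hsur u
    obtain ⟨y, rfl⟩ := hsur v
    simp only [Module.End.mul_apply]
    rw [hsym a, hsym b (X a _), hX, hX, hX, hX, hs b x, hF, hs x a]
  have htop := LinearMap.IsSymmetric.iSup_iInf_eq_top_of_commute hsym hcomm
  have : ∃ χ : E → ℝ, (⨅ a, Module.End.eigenspace (X a) (χ a)) ≠ ⊥ := by
    by_contra! h
    simp only [h, iSup_bot] at htop
    exact bot_ne_top htop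
  obtain ⟨p, hp⟩ := this
  obtain ⟨w, hw, hw0⟩ := Submodule.exists_mem_ne_zero_of_ne_bot hp
  have hw' : ∀ a, X a w = p a • w := by
    intro a
    exact Module.End.mem_eigenspace_iff.mp ((Submodule.mem_iInf _).mp hw a)
  refine ⟨w, hw0, inner ℝ w (T l l), p, fun a b => ?_⟩
  have step : ∀ a x, inner ℝ w (T a x) = p a * inner ℝ w (T l x) := by
    intro a x
    rw [← hX, ← hsym, hw', inner_smul_left]; simp
  rw [step, hs, step]; ring

lemma exists_factor (A : Matrix (Fin 6) (Fin 6) ℝ) (hA : A.PosSemidef) (hr : A.rank = 3) :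
    ∃ U : Matrix (Fin 3) (Fin 6) ℝ, A = Uᵀ * U := by
  have hc := hA.1.rank_eq_card_non_zero_eigs
  rw [hr] at hc
  let f : Fin 3 ≃ {i // hA.1.eigenvalues i ≠ 0} :=
    (Fintype.equivFinOfCardEq hc.symm).symm
  refine ⟨Matrix.of fun k j => Real.sqrt (hA.1.eigenvalues (f k)) *
    (hA.1.eigenvectorUnitary : Matrix (Fin 6) (Fin 6) ℝ) j (f k), ?_⟩
  ext i j
  have h := congrFun (congrFun hA.1.spectral_theorem i) j
  rw [Unitary.conjStarAlgAut_apply] at h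
  rw [h]
  simp only [Matrix.mul_apply, Matrix.transpose_apply, Matrix.of_apply, Matrix.diagonal_apply,
    Matrix.star_apply, Function.comp]
  simp only [mul_ite, mul_zero, Finset.sum_ite_eq', Finset.mem_univ, if_true]
  generalize (hA.1.eigenvectorUnitary : Matrix (Fin 6) (Fin 6) ℝ) = Q at *
  rw [f.sum_comp (fun k => Real.sqrt (hA.1.eigenvalues k) * Q i k *
    (Real.sqrt (hA.1.eigenvalues k) * Q j k))]
  have hsq : ∀ k, Q i k * ((hA.1.eigenvalues k : ℝ)) * star (Q j k) =
      Real.sqrt (hA.1.eigenvalues k) * Q i k * (Real.sqrt (hA.1.eigenvalues k) * Q j k) := by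
    intro k
    have := Real.mul_self_sqrt (hA.eigenvalues_nonneg k)
    rw [star_trivial]
    linear_combination (- Q i k * Q j k) * this
  refine (Finset.sum_congr rfl fun k _ => hsq k).trans ?_
  refine (Finset.sum_filter_of_ne (p := fun k => hA.1.eigenvalues k ≠ 0) fun k _ hk h0 => hk ?_).symm.trans
    (Finset.sum_subtype _ (fun k => by simp) _)
  simp [h0]

def bil (U : Matrix (Fin 3) (Fin 6) ℝ) :
    (Fin 3 → ℝ) →ₗ[ℝ] (Fin 3 → ℝ) →ₗ[ℝ] (Fin 3 → ℝ) :=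
  LinearMap.mk₂ ℝ (fun a b k => a 0 * b 0 * U k 0 + (a 0 * b 1 + a 1 * b 0) * U k 1
    + (a 0 * b 2 + a 2 * b 0) * U k 2 + a 1 * b 1 * U k 3 + (a 1 * b 2 + a 2 * b 1) * U k 4
    + a 2 * b 2 * U k 5)
    (by intros; ext k; simp; ring) (by intros; ext k; simp; ring)
    (by intros; ext k; simp; ring) (by intros; ext k; simp; ring)

lemma bil_apply (U : Matrix (Fin 3) (Fin 6) ℝ) (a b : Fin 3 → ℝ) (k : Fin 3) :
    bil U a b k = a 0 * b 0 * U k 0 + (a 0 * b 1 + a 1 * b 0) * U k 1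
    + (a 0 * b 2 + a 2 * b 0) * U k 2 + a 1 * b 1 * U k 3 + (a 1 * b 2 + a 2 * b 1) * U k 4
    + a 2 * b 2 * U k 5 := rfl

/-- The key step: some nonzero `w` with `w U` proportional to a Veronese point. -/
lemma key (U : Matrix (Fin 3) (Fin 6) ℝ) (hU : ∀ w : Fin 3 → ℝ, w ᵥ* U = 0 → w = 0)
    (hC : memC (Uᵀ * U)) :
    ∃ w : Fin 3 → ℝ, w ≠ 0 ∧ ∃ (c : ℝ) (p : Fin 3 → ℝ),
      w ᵥ* U = c • v (p 0) (p 1) (p 2) := by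
  have hs : ∀ a b, bil U a b = bil U b a := by
    intro a b; ext k; rw [bil_apply, bil_apply]; ring
  have hcoord : ∀ w : Fin 3 → ℝ, ∀ a b, w ⬝ᵥ bil U a b =
      a 0 * b 0 * (w ᵥ* U) 0 + (a 0 * b 1 + a 1 * b 0) * (w ᵥ* U) 1
      + (a 0 * b 2 + a 2 * b 0) * (w ᵥ* U) 2 + a 1 * b 1 * (w ᵥ* U) 3
      + (a 1 * b 2 + a 2 * b 1) * (w ᵥ* U) 4 + a 2 * b 2 * (w ᵥ* U) 5 := by
    intro w a b
    simp only [dotProduct, Matrix.vecMul, Fin.sum_univ_three, bil_apply]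
    ring
  -- the final conversion
  have conv : ∀ (w : Fin 3 → ℝ) (c : ℝ) (p : (Fin 3 → ℝ) → ℝ),
      (∀ a b, w ⬝ᵥ bil U a b = c * p a * p b) →
      w ᵥ* U = c • v (p ![1, 0, 0]) (p ![0, 1, 0]) (p ![0, 0, 1]) := by
    intro w c p h
    have h00 := h ![1, 0, 0] ![1, 0, 0]
    have h01 := h ![1, 0, 0] ![0, 1, 0]
    have h02 := h ![1, 0, 0] ![0, 0, 1]
    have h11 := h ![0, 1, 0] ![0, 1, 0]
    have h12 := h ![0, 1, 0] ![0, 0, 1]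
    have h22 := h ![0, 0, 1] ![0, 0, 1]
    rw [hcoord] at h00 h01 h02 h11 h12 h22
    simp at h00 h01 h02 h11 h12 h22
    ext i
    fin_cases i <;> simp [v, *] <;> ring
  have hn : ∀ w : Fin 3 → ℝ, (∀ a b, w ⬝ᵥ bil U a b = 0) → w = 0 := by
    intro w h
    apply hU
    have := conv w 0 (fun _ => 0) (fun a b => by rw [h]; ring)
    rw [this, zero_smul]
  by_cases hk : ∀ a, ∃ m, m ≠ 0 ∧ bil U a m = 0
  · obtain ⟨w, hw, c, p, h⟩ := nonflat (bil U) hs hn hk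
    exact ⟨w, hw, c, ![_, _, _], conv w c (fun a => p ⬝ᵥ a) h⟩
  · push Not at hk
    obtain ⟨l, hl⟩ := hk
    have hinj : Function.Injective (bil U l) := by
      rw [injective_iff_map_eq_zero]
      intro m hm
      by_contra h
      exact hl m h hm
    let L : (Fin 3 → ℝ) ≃ₗ[ℝ] EuclideanSpace ℝ (Fin 3) := (WithLp.linearEquiv 2 ℝ (Fin 3 → ℝ)).symm
    let T : (Fin 3 → ℝ) →ₗ[ℝ] (Fin 3 → ℝ) →ₗ[ℝ] EuclideanSpace ℝ (Fin 3) :=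
      (bil U).compr₂ L.toLinearMap
    have hin : ∀ x y : Fin 3 → ℝ, inner ℝ (L x) (L y) = x ⬝ᵥ y := by
      intro x y
      simp [L, PiLp.inner_apply, dotProduct, mul_comm]
    have hT : ∀ a b, T a b = L (bil U a b) := fun a b => rfl
    obtain ⟨w, hw, c, p, h⟩ := flat T (fun a b => by rw [hT, hT, hs]) (by
      intro a b c d
      rw [hT, hT, hT, hT, hin, hin]
      obtain ⟨-, h1, h2, h3, h4, h5, h6⟩ := hC
      simp only [Matrix.mul_apply, Matrix.transpose_apply, Fin.sum_univ_three] at h1 h2 h3 h4 h5 h6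
      simp only [dotProduct, Fin.sum_univ_three, bil_apply]
      linear_combination (a 0 * b 0 * c 1 * d 1 + a 1 * b 1 * c 0 * d 0
          - (a 0 * c 0 * b 1 * d 1 + a 1 * c 1 * b 0 * d 0)) * h1
        + (a 0 * b 0 * (c 1 * d 2 + c 2 * d 1) + (a 1 * b 2 + a 2 * b 1) * c 0 * d 0
          - (a 0 * c 0 * (b 1 * d 2 + b 2 * d 1) + (a 1 * c 2 + a 2 * c 1) * b 0 * d 0)) * h2
        + (a 0 * b 0 * c 2 * d 2 + a 2 * b 2 * c 0 * d 0
          - (a 0 * c 0 * b 2 * d 2 + a 2 * c 2 * b 0 * d 0)) * h3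
        + ((a 0 * b 1 + a 1 * b 0) * (c 1 * d 2 + c 2 * d 1) + (a 1 * b 2 + a 2 * b 1) * (c 0 * d 1 + c 1 * d 0)
          - ((a 0 * c 1 + a 1 * c 0) * (b 1 * d 2 + b 2 * d 1) + (a 1 * c 2 + a 2 * c 1) * (b 0 * d 1 + b 1 * d 0))) * h4
        + ((a 0 * b 1 + a 1 * b 0) * c 2 * d 2 + a 2 * b 2 * (c 0 * d 1 + c 1 * d 0)
          - ((a 0 * c 1 + a 1 * c 0) * b 2 * d 2 + a 2 * c 2 * (b 0 * d 1 + b 1 * d 0))) * h5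
        + (a 1 * b 1 * c 2 * d 2 + a 2 * b 2 * c 1 * d 1
          - (a 1 * c 1 * b 2 * d 2 + a 2 * c 2 * b 1 * d 1)) * h6) l ((LinearEquiv.ofInjectiveEndo (bil U l) hinj).trans L) (fun b => rfl)
    refine ⟨L.symm w, by simpa using hw, c, ![_, _, _], conv (L.symm w) c p (fun a b => ?_)⟩
    rw [← h, ← hin, hT, LinearEquiv.apply_symm_apply]

/-- No rank three element of the cone 𝒞 generates an extreme ray. -/
theorem rank_three_not_extreme (A : Matrix (Fin 6) (Fin 6) ℝ) (hA : memC A)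
    (hrank : A.rank = 3) :
    ∃ B C : Matrix (Fin 6) (Fin 6) ℝ, memC B ∧ memC C ∧ A = B + C ∧
      ¬∃ s : ℝ, 0 ≤ s ∧ B = s • A := by
  obtain ⟨U, rfl⟩ := exists_factor A hA.1 hrank
  have hUr : Uᵀ.rank = 3 := by
    rw [Matrix.rank_transpose, ← Matrix.rank_transpose_mul_self, hrank]
  have hU : ∀ w : Fin 3 → ℝ, w ᵥ* U = 0 → w = 0 := by
    have hli : LinearIndependent ℝ U.row := by
      rw [linearIndependent_iff_card_eq_finrank_span, Set.finrank, ← Matrix.rank_eq_finrank_span_row,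
        ← Matrix.rank_transpose, hUr]; rfl
    intro w hw
    have := Matrix.vecMul_injective_iff.mpr hli
    exact this (by simpa using hw)
  obtain ⟨w, hw, c, p, hwp⟩ := key U hU hA
  have hww : 0 < w ⬝ᵥ w := by
    have := dotProduct_star_self_pos_iff (v := w)
    simpa using this.mpr hw
  set x := w ᵥ* U with hx
  have hx0 : x ≠ 0 := fun h => hw (hU w h)
  have hBs : memC ((w ⬝ᵥ w)⁻¹ • vecMulVec x x) := by
    refine ⟨(posSemidef_vecMulVec_self_star x).smul (inv_nonneg.mpr hww.le), ?_⟩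
    rw [hwp]
    simp only [Matrix.smul_apply, vecMulVec_apply, Pi.smul_apply, v, smul_eq_mul]
    refine ⟨?_, ?_, ?_, ?_, ?_, ?_⟩ <;> congr 1 <;> simp <;> ring
  refine ⟨(w ⬝ᵥ w)⁻¹ • vecMulVec x x, Uᵀ * U - (w ⬝ᵥ w)⁻¹ • vecMulVec x x, hBs, ⟨?_, ?_⟩,
    by abel, ?_⟩
  · refine PosSemidef.of_dotProduct_mulVec_nonneg (hA.1.1.sub hBs.1.1) fun y => ?_
    have e1 : star y ⬝ᵥ (Uᵀ * U - (w ⬝ᵥ w)⁻¹ • vecMulVec x x) *ᵥ y =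
        (U *ᵥ y) ⬝ᵥ (U *ᵥ y) - (w ⬝ᵥ w)⁻¹ * (w ⬝ᵥ U *ᵥ y) ^ 2 := by
      rw [sub_mulVec, dotProduct_sub, smul_mulVec, dotProduct_smul, ← mulVec_mulVec,
        star_trivial, dotProduct_mulVec y, vecMul_transpose, vecMulVec_mulVec]
      simp only [hx, dotProduct_smul, MulOpposite.smul_eq_mul_unop, MulOpposite.unop_op, smul_eq_mul]
      rw [← dotProduct_mulVec, dotProduct_comm y, ← dotProduct_mulVec]
      ring
    rw [e1]
    generalize U *ᵥ y = z
    have cs : (w ⬝ᵥ z) ^ 2 ≤ (w ⬝ᵥ w) * (z ⬝ᵥ z) := by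
      simp only [dotProduct, Fin.sum_univ_three]
      nlinarith [sq_nonneg (w 0 * z 1 - w 1 * z 0), sq_nonneg (w 0 * z 2 - w 2 * z 0),
        sq_nonneg (w 1 * z 2 - w 2 * z 1)]
    have : (w ⬝ᵥ w)⁻¹ * (w ⬝ᵥ z) ^ 2 ≤ z ⬝ᵥ z := by
      rw [inv_mul_le_iff₀ hww]; exact cs
    linarith
  · obtain ⟨-, h1, h2, h3, h4, h5, h6⟩ := hA
    obtain ⟨-, g1, g2, g3, g4, g5, g6⟩ := hBs
    simp only [Matrix.sub_apply, h1, h2, h3, h4, h5, h6, g1, g2, g3, g4, g5, g6, and_self]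
  · rintro ⟨s, -, hs⟩
    have hr1 : (vecMulVec x x).rank ≤ 1 := rank_vecMulVec_le _ _
    have e : vecMulVec x x = ((w ⬝ᵥ w) * s) • (Uᵀ * U) := by
      rw [mul_smul, ← hs, smul_smul, mul_inv_cancel₀ hww.ne', one_smul]
    by_cases h0 : (w ⬝ᵥ w) * s = 0
    · rw [h0, zero_smul] at e
      apply hx0
      ext i
      have := congrFun (congrFun e i) i
      simpa [vecMulVec_apply] using this
    · have e2 : Uᵀ * U = ((w ⬝ᵥ w) * s)⁻¹ • vecMulVec x x := by
        rw [e, smul_smul, inv_mul_cancel₀ h0, one_smul]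
      have e3 : (Uᵀ * U).rank ≤ 1 := by
        rw [e2, ← smul_vecMulVec]
        exact rank_vecMulVec_le _ _
      omega
end

section
/- If p is a ternary quartic with p(x,y,z) ≥ 0 for all real x, y, z, and A is any 6×6 real symmetric matrix with p(x,y,z) = v(x,y,z)^⊤ A v(x,y,z) for all x, y, z, then tr(AC) ≥ 0 for every 6×6 real positive semidefinite matrix C = (c_{ij}) satisfying c_{14}=c_{22}, c_{15}=c_{23}, c_{16}=c_{33}, c_{25}=c_{34}, c_{26}=c_{35}, c_{46}=c_{55}. -/
open Matrix

/-- Quadratic form functions. -/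
def IsQuad (q : ℝ → ℝ → ℝ → ℝ) : Prop :=
  ∃ a b c d e f : ℝ, ∀ x y z, q x y z =
    a * x ^ 2 + b * (x * y) + c * (x * z) + d * y ^ 2 + e * (y * z) + f * z ^ 2

/-- `p` dominates the square of a nonzero quadratic form. -/
def Good (p : ℝ → ℝ → ℝ → ℝ) : Prop :=
  ∃ q, IsQuad q ∧ (∃ x y z, q x y z ≠ 0) ∧ ∀ x y z, q x y z ^ 2 ≤ p x y z

lemma Good.comp {p p' : ℝ → ℝ → ℝ → ℝ} (h : Good p) (a b c d e f g k l : ℝ)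
    (hp : ∀ x y z, p' x y z = p (a * x + b * y + c * z) (d * x + e * y + f * z)
      (g * x + k * y + l * z))
    (hs : ∀ x y z, ∃ x' y' z', a * x' + b * y' + c * z' = x ∧ d * x' + e * y' + f * z' = y ∧
      g * x' + k * y' + l * z' = z) : Good p' := by
  obtain ⟨q, ⟨q1, q2, q3, q4, q5, q6, hq⟩, ⟨x, y, z, h0⟩, hle⟩ := h
  refine ⟨fun x y z => q (a * x + b * y + c * z) (d * x + e * y + f * z)
      (g * x + k * y + l * z), ?_, ?_, ?_⟩
  · refine ⟨q1 * a ^ 2 + q2 * (a * d) + q3 * (a * g) + q4 * d ^ 2 + q5 * (d * g) + q6 * g ^ 2,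
      q1 * (2 * a * b) + q2 * (a * e + b * d) + q3 * (a * k + b * g) + q4 * (2 * d * e)
        + q5 * (d * k + e * g) + q6 * (2 * g * k),
      q1 * (2 * a * c) + q2 * (a * f + c * d) + q3 * (a * l + c * g) + q4 * (2 * d * f)
        + q5 * (d * l + f * g) + q6 * (2 * g * l),
      q1 * b ^ 2 + q2 * (b * e) + q3 * (b * k) + q4 * e ^ 2 + q5 * (e * k) + q6 * k ^ 2,
      q1 * (2 * b * c) + q2 * (b * f + c * e) + q3 * (b * l + c * k) + q4 * (2 * e * f)
        + q5 * (e * l + f * k) + q6 * (2 * k * l),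
      q1 * c ^ 2 + q2 * (c * f) + q3 * (c * l) + q4 * f ^ 2 + q5 * (f * l) + q6 * l ^ 2, ?_⟩
    intro x y z
    simp only [hq]
    ring
  · obtain ⟨x', y', z', h1, h2, h3⟩ := hs x y z
    exact ⟨x', y', z', by simpa only [h1, h2, h3] using h0⟩
  · intro x y z
    rw [hp]
    exact hle _ _ _

lemma pos_cmp {E : Type*} [NormedAddCommGroup E] [NormedSpace ℝ E] [ProperSpace E]
    (F G : E → ℝ) (n : ℕ) (hF : Continuous F) (hG : Continuous G)
    (hFh : ∀ (t : ℝ) u, F (t • u) = t ^ n * F u) (hGh : ∀ (t : ℝ) u, G (t • u) = t ^ n * G u)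
    (hn : n ≠ 0) (hpos : ∀ u, u ≠ 0 → 0 < F u) : ∃ ε > 0, ∀ u, ε * G u ≤ F u := by
  have hK : IsCompact (Metric.sphere (0 : E) 1) := isCompact_sphere _ _
  obtain ⟨m, hm, hm'⟩ := hK.exists_forall_le' hF.continuousOn (a := 0) (fun u hu => hpos u (by
    rintro rfl; simp at hu))
  obtain ⟨M, hM⟩ := hK.exists_bound_of_continuousOn hG.continuousOn
  have hM1 : 0 < |M| + 1 := by positivity
  refine ⟨m / (|M| + 1), by positivity, fun u => ?_⟩
  by_cases hu : u = 0
  · have h1 := hFh 0 0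
    have h2 := hGh 0 0
    simp [hn] at h1 h2
    simp [hu, h1, h2]
  have hu' : 0 < ‖u‖ := norm_pos_iff.2 hu
  have hw : ‖u‖⁻¹ • u ∈ Metric.sphere (0 : E) 1 := by
    simp [norm_smul, hu'.ne']
  have e : u = ‖u‖ • (‖u‖⁻¹ • u) := by rw [smul_smul, mul_inv_cancel₀ hu'.ne', one_smul]
  rw [e, hFh, hGh]
  have a1 := hm' _ hw
  have a2 : G (‖u‖⁻¹ • u) ≤ |M| + 1 := by
    have := hM _ hw
    have := le_abs_self (G (‖u‖⁻¹ • u))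
    have := le_abs_self M
    simp only [Real.norm_eq_abs] at *
    linarith
  have a3 : m / (|M| + 1) * G (‖u‖⁻¹ • u) ≤ F (‖u‖⁻¹ • u) := by
    calc m / (|M| + 1) * G (‖u‖⁻¹ • u) ≤ m / (|M| + 1) * (|M| + 1) := by gcongr
      _ = m := by field_simp
      _ ≤ _ := a1
  calc _ = ‖u‖ ^ n * (m / (|M| + 1) * G (‖u‖⁻¹ • u)) := by ring
    _ ≤ _ := by gcongr

lemma pos_cmp2 (F G : ℝ → ℝ → ℝ) (n : ℕ) (hF : Continuous fun u : ℝ × ℝ => F u.1 u.2)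
    (hG : Continuous fun u : ℝ × ℝ => G u.1 u.2)
    (hFh : ∀ t y z, F (t * y) (t * z) = t ^ n * F y z)
    (hGh : ∀ t y z, G (t * y) (t * z) = t ^ n * G y z)
    (hn : n ≠ 0) (hpos : ∀ y z, F y z = 0 → y = 0 ∧ z = 0) (h0 : ∀ y z, 0 ≤ F y z) :
    ∃ ε > 0, ∀ y z, ε * G y z ≤ F y z := by
  obtain ⟨ε, h1, h2⟩ := pos_cmp (fun u : ℝ × ℝ => F u.1 u.2) (fun u : ℝ × ℝ => G u.1 u.2) n hF hG
    (fun t u => hFh t _ _) (fun t u => hGh t _ _) hn (fun u hu => lt_of_le_of_ne (h0 _ _)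
      (fun h => hu (Prod.ext (hpos _ _ h.symm).1 (hpos _ _ h.symm).2)))
  exact ⟨ε, h1, fun y z => h2 (y, z)⟩

lemma pos_cmp3 (F G : ℝ → ℝ → ℝ → ℝ) (n : ℕ)
    (hF : Continuous fun u : ℝ × ℝ × ℝ => F u.1 u.2.1 u.2.2)
    (hG : Continuous fun u : ℝ × ℝ × ℝ => G u.1 u.2.1 u.2.2)
    (hFh : ∀ t x y z, F (t * x) (t * y) (t * z) = t ^ n * F x y z)
    (hGh : ∀ t x y z, G (t * x) (t * y) (t * z) = t ^ n * G x y z)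
    (hn : n ≠ 0) (hpos : ∀ x y z, F x y z = 0 → x = 0 ∧ y = 0 ∧ z = 0)
    (h0 : ∀ x y z, 0 ≤ F x y z) :
    ∃ ε > 0, ∀ x y z, ε * G x y z ≤ F x y z := by
  obtain ⟨ε, h1, h2⟩ := pos_cmp (fun u : ℝ × ℝ × ℝ => F u.1 u.2.1 u.2.2)
    (fun u : ℝ × ℝ × ℝ => G u.1 u.2.1 u.2.2) n hF hG
    (fun t u => hFh t _ _ _) (fun t u => hGh t _ _ _) hn (fun u hu => lt_of_le_of_ne (h0 _ _ _)
      (fun h => hu (Prod.ext (hpos _ _ _ h.symm).1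
        (Prod.ext (hpos _ _ _ h.symm).2.1 (hpos _ _ _ h.symm).2.2))))
  exact ⟨ε, h1, fun x y z => h2 (x, y, z)⟩

lemma quad_nonneg {a b c : ℝ} (h : ∀ x : ℝ, 0 ≤ a * x ^ 2 + 2 * b * x + c) :
    0 ≤ a ∧ 0 ≤ c ∧ b ^ 2 ≤ a * c := by
  have hd := discrim_le_zero (a := a) (b := 2 * b) (c := c) (fun x => by
    have := h x; nlinarith)
  unfold discrim at hd
  have h0 := h 0
  have h1 := h 1
  have h2 := h (-1)
  have hc : 0 ≤ c := by linarith
  refine ⟨?_, hc, by linarith⟩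
  by_contra! ha
  have : a * c ≤ 0 := mul_nonpos_of_nonpos_of_nonneg ha.le hc
  have hb : b ^ 2 ≤ 0 := by linarith
  have hac : a * c = 0 := by nlinarith
  have hc0 : c = 0 := by
    rcases mul_eq_zero.1 hac with h | h
    · linarith
    · exact h
  linarith

lemma lin_zero {b c d e : ℝ} (h : ∀ s : ℝ, 0 ≤ b * s + c * s ^ 2 + d * s ^ 3 + e * s ^ 4) :
    b = 0 := by
  have hm : IsLocalMin (fun s : ℝ => b * s + c * s ^ 2 + d * s ^ 3 + e * s ^ 4) 0 := by
    apply Filter.Eventually.of_forall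
    intro s
    simpa using h s
  have hd : HasDerivAt (fun s : ℝ => b * s + c * s ^ 2 + d * s ^ 3 + e * s ^ 4) b 0 := by
    have := ((((hasDerivAt_id (0 : ℝ)).const_mul b).add
      ((hasDerivAt_pow 2 (0 : ℝ)).const_mul c)).add ((hasDerivAt_pow 3 (0 : ℝ)).const_mul d)).add
      ((hasDerivAt_pow 4 (0 : ℝ)).const_mul e)
    refine HasDerivAt.congr_deriv this ?_
    simp
  exact hm.hasDerivAt_eq_zero hd

/-- a binary quadratic form vanishing at a nonzero point factors. -/
lemma quad_factor {f g h b c : ℝ} (hbc : b ≠ 0 ∨ c ≠ 0)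
    (h0 : f * b ^ 2 + g * (b * c) + h * c ^ 2 = 0) :
    ∃ k l : ℝ, ∀ y z : ℝ, f * y ^ 2 + g * (y * z) + h * z ^ 2 = (c * y - b * z) * (k * y + l * z) := by
  by_cases hc : c = 0
  · subst hc
    have hb : b ≠ 0 := by simpa using hbc
    have hf : f = 0 := by
      have : f * b ^ 2 = 0 := by linarith
      simpa [hb] using this
    refine ⟨-g / b, -h / b, fun y z => ?_⟩
    subst hf
    field_simp
    ring
  · have hh : h = -(f * b ^ 2 + g * (b * c)) / c ^ 2 := by field_simp; linarith
    refine ⟨f / c, (g + f * b / c) / c, fun y z => ?_⟩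
    rw [hh]
    field_simp
    ring

/-- Two-zeros case. -/
lemma good_two (f1 f2 f3 g1 g2 g3 h1 h2 h3 : ℝ) (hf1 : 0 < f1) (hfd : 0 < f1 * f3 - f2 ^ 2)
    (P : ℝ → ℝ → ℝ → ℝ)
    (hP : ∀ x y z, P x y z = x ^ 2 * (f1 * y ^ 2 + 2 * f2 * (y * z) + f3 * z ^ 2)
      + 2 * x * y * (g1 * y ^ 2 + g2 * (y * z) + g3 * z ^ 2)
      + y ^ 2 * (h1 * y ^ 2 + h2 * (y * z) + h3 * z ^ 2))
    (hpos : ∀ x y z, 0 ≤ P x y z) : Good P := by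
  set F : ℝ → ℝ → ℝ := fun y z => f1 * y ^ 2 + 2 * f2 * (y * z) + f3 * z ^ 2 with hF
  set G : ℝ → ℝ → ℝ := fun y z => g1 * y ^ 2 + g2 * (y * z) + g3 * z ^ 2 with hG
  set H : ℝ → ℝ → ℝ := fun y z => h1 * y ^ 2 + h2 * (y * z) + h3 * z ^ 2 with hH
  have hP' : ∀ x y z, P x y z = x ^ 2 * F y z + 2 * x * y * G y z + y ^ 2 * H y z := hP
  have hFid : ∀ y z, f1 * F y z = (f1 * y + f2 * z) ^ 2 + (f1 * f3 - f2 ^ 2) * z ^ 2 := by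
    intro y z; simp only [hF]; ring
  have hF0 : ∀ y z, 0 ≤ F y z := fun y z => by
    have : 0 ≤ f1 * F y z := by rw [hFid]; positivity
    exact nonneg_of_mul_nonneg_right this hf1
  have hFz : ∀ y z, F y z = 0 → y = 0 ∧ z = 0 := fun y z h => by
    have h1 := hFid y z
    rw [h, mul_zero] at h1
    have hz : z = 0 := by
      have : (f1 * f3 - f2 ^ 2) * z ^ 2 ≤ 0 := by nlinarith [sq_nonneg (f1 * y + f2 * z)]
      have : z ^ 2 ≤ 0 := nonpos_of_mul_nonpos_right this hfd
      exact pow_eq_zero_iff (two_ne_zero) |>.1 (le_antisymm this (sq_nonneg _))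
    subst hz
    have : (f1 * y) ^ 2 = 0 := by nlinarith
    refine ⟨?_, rfl⟩
    simpa [hf1.ne'] using this
  obtain ⟨δ, hδ, hδ'⟩ := pos_cmp2 F (fun y z => y ^ 2) 2 (by fun_prop) (by fun_prop)
    (by intro t y z; simp only [hF]; ring) (by intro t y z; ring) two_ne_zero hFz hF0
  have hD1 : ∀ y z, y ≠ 0 → 0 ≤ F y z * H y z - G y z ^ 2 := by
    intro y z hy
    have := (quad_nonneg (a := F y z) (b := y * G y z) (c := y ^ 2 * H y z) (fun x => by
      have := hpos x y z
      rw [hP'] at this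
      linarith)).2.2
    have h3 : 0 ≤ y ^ 2 * (F y z * H y z - G y z ^ 2) := by linarith
    have : 0 < y ^ 2 := by positivity
    exact nonneg_of_mul_nonneg_right h3 this
  have hD : ∀ y z, 0 ≤ F y z * H y z - G y z ^ 2 := by
    intro y z
    have hcl : IsClosed {y : ℝ | 0 ≤ F y z * H y z - G y z ^ 2} :=
      isClosed_le continuous_const (by simp only [hF, hG, hH]; fun_prop)
    have : closure ({0}ᶜ : Set ℝ) ⊆ {y : ℝ | 0 ≤ F y z * H y z - G y z ^ 2} :=
      hcl.closure_subset_iff.2 (fun y hy => hD1 y z hy)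
    exact this ((dense_compl_singleton (0 : ℝ)) y)
  by_cases hz : ∀ y z, F y z * H y z - G y z ^ 2 = 0 → y = 0 ∧ z = 0
  · obtain ⟨ε, hε, hε'⟩ := pos_cmp2 (fun y z => F y z * H y z - G y z ^ 2) (fun y z => F y z ^ 2) 4
      (by simp only [hF, hG, hH]; fun_prop) (by simp only [hF, hG, hH]; fun_prop)
      (by intro t y z; simp only [hF, hG, hH]; ring) (by intro t y z; simp only [hF]; ring)
      (by norm_num) hz hD
    refine ⟨fun x y z => √(ε * δ) * y ^ 2, ⟨0, 0, 0, √(ε * δ), 0, 0, by intros; ring⟩,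
      ⟨0, 1, 0, by simp; positivity⟩, fun x y z => ?_⟩
    rw [mul_pow, Real.sq_sqrt (by positivity)]
    by_cases hyz : F y z = 0
    · obtain ⟨rfl, rfl⟩ := hFz _ _ hyz
      simpa using hpos x 0 0
    have hFp : 0 < F y z := lt_of_le_of_ne (hF0 _ _) (Ne.symm hyz)
    have e1 : F y z * P x y z = (x * F y z + y * G y z) ^ 2
        + y ^ 2 * (F y z * H y z - G y z ^ 2) := by rw [hP']; ring
    have e2 : y ^ 2 * (ε * F y z ^ 2) ≤ y ^ 2 * (F y z * H y z - G y z ^ 2) := by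
      gcongr; exact hε' y z
    have e3 : F y z * (ε * y ^ 2 * F y z) ≤ F y z * P x y z := by
      nlinarith [sq_nonneg (x * F y z + y * G y z)]
    have e4 := le_of_mul_le_mul_left e3 hFp
    have e5 : ε * y ^ 2 * (δ * y ^ 2) ≤ ε * y ^ 2 * F y z := by
      gcongr; exact hδ' y z
    linarith
  · push Not at hz
    obtain ⟨b, c, hbc0, hbc⟩ := hz
    have hne : b ≠ 0 ∨ c ≠ 0 := by
      by_contra! h; exact hbc h.1 h.2
    have hFp : 0 < F b c := lt_of_le_of_ne (hF0 _ _) (fun h => hbc (hFz _ _ h.symm).1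
      (hFz _ _ h.symm).2)
    -- shear
    set t : ℝ := - G b c / F b c with ht
    have hG' : G b c + t * F b c = 0 := by rw [ht]; field_simp; ring
    have hH' : H b c + 2 * t * G b c + t ^ 2 * F b c = 0 := by
      have : F b c * (H b c + 2 * t * G b c + t ^ 2 * F b c) = 0 := by
        have : G b c = - t * F b c := by linarith
        rw [this] at hbc0 ⊢
        linarith
      exact (mul_eq_zero.1 this).resolve_left hFp.ne'
    obtain ⟨k, l, hkl⟩ := quad_factor (f := g1 + t * f1) (g := g2 + 2 * t * f2) (h := g3 + t * f3)
      hne (by simp only [hG, hF] at hG'; linarith)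
    obtain ⟨m, n, hmn⟩ := quad_factor (f := h1 + 2 * t * g1 + t ^ 2 * f1)
      (g := h2 + 2 * t * g2 + 2 * t ^ 2 * f2) (h := h3 + 2 * t * g3 + t ^ 2 * f3)
      hne (by simp only [hG, hF, hH] at hH'; linarith)
    have hHn : ∀ y z, 0 ≤ (c * y - b * z) * (m * y + n * z) := by
      intro y z
      have := hD y z
      rw [← hmn]
      have e : F y z * ((h1 + 2 * t * g1 + t ^ 2 * f1) * y ^ 2
        + (h2 + 2 * t * g2 + 2 * t ^ 2 * f2) * (y * z) + (h3 + 2 * t * g3 + t ^ 2 * f3) * z ^ 2)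
        = (F y z * H y z - G y z ^ 2) + (G y z + t * F y z) ^ 2 := by
        simp only [hF, hG, hH]; ring
      by_cases hyz : F y z = 0
      · obtain ⟨rfl, rfl⟩ := hFz _ _ hyz
        simp
      have hFp : 0 < F y z := lt_of_le_of_ne (hF0 _ _) (Ne.symm hyz)
      refine nonneg_of_mul_nonneg_right ?_ hFp
      rw [e]; positivity
    -- the second factor vanishes at (b, c) too
    have hmbc : m * b + n * c = 0 := by
      have hN : 0 < b ^ 2 + c ^ 2 := by
        rcases hne with h | h <;> positivity
      have : (b ^ 2 + c ^ 2) * (m * b + n * c) = 0 := by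
        apply lin_zero (c := (m * c - n * b) * (b ^ 2 + c ^ 2)) (d := 0) (e := 0)
        intro s
        have := hHn (b + s * c) (c - s * b)
        linarith
      exact (mul_eq_zero.1 this).resolve_left hN.ne'
    have hN : 0 < b ^ 2 + c ^ 2 := by
      rcases hne with h | h <;> positivity
    obtain ⟨r, hr⟩ : ∃ r : ℝ, ∀ y z, m * y + n * z = r * (c * y - b * z) := by
      refine ⟨(m * c - n * b) / (b ^ 2 + c ^ 2), fun y z => ?_⟩
      field_simp
      linear_combination (b * y + c * z) * hmbc
    have hr0 : 0 ≤ r := by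
      have := hHn c (-b)
      rw [hr] at this
      have h2 : 0 ≤ (b ^ 2 + c ^ 2) ^ 2 * r := by linarith
      exact nonneg_of_mul_nonneg_right h2 (by positivity)
    have key1 : ∀ y z, c * y - b * z ≠ 0 → 0 ≤ r * F y z - (k * y + l * z) ^ 2 := by
      intro y z hl
      have e : (c * y - b * z) ^ 2 * (r * F y z - (k * y + l * z) ^ 2)
          = F y z * H y z - G y z ^ 2 := by
        have e1 := hkl y z
        have e2 := hmn y z
        rw [hr] at e2
        have e3 : (c * y - b * z) * (k * y + l * z) = G y z + t * F y z := by
          rw [← e1]; simp only [hF, hG]; ring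
        have e4 : (c * y - b * z) * (r * (c * y - b * z))
            = H y z + 2 * t * G y z + t ^ 2 * F y z := by
          rw [← e2]; simp only [hF, hG, hH]; ring
        linear_combination F y z * e4 - ((c * y - b * z) * (k * y + l * z) + G y z + t * F y z) * e3
      refine nonneg_of_mul_nonneg_right (a := (c * y - b * z) ^ 2) ?_ (by positivity)
      rw [e]; exact hD y z
    have key : ∀ y z, 0 ≤ r * F y z - (k * y + l * z) ^ 2 := by
      intro y z
      by_cases hl : c * y - b * z = 0
      · have hcl : IsClosed {s : ℝ | 0 ≤ r * F (y + s * c) (z - s * b)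
            - (k * (y + s * c) + l * (z - s * b)) ^ 2} :=
          isClosed_le continuous_const (by simp only [hF]; fun_prop)
        have := (hcl.closure_subset_iff (s := ({0}ᶜ : Set ℝ))).2 (fun s hs => by
          apply key1
          have : c * (y + s * c) - b * (z - s * b) = s * (b ^ 2 + c ^ 2) := by linarith
          rw [this]
          exact mul_ne_zero hs hN.ne')
        simpa using this ((dense_compl_singleton (0 : ℝ)) 0)
      · exact key1 y z hl
    have hPe : ∀ x y z, P x y z = (x - t * y) ^ 2 * F y z
        + 2 * (x - t * y) * y * ((c * y - b * z) * (k * y + l * z))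
        + y ^ 2 * (r * (c * y - b * z) ^ 2) := by
      intro x y z
      have e2 := hmn y z
      rw [hr] at e2
      have e4 : r * (c * y - b * z) ^ 2 = (c * y - b * z) * (r * (c * y - b * z)) := by ring
      rw [hP', ← hkl, e4, ← e2]
      simp only [hF, hG, hH]; ring
    rcases hr0.eq_or_lt with hr0 | hr0
    · have hkz : ∀ y z, k * y + l * z = 0 := by
        intro y z
        have := key y z
        rw [← hr0] at this
        have : (k * y + l * z) ^ 2 = 0 := by nlinarith [sq_nonneg (k * y + l * z)]
        simpa using this
      refine ⟨fun x y z => √δ * ((x - t * y) * y),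
        ⟨0, √δ, 0, -√δ * t, 0, 0, by intros; ring⟩, ⟨1 + t, 1, 0, ?_⟩, fun x y z => ?_⟩
      · simp; positivity
      · rw [mul_pow, Real.sq_sqrt hδ.le, hPe, hkz, ← hr0]
        have := mul_le_mul_of_nonneg_left (hδ' y z) (sq_nonneg (x - t * y))
        nlinarith
    · refine ⟨fun x y z => (√r)⁻¹ * (r * (y * (c * y - b * z)) + (x - t * y) * (k * y + l * z)),
        ⟨0, (√r)⁻¹ * k, (√r)⁻¹ * l, (√r)⁻¹ * (r * c - t * k), (√r)⁻¹ * (-r * b - t * l), 0,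
          by intros; ring⟩, ?_, fun x y z => ?_⟩
      · have hs : (√r)⁻¹ ≠ 0 := by positivity
        by_cases hc : c = 0
        · have hb : b ≠ 0 := by simpa [hc] using hne
          refine ⟨t, 1, 1, mul_ne_zero hs ?_⟩
          simp [hc, hb, hr0.ne']
        · refine ⟨t, 1, 0, mul_ne_zero hs ?_⟩
          simp [hc, hr0.ne']
      · rw [mul_pow, inv_pow, Real.sq_sqrt hr0.le, inv_mul_le_iff₀ hr0, hPe]
        have := mul_nonneg (sq_nonneg (x - t * y)) (key y z)
        linarith

/-- Rank-one case. -/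
lemma good_one (a g0 g1 g2 g3 h0 h1 h2 h3 h4 : ℝ) (ha : 0 < a) (P : ℝ → ℝ → ℝ → ℝ)
    (hP : ∀ x y z, P x y z = x ^ 2 * (a * y ^ 2)
      + 2 * x * (g0 * y ^ 3 + g1 * (y ^ 2 * z) + g2 * (y * z ^ 2) + g3 * z ^ 3)
      + (h0 * y ^ 4 + h1 * (y ^ 3 * z) + h2 * (y ^ 2 * z ^ 2) + h3 * (y * z ^ 3) + h4 * z ^ 4))
    (hpos : ∀ x y z, 0 ≤ P x y z) : Good P := by
  have hd : ∀ y z, (g0 * y ^ 3 + g1 * (y ^ 2 * z) + g2 * (y * z ^ 2) + g3 * z ^ 3) ^ 2 ≤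
      a * y ^ 2 * (h0 * y ^ 4 + h1 * (y ^ 3 * z) + h2 * (y ^ 2 * z ^ 2) + h3 * (y * z ^ 3)
        + h4 * z ^ 4) := fun y z => (quad_nonneg (fun x => by
      have := hpos x y z
      rw [hP] at this
      linarith)).2.2
  have hg3 : g3 = 0 := by
    have := hd 0 1
    have : g3 ^ 2 = 0 := by nlinarith
    simpa using this
  subst hg3
  set G : ℝ → ℝ → ℝ := fun y z => g0 * y ^ 2 + g1 * (y * z) + g2 * z ^ 2 with hG
  set H : ℝ → ℝ → ℝ := fun y z => h0 * y ^ 4 + h1 * (y ^ 3 * z) + h2 * (y ^ 2 * z ^ 2)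
    + h3 * (y * z ^ 3) + h4 * z ^ 4 with hH
  have hD1 : ∀ y z, y ≠ 0 → 0 ≤ a * H y z - G y z ^ 2 := by
    intro y z hy
    refine nonneg_of_mul_nonneg_right (a := y ^ 2) ?_ (by positivity)
    have := hd y z
    simp only [hG, hH]
    linarith
  have hD : ∀ y z, 0 ≤ a * H y z - G y z ^ 2 := by
    intro y z
    have hcl : IsClosed {y : ℝ | 0 ≤ a * H y z - G y z ^ 2} :=
      isClosed_le continuous_const (by simp only [hG, hH]; fun_prop)
    have : closure ({0}ᶜ : Set ℝ) ⊆ {y : ℝ | 0 ≤ a * H y z - G y z ^ 2} :=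
      hcl.closure_subset_iff.2 (fun y hy => hD1 y z hy)
    exact this ((dense_compl_singleton (0 : ℝ)) y)
  refine ⟨fun x y z => (√a)⁻¹ * (a * (x * y) + G y z),
    ⟨0, (√a)⁻¹ * a, 0, (√a)⁻¹ * g0, (√a)⁻¹ * g1, (√a)⁻¹ * g2, by
      intros; simp only [hG]; ring⟩, ⟨(1 - g0) / a, 1, 0, ?_⟩, fun x y z => ?_⟩
  · have : a * ((1 - g0) / a * 1) + G 1 0 = 1 := by simp only [hG]; field_simp; ring
    beta_reduce
    rw [this]
    positivity
  · rw [mul_pow, inv_pow, Real.sq_sqrt ha.le, inv_mul_le_iff₀ ha, hP]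
    have := hD y z
    simp only [hG, hH] at this ⊢
    linarith

/-- Rank-two case with a second zero, normalised. -/
lemma good_rank2_zero (f1 f2 f3 g0 g1 g2 g3 h0 h1 h2 h3 h4 b : ℝ)
    (hf1 : 0 < f1) (hfd : 0 < f1 * f3 - f2 ^ 2) (P : ℝ → ℝ → ℝ → ℝ)
    (hP : ∀ x y z, P x y z = x ^ 2 * (f1 * y ^ 2 + 2 * f2 * (y * z) + f3 * z ^ 2)
      + 2 * x * (g0 * y ^ 3 + g1 * (y ^ 2 * z) + g2 * (y * z ^ 2) + g3 * z ^ 3)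
      + (h0 * y ^ 4 + h1 * (y ^ 3 * z) + h2 * (y ^ 2 * z ^ 2) + h3 * (y * z ^ 3) + h4 * z ^ 4))
    (hpos : ∀ x y z, 0 ≤ P x y z) (t : ℝ) (hz : P t b 1 = 0) : Good P := by
  obtain ⟨F2, hF2⟩ : ∃ F2, F2 = f2 + b * f1 := ⟨_, rfl⟩
  obtain ⟨F3, hF3⟩ : ∃ F3, F3 = f3 + 2 * b * f2 + b ^ 2 * f1 := ⟨_, rfl⟩
  obtain ⟨k1, hk1⟩ : ∃ k, k = g1 + 3 * b * g0 := ⟨_, rfl⟩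
  obtain ⟨k2, hk2⟩ : ∃ k, k = g2 + 2 * b * g1 + 3 * b ^ 2 * g0 := ⟨_, rfl⟩
  obtain ⟨k3, hk3⟩ : ∃ k, k = g3 + b * g2 + b ^ 2 * g1 + b ^ 3 * g0 := ⟨_, rfl⟩
  obtain ⟨G1, hG1⟩ : ∃ k, k = k1 + t * f1 := ⟨_, rfl⟩
  obtain ⟨G2, hG2⟩ : ∃ k, k = k2 + 2 * t * F2 := ⟨_, rfl⟩
  obtain ⟨G3, hG3⟩ : ∃ k, k = k3 + t * F3 := ⟨_, rfl⟩
  obtain ⟨H1, hH1⟩ : ∃ k, k = h1 + 4 * b * h0 + 2 * t * g0 := ⟨_, rfl⟩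
  obtain ⟨H2, hH2⟩ : ∃ k, k = h2 + 3 * b * h1 + 6 * b ^ 2 * h0 + 2 * t * k1 + t ^ 2 * f1 := ⟨_, rfl⟩
  obtain ⟨H3, hH3⟩ : ∃ k, k = h3 + 2 * b * h2 + 3 * b ^ 2 * h1 + 4 * b ^ 3 * h0 + 2 * t * k2
    + 2 * t ^ 2 * F2 := ⟨_, rfl⟩
  obtain ⟨H4, hH4⟩ : ∃ k, k = P t b 1 := ⟨_, rfl⟩
  have hQ : ∀ x y z, P (x + t * z) (y + b * z) z
      = x ^ 2 * (f1 * y ^ 2 + 2 * F2 * (y * z) + F3 * z ^ 2)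
      + 2 * x * (g0 * y ^ 3 + G1 * (y ^ 2 * z) + G2 * (y * z ^ 2) + G3 * z ^ 3)
      + (h0 * y ^ 4 + H1 * (y ^ 3 * z) + H2 * (y ^ 2 * z ^ 2) + H3 * (y * z ^ 3) + H4 * z ^ 4) := by
    intro x y z
    subst hF2 hF3 hG1 hG2 hG3 hH1 hH2 hH3 hH4 hk1 hk2 hk3
    simp only [hP]
    ring
  have hQp : ∀ x y z, 0 ≤ x ^ 2 * (f1 * y ^ 2 + 2 * F2 * (y * z) + F3 * z ^ 2)
      + 2 * x * (g0 * y ^ 3 + G1 * (y ^ 2 * z) + G2 * (y * z ^ 2) + G3 * z ^ 3)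
      + (h0 * y ^ 4 + H1 * (y ^ 3 * z) + H2 * (y ^ 2 * z ^ 2) + H3 * (y * z ^ 3)
      + H4 * z ^ 4) := fun x y z => by rw [← hQ]; exact hpos _ _ _
  have hH40 : H4 = 0 := hH4.trans hz
  have hG30 : 2 * G3 = 0 := by
    apply lin_zero (c := F3) (d := 0) (e := 0)
    intro s
    have := hQp s 0 1
    linarith
  have hH30 : H3 = 0 := by
    apply lin_zero (c := H2) (d := H1) (e := h0)
    intro s
    have := hQp 0 s 1
    linarith
  have hgood : Good (fun x y z => P (x + t * z) (y + b * z) z) := by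
    apply good_two f1 F2 F3 g0 G1 G2 h0 H1 H2 hf1 (by subst hF2 hF3; linarith) _ _
      (fun x y z => hpos _ _ _)
    intro x y z
    have hG3' : G3 = 0 := by linarith
    simp only [hQ, hG3', hH30, hH40]
    ring
  refine hgood.comp 1 0 (-t) 0 1 (-b) 0 0 1 (fun x y z => ?_) (fun x y z => ?_)
  · congr 1 <;> ring
  · exact ⟨x + t * z, y + b * z, z, by ring, by ring, by ring⟩

/-- Rank-two case. -/
lemma good_rank2 (f1 f2 f3 g0 g1 g2 g3 h0 h1 h2 h3 h4 : ℝ)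
    (hf1 : 0 < f1) (hfd : 0 < f1 * f3 - f2 ^ 2) (P : ℝ → ℝ → ℝ → ℝ)
    (hP : ∀ x y z, P x y z = x ^ 2 * (f1 * y ^ 2 + 2 * f2 * (y * z) + f3 * z ^ 2)
      + 2 * x * (g0 * y ^ 3 + g1 * (y ^ 2 * z) + g2 * (y * z ^ 2) + g3 * z ^ 3)
      + (h0 * y ^ 4 + h1 * (y ^ 3 * z) + h2 * (y ^ 2 * z ^ 2) + h3 * (y * z ^ 3) + h4 * z ^ 4))
    (hpos : ∀ x y z, 0 ≤ P x y z) : Good P := by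
  by_cases hz1 : ∃ t b, P t b 1 = 0
  · obtain ⟨t, b, h⟩ := hz1
    exact good_rank2_zero f1 f2 f3 g0 g1 g2 g3 h0 h1 h2 h3 h4 b hf1 hfd P hP hpos t h
  by_cases hz2 : ∃ t b, P t 1 b = 0
  · obtain ⟨t, b, h⟩ := hz2
    have hf3 : 0 < f3 := by
      have : 0 < f1 * f3 := by nlinarith [sq_nonneg f2]
      exact pos_of_mul_pos_right this hf1.le
    have := good_rank2_zero f3 f2 f1 g3 g2 g1 g0 h4 h3 h2 h1 h0 b hf3 (by linarith)
      (fun x y z => P x z y) (fun x y z => by simp only [hP]; ring) (fun x y z => hpos _ _ _) t h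
    refine this.comp 1 0 0 0 0 1 0 1 0 (fun x y z => ?_) (fun x y z => ?_)
    · congr 1 <;> ring
    · exact ⟨x, z, y, by ring, by ring, by ring⟩
  push Not at hz1 hz2
  set F : ℝ → ℝ → ℝ := fun y z => f1 * y ^ 2 + 2 * f2 * (y * z) + f3 * z ^ 2 with hF
  set G : ℝ → ℝ → ℝ := fun y z => g0 * y ^ 3 + g1 * (y ^ 2 * z) + g2 * (y * z ^ 2) + g3 * z ^ 3
    with hG
  set H : ℝ → ℝ → ℝ := fun y z => h0 * y ^ 4 + h1 * (y ^ 3 * z) + h2 * (y ^ 2 * z ^ 2)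
    + h3 * (y * z ^ 3) + h4 * z ^ 4 with hH
  have hP' : ∀ x y z, P x y z = x ^ 2 * F y z + 2 * x * G y z + H y z := hP
  have hFid : ∀ y z, f1 * F y z = (f1 * y + f2 * z) ^ 2 + (f1 * f3 - f2 ^ 2) * z ^ 2 := by
    intro y z; simp only [hF]; ring
  have hF0 : ∀ y z, 0 ≤ F y z := fun y z => by
    have : 0 ≤ f1 * F y z := by rw [hFid]; positivity
    exact nonneg_of_mul_nonneg_right this hf1
  have hFz : ∀ y z, F y z = 0 → y = 0 ∧ z = 0 := fun y z h => by
    have h1 := hFid y z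
    rw [h, mul_zero] at h1
    have hz : z = 0 := by
      have : (f1 * f3 - f2 ^ 2) * z ^ 2 ≤ 0 := by nlinarith [sq_nonneg (f1 * y + f2 * z)]
      have : z ^ 2 ≤ 0 := nonpos_of_mul_nonpos_right this hfd
      exact pow_eq_zero_iff (two_ne_zero) |>.1 (le_antisymm this (sq_nonneg _))
    subst hz
    have : (f1 * y) ^ 2 = 0 := by nlinarith
    refine ⟨?_, rfl⟩
    simpa [hf1.ne'] using this
  have hD : ∀ y z, 0 ≤ F y z * H y z - G y z ^ 2 := by
    intro y z
    have := (quad_nonneg (a := F y z) (b := G y z) (c := H y z) (fun x => by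
      have := hpos x y z
      rw [hP'] at this
      linarith)).2.2
    linarith
  have hDz : ∀ y z, F y z * H y z - G y z ^ 2 = 0 → y = 0 ∧ z = 0 := by
    intro y z h
    by_contra hne
    have hFp : F y z ≠ 0 := fun h => hne (hFz _ _ h)
    have hPz : P (- G y z / F y z) y z = 0 := by
      rw [hP']
      have : H y z = G y z ^ 2 / F y z := by field_simp; linarith
      rw [this]; field_simp; ring
    have hhom : ∀ s x y z, P (s * x) (s * y) (s * z) = s ^ 4 * P x y z := by
      intro s x y z; simp only [hP]; ring
    by_cases hz : z = 0
    · have hy : y ≠ 0 := fun hy => hne ⟨hy, hz⟩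
      apply hz2 (y⁻¹ * (- G y z / F y z)) (y⁻¹ * z)
      have := hhom y⁻¹ (- G y z / F y z) y z
      rwa [inv_mul_cancel₀ hy, hPz, mul_zero] at this
    · apply hz1 (z⁻¹ * (- G y z / F y z)) (z⁻¹ * y)
      have := hhom z⁻¹ (- G y z / F y z) y z
      rwa [inv_mul_cancel₀ hz, hPz, mul_zero] at this
  obtain ⟨ε, hε, hε'⟩ := pos_cmp2 (fun y z => F y z * H y z - G y z ^ 2) (fun y z => F y z ^ 3) 6
      (by simp only [hF, hG, hH]; fun_prop) (by simp only [hF]; fun_prop)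
      (by intro t y z; simp only [hF, hG, hH]; ring) (by intro t y z; simp only [hF]; ring)
      (by norm_num) hDz hD
  refine ⟨fun x y z => √ε * F y z, ⟨0, 0, 0, √ε * f1, √ε * (2 * f2), √ε * f3, by
      intros; simp only [hF]; ring⟩,
      ⟨0, 1, 0, by simp only [hF]; ring_nf; positivity⟩, fun x y z => ?_⟩
  rw [mul_pow, Real.sq_sqrt (by positivity)]
  by_cases hyz : F y z = 0
  · rw [hyz]; simpa using hpos x y z
  have hFp : 0 < F y z := lt_of_le_of_ne (hF0 _ _) (Ne.symm hyz)
  have e1 : F y z * P x y z = (x * F y z + G y z) ^ 2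
        + (F y z * H y z - G y z ^ 2) := by rw [hP']; ring
  have e3 : F y z * (ε * F y z ^ 2) ≤ F y z * P x y z := by
    nlinarith [sq_nonneg (x * F y z + G y z), hε' y z]
  exact le_of_mul_le_mul_left e3 hFp

/-- Ternary quartic functions. -/
def IsQuartic (P : ℝ → ℝ → ℝ → ℝ) : Prop :=
  ∃ a b1 b2 f1 f2 f3 g0 g1 g2 g3 h0 h1 h2 h3 h4 : ℝ, ∀ x y z, P x y z = a * x ^ 4
    + x ^ 3 * (b1 * y + b2 * z)
    + x ^ 2 * (f1 * y ^ 2 + 2 * f2 * (y * z) + f3 * z ^ 2)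
    + 2 * x * (g0 * y ^ 3 + g1 * (y ^ 2 * z) + g2 * (y * z ^ 2) + g3 * z ^ 3)
    + (h0 * y ^ 4 + h1 * (y ^ 3 * z) + h2 * (y ^ 2 * z ^ 2) + h3 * (y * z ^ 3) + h4 * z ^ 4)

lemma IsQuartic.swapYZ {P : ℝ → ℝ → ℝ → ℝ} (h : IsQuartic P) :
    IsQuartic (fun x y z => P x z y) := by
  obtain ⟨a, b1, b2, f1, f2, f3, g0, g1, g2, g3, h0, h1, h2, h3, h4, hP⟩ := h
  refine ⟨a, b2, b1, f3, f2, f1, g3, g2, g1, g0, h4, h3, h2, h1, h0, fun x y z => ?_⟩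
  simp only [hP]; ring

lemma IsQuartic.swapXY {P : ℝ → ℝ → ℝ → ℝ} (h : IsQuartic P) :
    IsQuartic (fun x y z => P y x z) := by
  obtain ⟨a, b1, b2, f1, f2, f3, g0, g1, g2, g3, h0, h1, h2, h3, h4, hP⟩ := h
  refine ⟨h0, 2 * g0, h1, f1, g1, h2, b1 / 2, f2, g2, h3 / 2, a, b2, f3, 2 * g3, h4,
    fun x y z => ?_⟩
  simp only [hP]; ring

lemma IsQuartic.shear {P : ℝ → ℝ → ℝ → ℝ} (h : IsQuartic P) (b : ℝ) :
    IsQuartic (fun x y z => P x (y + b * x) z) := by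
  obtain ⟨a, b1, b2, f1, f2, f3, g0, g1, g2, g3, h0, h1, h2, h3, h4, hP⟩ := h
  refine ⟨a + b1 * b + f1 * b ^ 2 + 2 * g0 * b ^ 3 + h0 * b ^ 4,
    b1 + 2 * f1 * b + 6 * g0 * b ^ 2 + 4 * h0 * b ^ 3,
    b2 + 2 * f2 * b + 2 * g1 * b ^ 2 + h1 * b ^ 3,
    f1 + 6 * g0 * b + 6 * h0 * b ^ 2, f2 + 2 * g1 * b + 3 / 2 * h1 * b ^ 2,
    f3 + 2 * g2 * b + h2 * b ^ 2, g0 + 2 * h0 * b, g1 + 3 / 2 * h1 * b, g2 + h2 * b,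
    g3 + h3 * b / 2, h0, h1, h2, h3, h4, fun x y z => ?_⟩
  simp only [hP]; ring

/-- Binary quartics with a zero at `(b, 1)`. -/
lemma good_binary_zero (h0 h1 h2 h3 h4 : ℝ) (P : ℝ → ℝ → ℝ → ℝ)
    (hP : ∀ x y z, P x y z = h0 * y ^ 4 + h1 * (y ^ 3 * z) + h2 * (y ^ 2 * z ^ 2)
      + h3 * (y * z ^ 3) + h4 * z ^ 4)
    (hpos : ∀ x y z, 0 ≤ P x y z) (hne : ∃ x y z, P x y z ≠ 0) (b : ℝ) (hz : P 0 b 1 = 0) :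
    Good P := by
  obtain ⟨H1, hH1⟩ : ∃ k, k = h1 + 4 * b * h0 := ⟨_, rfl⟩
  obtain ⟨H2, hH2⟩ : ∃ k, k = h2 + 3 * b * h1 + 6 * b ^ 2 * h0 := ⟨_, rfl⟩
  obtain ⟨H3, hH3⟩ : ∃ k, k = h3 + 2 * b * h2 + 3 * b ^ 2 * h1 + 4 * b ^ 3 * h0 := ⟨_, rfl⟩
  have hQ : ∀ x y z, P z (y + b * x) x
      = h0 * y ^ 4 + H1 * (y ^ 3 * x) + H2 * (y ^ 2 * x ^ 2) + H3 * (y * x ^ 3) := by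
    intro x y z
    have : P z (y + b * x) x = h0 * y ^ 4 + H1 * (y ^ 3 * x) + H2 * (y ^ 2 * x ^ 2)
        + H3 * (y * x ^ 3) + P 0 b 1 * x ^ 4 := by
      subst hH1 hH2 hH3
      simp only [hP]; ring
    rw [this, hz]; ring
  have hQp : ∀ x y, 0 ≤ h0 * y ^ 4 + H1 * (y ^ 3 * x) + H2 * (y ^ 2 * x ^ 2)
      + H3 * (y * x ^ 3) := fun x y => by rw [← hQ x y 0]; exact hpos _ _ _
  have hH30 : H3 = 0 := by
    apply lin_zero (c := H2) (d := H1) (e := h0)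
    intro s
    have := hQp 1 s
    linarith
  have hgood : Good (fun x y z => P z (y + b * x) x) := by
    obtain ⟨q1, q2, q3⟩ := quad_nonneg (a := H2) (b := H1 / 2) (c := h0) (fun x => by
      have := hQp x 1
      rw [hH30] at this
      linarith)
    rcases q1.eq_or_lt with q1 | q1
    · rw [← q1] at q3
      have hH10 : H1 = 0 := by
        have : H1 ^ 2 = 0 := by nlinarith [sq_nonneg H1]
        simpa using this
      have hh0 : 0 < h0 := by
        refine lt_of_le_of_ne q2 (fun h => ?_)
        obtain ⟨x, y, z, hxyz⟩ := hne
        apply hxyz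
        have := hQ z (y - b * z) x
        rw [sub_add_cancel] at this
        rw [this, ← h, hH10, hH30, ← q1]
        ring
      refine ⟨fun x y z => √h0 * y ^ 2, ⟨0, 0, 0, √h0, 0, 0, by intros; ring⟩,
        ⟨0, 1, 0, by simp; positivity⟩, fun x y z => ?_⟩
      beta_reduce
      rw [mul_pow, Real.sq_sqrt hh0.le, hQ, hH10, hH30, ← q1]
      apply le_of_eq; ring
    · apply good_one H2 (H1 / 2) 0 0 0 h0 0 0 0 0 q1 _ _ (fun x y z => hpos _ _ _)
      intro x y z
      simp only [hQ, hH30]; ring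
  refine hgood.comp 0 0 1 0 1 (-b) 1 0 0 (fun x y z => ?_) (fun x y z => ?_)
  · congr 1 <;> ring
  · exact ⟨z, y + b * x, x, by ring, by ring, by ring⟩

lemma good_binary (h0 h1 h2 h3 h4 : ℝ) (P : ℝ → ℝ → ℝ → ℝ)
    (hP : ∀ x y z, P x y z = h0 * y ^ 4 + h1 * (y ^ 3 * z) + h2 * (y ^ 2 * z ^ 2)
      + h3 * (y * z ^ 3) + h4 * z ^ 4)
    (hpos : ∀ x y z, 0 ≤ P x y z) (hne : ∃ x y z, P x y z ≠ 0) : Good P := by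
  by_cases hz1 : ∃ b, P 0 b 1 = 0
  · obtain ⟨b, h⟩ := hz1
    exact good_binary_zero h0 h1 h2 h3 h4 P hP hpos hne b h
  by_cases hz2 : ∃ b, P 0 1 b = 0
  · obtain ⟨b, h⟩ := hz2
    have := good_binary_zero h4 h3 h2 h1 h0 (fun x y z => P x z y)
      (fun x y z => by simp only [hP]; ring) (fun x y z => hpos _ _ _)
      (by obtain ⟨x, y, z, h⟩ := hne; exact ⟨x, z, y, h⟩) b h
    refine this.comp 1 0 0 0 0 1 0 1 0 (fun x y z => ?_) (fun x y z => ?_)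
    · congr 1 <;> ring
    · exact ⟨x, z, y, by ring, by ring, by ring⟩
  push Not at hz1 hz2
  have hhom : ∀ t y z, P 0 (t * y) (t * z) = t ^ 4 * P 0 y z := by
    intro t y z; simp only [hP]; ring
  have hcont : Continuous fun u : ℝ × ℝ => P 0 u.1 u.2 := by
    simp only [hP]; fun_prop
  obtain ⟨ε, hε, hε'⟩ := pos_cmp2 (fun y z => P 0 y z) (fun y z => y ^ 4) 4 hcont (by fun_prop)
    hhom (by intros; ring) (by norm_num) (by
      intro y z h
      by_contra hne
      by_cases hz : z = 0
      · have hy : y ≠ 0 := fun hy => hne ⟨hy, hz⟩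
        apply hz2 (y⁻¹ * z)
        have := hhom y⁻¹ y z
        rwa [inv_mul_cancel₀ hy, h, mul_zero] at this
      · apply hz1 (z⁻¹ * y)
        have := hhom z⁻¹ y z
        rwa [inv_mul_cancel₀ hz, h, mul_zero] at this) (fun y z => hpos _ _ _)
  refine ⟨fun x y z => √ε * y ^ 2, ⟨0, 0, 0, √ε, 0, 0, by intros; ring⟩,
    ⟨0, 1, 0, by simp; positivity⟩, fun x y z => ?_⟩
  rw [mul_pow, Real.sq_sqrt hε.le]
  have h1 := hε' y z
  have h2 : P x y z = P 0 y z := by simp only [hP]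
  rw [h2]
  linarith

/-- Quartics with a zero at `(1, 0, 0)`. -/
lemma good_zero_x (P : ℝ → ℝ → ℝ → ℝ) (hq : IsQuartic P) (hpos : ∀ x y z, 0 ≤ P x y z)
    (hne : ∃ x y z, P x y z ≠ 0) (hz : P 1 0 0 = 0) : Good P := by
  obtain ⟨a, b1, b2, f1, f2, f3, g0, g1, g2, g3, h0, h1, h2, h3, h4, hP⟩ := hq
  have ha : a = 0 := by
    rw [hP] at hz; linarith
  have hb1 : b1 = 0 := by
    apply lin_zero (c := f1) (d := 2 * g0) (e := h0)
    intro s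
    have := hpos 1 s 0
    rw [hP, ha] at this
    linarith
  have hb2 : b2 = 0 := by
    apply lin_zero (c := f3) (d := 2 * g3) (e := h4)
    intro s
    have := hpos 1 0 s
    rw [hP, ha] at this
    linarith
  subst ha hb1 hb2
  have hd : ∀ y z, 0 ≤ f1 * y ^ 2 + 2 * f2 * (y * z) + f3 * z ^ 2 ∧
      (g0 * y ^ 3 + g1 * (y ^ 2 * z) + g2 * (y * z ^ 2) + g3 * z ^ 3) ^ 2
      ≤ (f1 * y ^ 2 + 2 * f2 * (y * z) + f3 * z ^ 2) *
        (h0 * y ^ 4 + h1 * (y ^ 3 * z) + h2 * (y ^ 2 * z ^ 2) + h3 * (y * z ^ 3) + h4 * z ^ 4) := by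
    intro y z
    have := quad_nonneg (a := f1 * y ^ 2 + 2 * f2 * (y * z) + f3 * z ^ 2)
      (b := g0 * y ^ 3 + g1 * (y ^ 2 * z) + g2 * (y * z ^ 2) + g3 * z ^ 3)
      (c := h0 * y ^ 4 + h1 * (y ^ 3 * z) + h2 * (y ^ 2 * z ^ 2) + h3 * (y * z ^ 3) + h4 * z ^ 4)
      (fun x => by
        have := hpos x y z
        rw [hP] at this
        linarith)
    exact ⟨this.1, this.2.2⟩
  obtain ⟨p1, p3, p2⟩ := quad_nonneg (a := f1) (b := f2) (c := f3) (fun y => by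
    have := (hd y 1).1
    linarith)
  rcases p1.eq_or_lt with p1 | p1
  · have hf2 : f2 = 0 := by
      rw [← p1] at p2
      have : f2 ^ 2 = 0 := by nlinarith [sq_nonneg f2]
      simpa using this
    subst hf2
    subst p1
    rcases p3.eq_or_lt with p3 | p3
    · subst p3
      have hG : ∀ y z, g0 * y ^ 3 + g1 * (y ^ 2 * z) + g2 * (y * z ^ 2) + g3 * z ^ 3 = 0 := by
        intro y z
        have h := (hd y z).2
        have : (g0 * y ^ 3 + g1 * (y ^ 2 * z) + g2 * (y * z ^ 2) + g3 * z ^ 3) ^ 2 = 0 :=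
          le_antisymm (by linarith) (sq_nonneg _)
        simpa using this
      refine good_binary h0 h1 h2 h3 h4 P (fun x y z => ?_) hpos hne
      rw [hP, hG]; ring
    · have := good_one f3 g3 g2 g1 g0 h4 h3 h2 h1 h0 p3 (fun x y z => P x z y)
        (fun x y z => by simp only [hP]; ring) (fun x y z => hpos _ _ _)
      refine this.comp 1 0 0 0 0 1 0 1 0 (fun x y z => ?_) (fun x y z => ?_)
      · congr 1 <;> ring
      · exact ⟨x, z, y, by ring, by ring, by ring⟩
  · rcases p2.eq_or_lt with p2 | p2
    · obtain ⟨b, hb⟩ : ∃ b, b = - f2 / f1 := ⟨_, rfl⟩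
      have hb2 : f2 = - b * f1 := by rw [hb]; field_simp
      have hb3 : f3 = b ^ 2 * f1 := by
        have : f1 * f3 = f1 * (b ^ 2 * f1) := by rw [← p2, hb2]; ring
        exact mul_left_cancel₀ p1.ne' this
      have hgood : Good (fun x y z => P x (y + b * z) z) := by
        apply good_one f1 g0 (g1 + 3 * b * g0) (g2 + 2 * b * g1 + 3 * b ^ 2 * g0)
          (g3 + b * g2 + b ^ 2 * g1 + b ^ 3 * g0) h0 (h1 + 4 * b * h0)
          (h2 + 3 * b * h1 + 6 * b ^ 2 * h0)
          (h3 + 2 * b * h2 + 3 * b ^ 2 * h1 + 4 * b ^ 3 * h0)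
          (h4 + b * h3 + b ^ 2 * h2 + b ^ 3 * h1 + b ^ 4 * h0) p1 _ _ (fun x y z => hpos _ _ _)
        intro x y z
        simp only [hP, hb2, hb3]; ring
      refine hgood.comp 1 0 0 0 1 (-b) 0 0 1 (fun x y z => ?_) (fun x y z => ?_)
      · congr 1 <;> ring
      · exact ⟨x, y + b * z, z, by ring, by ring, by ring⟩
    · refine good_rank2 f1 f2 f3 g0 g1 g2 g3 h0 h1 h2 h3 h4 p1 (by linarith) P
        (fun x y z => ?_) hpos
      rw [hP]; ring

/-- Quartics with a zero having nonzero first coordinate. -/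
lemma good_zero_x' (P : ℝ → ℝ → ℝ → ℝ) (hq : IsQuartic P) (hpos : ∀ x y z, 0 ≤ P x y z)
    (hne : ∃ x y z, P x y z ≠ 0) (a b c : ℝ) (ha : a ≠ 0) (hz : P a b c = 0) : Good P := by
  have hhom : ∀ t x y z, P (t * x) (t * y) (t * z) = t ^ 4 * P x y z := by
    obtain ⟨_, _, _, _, _, _, _, _, _, _, _, _, _, _, _, hP⟩ := hq
    intro t x y z; simp only [hP]; ring
  obtain ⟨b', hb'⟩ : ∃ b', b' = a⁻¹ * b := ⟨_, rfl⟩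
  obtain ⟨c', hc'⟩ : ∃ c', c' = a⁻¹ * c := ⟨_, rfl⟩
  have hz' : P 1 b' c' = 0 := by
    have := hhom a⁻¹ a b c
    rwa [inv_mul_cancel₀ ha, hz, mul_zero, ← hb', ← hc'] at this
  have hq' : IsQuartic (fun x y z => P x (y + b' * x) (z + c' * x)) :=
    (((hq.swapYZ).shear c').swapYZ).shear b'
  have hgood := good_zero_x _ hq' (fun x y z => hpos _ _ _) (by
    obtain ⟨x, y, z, h⟩ := hne
    exact ⟨x, y - b' * x, z - c' * x, by simpa using h⟩) (by simpa using hz')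
  refine hgood.comp 1 0 0 (-b') 1 0 (-c') 0 1 (fun x y z => ?_) (fun x y z => ?_)
  · congr 1 <;> ring
  · exact ⟨x, y + b' * x, z + c' * x, by ring, by ring, by ring⟩

/-- Every nonzero nonnegative ternary quartic dominates the square of a nonzero quadratic form. -/
lemma good_quartic (P : ℝ → ℝ → ℝ → ℝ) (hq : IsQuartic P) (hpos : ∀ x y z, 0 ≤ P x y z)
    (hne : ∃ x y z, P x y z ≠ 0) : Good P := by
  by_cases hz : ∀ x y z, P x y z = 0 → x = 0 ∧ y = 0 ∧ z = 0
  · obtain ⟨a, b1, b2, f1, f2, f3, g0, g1, g2, g3, h0, h1, h2, h3, h4, hP⟩ := hq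
    obtain ⟨ε, hε, hε'⟩ := pos_cmp3 P (fun x y z => x ^ 4) 4 (by simp only [hP]; fun_prop)
      (by fun_prop) (by intro t x y z; simp only [hP]; ring) (by intros; ring) (by norm_num)
      hz hpos
    refine ⟨fun x y z => √ε * x ^ 2, ⟨√ε, 0, 0, 0, 0, 0, by intros; ring⟩,
      ⟨1, 0, 0, by simp; positivity⟩, fun x y z => ?_⟩
    rw [mul_pow, Real.sq_sqrt hε.le]
    have h1 := hε' x y z
    linarith
  · push Not at hz
    obtain ⟨a, b, c, h0, hn⟩ := hz
    by_cases ha : a = 0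
    · by_cases hb : b = 0
      · have hc := hn ha hb
        have hgood := good_zero_x' (fun x y z => P z y x) hq.swapXY.swapYZ.swapXY
          (fun x y z => hpos _ _ _) (by obtain ⟨x, y, z, h⟩ := hne; exact ⟨z, y, x, h⟩) c b a hc h0
        refine hgood.comp 0 0 1 0 1 0 1 0 0 (fun x y z => ?_) (fun x y z => ?_)
        · congr 1 <;> ring
        · exact ⟨z, y, x, by ring, by ring, by ring⟩
      · have hgood := good_zero_x' (fun x y z => P y x z) hq.swapXY
          (fun x y z => hpos _ _ _) (by obtain ⟨x, y, z, h⟩ := hne; exact ⟨y, x, z, h⟩) b a c hb h0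
        refine hgood.comp 0 1 0 1 0 0 0 0 1 (fun x y z => ?_) (fun x y z => ?_)
        · congr 1 <;> ring
        · exact ⟨y, x, z, by ring, by ring, by ring⟩
    · exact good_zero_x' P hq hpos hne a b c ha h0

open scoped MatrixOrder in
lemma psd_trace_mul {G C : Matrix (Fin 6) (Fin 6) ℝ} (hG : G.PosSemidef) (hC : C.PosSemidef) :
    0 ≤ (G * C).trace := by
  obtain ⟨B, rfl⟩ := CStarAlgebra.nonneg_iff_eq_star_mul_self.mp (Matrix.nonneg_iff_posSemidef.2 hG)
  rw [Matrix.star_eq_conjTranspose, Matrix.mul_assoc, Matrix.trace_mul_comm]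
  exact (hC.mul_mul_conjTranspose_same B).trace_nonneg

lemma gram_expand (B : Matrix (Fin 6) (Fin 6) ℝ) (hB : B.IsSymm) (x y z : ℝ) :
    v x y z ⬝ᵥ (B *ᵥ v x y z) = B 0 0 * x ^ 4
      + x ^ 3 * ((2 * B 0 1) * y + (2 * B 0 2) * z)
      + x ^ 2 * ((2 * B 0 3 + B 1 1) * y ^ 2 + 2 * (B 0 4 + B 1 2) * (y * z)
        + (2 * B 0 5 + B 2 2) * z ^ 2)
      + 2 * x * (B 1 3 * y ^ 3 + (B 1 4 + B 2 3) * (y ^ 2 * z) + (B 1 5 + B 2 4) * (y * z ^ 2)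
        + B 2 5 * z ^ 3)
      + (B 3 3 * y ^ 4 + 2 * B 3 4 * (y ^ 3 * z) + (2 * B 3 5 + B 4 4) * (y ^ 2 * z ^ 2)
        + 2 * B 4 5 * (y * z ^ 3) + B 5 5 * z ^ 4) := by
  have h : ∀ i j, B i j = B j i := fun i j => hB.apply j i
  simp only [v, dotProduct, mulVec, Fin.sum_univ_six]
  simp [h 1 0, h 2 0, h 3 0, h 4 0, h 5 0, h 2 1, h 3 1, h 4 1, h 5 1, h 3 2, h 4 2, h 5 2,
    h 4 3, h 5 3, h 5 4]
  ring

lemma trace_zero (B C : Matrix (Fin 6) (Fin 6) ℝ) (hB : B.IsSymm) (hCs : C.IsSymm)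
    (hC14 : C 0 3 = C 1 1) (hC15 : C 0 4 = C 1 2) (hC16 : C 0 5 = C 2 2)
    (hC25 : C 1 4 = C 2 3) (hC26 : C 1 5 = C 2 4) (hC46 : C 3 5 = C 4 4)
    (h0 : ∀ x y z, v x y z ⬝ᵥ (B *ᵥ v x y z) = 0) : (B * C).trace = 0 := by
  simp only [gram_expand B hB] at h0
  have e1 := h0 1 0 0
  have e2 := h0 0 1 0
  have e3 := h0 0 0 1
  have e4 := h0 1 1 0
  have e5 := h0 1 (-1) 0
  have e6 := h0 1 2 0
  have e7 := h0 1 0 1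
  have e8 := h0 1 0 (-1)
  have e9 := h0 1 0 2
  have e10 := h0 0 1 1
  have e11 := h0 0 1 (-1)
  have e12 := h0 0 1 2
  have e13 := h0 1 1 1
  have e14 := h0 1 1 (-1)
  have e15 := h0 1 (-1) 1
  ring_nf at e1 e2 e3 e4 e5 e6 e7 e8 e9 e10 e11 e12 e13 e14 e15
  have a1 : B 0 0 = 0 := by linarith
  have a2 : B 3 3 = 0 := by linarith
  have a3 : B 5 5 = 0 := by linarith
  have a4 : 2 * B 0 3 + B 1 1 = 0 := by linarith
  have a5 : B 0 1 = 0 := by linarith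
  have a6 : B 1 3 = 0 := by linarith
  have a7 : 2 * B 0 5 + B 2 2 = 0 := by linarith
  have a8 : B 0 2 = 0 := by linarith
  have a9 : B 2 5 = 0 := by linarith
  have a10 : 2 * B 3 5 + B 4 4 = 0 := by linarith
  have a11 : B 3 4 = 0 := by linarith
  have a12 : B 4 5 = 0 := by linarith
  have a13 : B 0 4 + B 1 2 = 0 := by linarith
  have a14 : B 1 4 + B 2 3 = 0 := by linarith
  have a15 : B 1 5 + B 2 4 = 0 := by linarith
  have h : ∀ i j, B i j = B j i := fun i j => hB.apply j i
  have k : ∀ i j, C i j = C j i := fun i j => hCs.apply j i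
  simp only [Matrix.trace, Matrix.diag, Matrix.mul_apply, Fin.sum_univ_six]
  rw [h 1 0, h 2 0, h 3 0, h 4 0, h 5 0, h 2 1, h 3 1, h 4 1, h 5 1, h 3 2, h 4 2, h 5 2,
    h 4 3, h 5 3, h 5 4, k 1 0, k 2 0, k 3 0, k 4 0, k 5 0, k 2 1, k 3 1, k 4 1, k 5 1, k 3 2,
    k 4 2, k 5 2, k 4 3, k 5 3, k 5 4, hC14, hC15, hC16, hC25, hC26, hC46]
  linear_combination C 0 0 * a1 + C 3 3 * a2 + C 5 5 * a3 + C 1 1 * a4 + 2 * C 0 1 * a5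
    + 2 * C 1 3 * a6 + C 2 2 * a7 + 2 * C 0 2 * a8 + 2 * C 2 5 * a9 + C 4 4 * a10
    + 2 * C 3 4 * a11 + 2 * C 4 5 * a12 + 2 * C 1 2 * a13 + 2 * C 2 3 * a14 + 2 * C 2 4 * a15

/-- The set of Gram matrices of sums of squares below `A`. -/
def gramSet (A : Matrix (Fin 6) (Fin 6) ℝ) : Set (Matrix (Fin 6) (Fin 6) ℝ) :=
  {G | G.IsSymm ∧ (∀ u : Fin 6 → ℝ, 0 ≤ u ⬝ᵥ (G *ᵥ u)) ∧
    ∀ x y z, v x y z ⬝ᵥ (G *ᵥ v x y z) ≤ v x y z ⬝ᵥ (A *ᵥ v x y z)}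

lemma gramSet_closed (A : Matrix (Fin 6) (Fin 6) ℝ) : IsClosed (gramSet A) := by
  have hc : ∀ u : Fin 6 → ℝ, Continuous fun G : Matrix (Fin 6) (Fin 6) ℝ => u ⬝ᵥ (G *ᵥ u) := by
    intro u; fun_prop
  have h1 : IsClosed {G : Matrix (Fin 6) (Fin 6) ℝ | G.IsSymm} :=
    isClosed_eq (by fun_prop) continuous_id
  have h2 : IsClosed {G : Matrix (Fin 6) (Fin 6) ℝ | ∀ u : Fin 6 → ℝ, 0 ≤ u ⬝ᵥ (G *ᵥ u)} := by
    simp only [Set.ofPred_forall]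
    exact isClosed_iInter fun u => isClosed_le continuous_const (hc u)
  have h3 : IsClosed {G : Matrix (Fin 6) (Fin 6) ℝ |
      ∀ x y z, v x y z ⬝ᵥ (G *ᵥ v x y z) ≤ v x y z ⬝ᵥ (A *ᵥ v x y z)} := by
    simp only [Set.ofPred_forall]
    exact isClosed_iInter fun x => isClosed_iInter fun y => isClosed_iInter fun z =>
      isClosed_le (hc _) continuous_const
  exact h1.inter (h2.inter h3)

lemma two_psd (G : Matrix (Fin 6) (Fin 6) ℝ) (hs : G.IsSymm)
    (hpsd : ∀ u : Fin 6 → ℝ, 0 ≤ u ⬝ᵥ (G *ᵥ u)) (i j : Fin 6) (a b : ℝ) :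
    0 ≤ a ^ 2 * G i i + 2 * (a * b) * G i j + b ^ 2 * G j j := by
  have := hpsd (Pi.single i a + Pi.single j b)
  simp [Matrix.mulVec_add, add_dotProduct] at this
  have h2 : G i j = G j i := hs.apply j i
  rw [← h2] at this
  linarith

lemma gramSet_compact (A : Matrix (Fin 6) (Fin 6) ℝ) : IsCompact (gramSet A) := by
  obtain ⟨p, hp⟩ : ∃ p : ℝ → ℝ → ℝ → ℝ, p = fun x y z => v x y z ⬝ᵥ (A *ᵥ v x y z) := ⟨_, rfl⟩
  obtain ⟨M, hM⟩ : ∃ M, M = |p 1 0 0| + |p 0 1 0| + |p 0 0 1| + |p 1 1 0| + |p 1 (-1) 0|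
    + |p 1 0 1| + |p 1 0 (-1)| + |p 0 1 1| + |p 0 1 (-1)| := ⟨_, rfl⟩
  have hbox : IsCompact (Set.pi Set.univ fun _ : Fin 6 => Set.pi Set.univ fun _ : Fin 6 =>
      Set.Icc (-M) M : Set (Fin 6 → Fin 6 → ℝ)) :=
    isCompact_univ_pi fun _ => isCompact_univ_pi fun _ => isCompact_Icc
  refine hbox.of_isClosed_subset (gramSet_closed A) ?_
  rintro G ⟨hs, hpsd, hle⟩
  have hs' : ∀ i j, G i j = G j i := fun i j => hs.apply j i
  have hle' : ∀ x y z, v x y z ⬝ᵥ (G *ᵥ v x y z) ≤ p x y z := by rw [hp]; exact hle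
  simp only [gram_expand G hs] at hle'
  have two := two_psd G hs hpsd
  have l1 := hle' 1 0 0
  have l2 := hle' 0 1 0
  have l3 := hle' 0 0 1
  have l4 := hle' 1 1 0
  have l5 := hle' 1 (-1) 0
  have l6 := hle' 1 0 1
  have l7 := hle' 1 0 (-1)
  have l8 := hle' 0 1 1
  have l9 := hle' 0 1 (-1)
  have m1 := two 0 3 1 1
  have m2 := two 0 5 1 1
  have m3 := two 3 5 1 1
  have A1 := le_abs_self (p 1 0 0)
  have A2 := le_abs_self (p 0 1 0)
  have A3 := le_abs_self (p 0 0 1)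
  have A4 := le_abs_self (p 1 1 0)
  have A5 := le_abs_self (p 1 (-1) 0)
  have A6 := le_abs_self (p 1 0 1)
  have A7 := le_abs_self (p 1 0 (-1))
  have A8 := le_abs_self (p 0 1 1)
  have A9 := le_abs_self (p 0 1 (-1))
  have B1 := abs_nonneg (p 1 0 0)
  have B2 := abs_nonneg (p 0 1 0)
  have B3 := abs_nonneg (p 0 0 1)
  have B4 := abs_nonneg (p 1 1 0)
  have B5 := abs_nonneg (p 1 (-1) 0)
  have B6 := abs_nonneg (p 1 0 1)
  have B7 := abs_nonneg (p 1 0 (-1))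
  have B8 := abs_nonneg (p 0 1 1)
  have B9 := abs_nonneg (p 0 1 (-1))
  norm_num at l1 l2 l3 l4 l5 l6 l7 l8 l9
  have hd : ∀ i, G i i ≤ M := by
    intro i
    fin_cases i <;> simp <;> linarith
  intro i _ j _
  have t1 := two i j 1 1
  have t2 := two i j 1 (-1)
  have d1 := hd i
  have d2 := hd j
  constructor <;> linarith

theorem trace_nonneg_on_cone (p : MvPolynomial (Fin 3) ℝ)
    (hhom : p.IsHomogeneous 4)
    (hpos : ∀ x : Fin 3 → ℝ, 0 ≤ MvPolynomial.eval x p)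
    (A : Matrix (Fin 6) (Fin 6) ℝ) (hAsymm : A.IsSymm)
    (hA : ∀ x y z : ℝ, MvPolynomial.eval ![x, y, z] p = v x y z ⬝ᵥ (A *ᵥ v x y z))
    (C : Matrix (Fin 6) (Fin 6) ℝ) (hC : C.PosSemidef)
    (hC14 : C 0 3 = C 1 1) (hC15 : C 0 4 = C 1 2) (hC16 : C 0 5 = C 2 2)
    (hC25 : C 1 4 = C 2 3) (hC26 : C 1 5 = C 2 4) (hC46 : C 3 5 = C 4 4) :
    0 ≤ Matrix.trace (A * C) := by
  have hA0 : ∀ x y z, 0 ≤ v x y z ⬝ᵥ (A *ᵥ v x y z) := fun x y z => by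
    rw [← hA]; exact hpos _
  have hne : (gramSet A).Nonempty :=
    ⟨0, Matrix.transpose_zero, fun u => by simp, fun x y z => by simpa using hA0 x y z⟩
  obtain ⟨G, ⟨hGs, hGp, hGle⟩, hmax⟩ := (gramSet_compact A).exists_isMaxOn hne
    (f := fun G : Matrix (Fin 6) (Fin 6) ℝ => G.trace) (by fun_prop)
  have hBs : (A - G).IsSymm := hAsymm.sub hGs
  have hPe : ∀ x y z, v x y z ⬝ᵥ ((A - G) *ᵥ v x y z)
      = v x y z ⬝ᵥ (A *ᵥ v x y z) - v x y z ⬝ᵥ (G *ᵥ v x y z) := by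
    intro x y z; rw [Matrix.sub_mulVec, dotProduct_sub]
  have hGpsd : G.PosSemidef := by
    apply Matrix.PosSemidef.of_dotProduct_mulVec_nonneg
    · rw [Matrix.IsHermitian, Matrix.conjTranspose_eq_transpose_of_trivial]; exact hGs
    · intro u; simpa using hGp u
  have hCs : C.IsSymm := by
    have := hC.isHermitian
    rwa [Matrix.IsHermitian, Matrix.conjTranspose_eq_transpose_of_trivial] at this
  by_cases hz : ∀ x y z, v x y z ⬝ᵥ ((A - G) *ᵥ v x y z) = 0
  · have h1 := trace_zero (A - G) C hBs hCs hC14 hC15 hC16 hC25 hC26 hC46 hz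
    rw [Matrix.sub_mul, Matrix.trace_sub] at h1
    have := psd_trace_mul hGpsd hC
    linarith
  · exfalso
    push Not at hz
    have hgood : Good (fun x y z => v x y z ⬝ᵥ ((A - G) *ᵥ v x y z)) :=
      good_quartic _ ⟨_, _, _, _, _, _, _, _, _, _, _, _, _, _, _, gram_expand _ hBs⟩
        (fun x y z => by rw [hPe]; linarith [hGle x y z]) hz
    obtain ⟨q, ⟨a, b, c, d, e, f, hq⟩, ⟨x0, y0, z0, hq0⟩, hqle⟩ := hgood
    set u : Fin 6 → ℝ := ![a, b, c, d, e, f] with hu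
    have hqu : ∀ x y z, q x y z = u ⬝ᵥ v x y z := by
      intro x y z
      rw [hq]
      simp [hu, v, dotProduct, Fin.sum_univ_six]
    have hvm : ∀ w : Fin 6 → ℝ, w ⬝ᵥ (Matrix.vecMulVec u u *ᵥ w) = (u ⬝ᵥ w) ^ 2 := by
      intro w
      rw [Matrix.vecMulVec_mulVec]
      simp [dotProduct_comm w u, sq]
    have hmem : G + Matrix.vecMulVec u u ∈ gramSet A := by
      refine ⟨hGs.add (Matrix.transpose_vecMulVec u u), fun w => ?_, fun x y z => ?_⟩
      · rw [Matrix.add_mulVec, dotProduct_add, hvm]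
        have := hGp w
        positivity
      · rw [Matrix.add_mulVec, dotProduct_add, hvm, ← hqu]
        have := hqle x y z
        simp only [hPe] at this
        linarith
    have hle : (G + Matrix.vecMulVec u u).trace ≤ G.trace := hmax hmem
    rw [Matrix.trace_add, Matrix.trace_vecMulVec] at hle
    have hu0 : u ⬝ᵥ u = 0 := by
      have : 0 ≤ u ⬝ᵥ u := Finset.sum_nonneg fun i _ => mul_self_nonneg _
      linarith
    rw [dotProduct_self_eq_zero] at hu0
    apply hq0
    rw [hqu, hu0, zero_dotProduct]
end
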